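/- Let G be a 2-connected planar simple graph with Δ(G) ≥ 5. Then G contains at least one of the configurations (A1), (A2), (A3), (A4). -/

import Mathlib

open SimpleGraph

/-- The degree of a vertex `v` of `G` (cardinality of its neighbor set). -/
noncomputable def deg {V : Type*} (G : SimpleGraph V) (v : V) : ℕ :=
  (G.neighborSet v).ncard

/-- The maximum degree `Δ(G)` of a finite graph `G`. -/
noncomputable def maxDeg {V : Type*} [Fintype V] (G : SimpleGraph V) : ℕ :=
  Finset.univ.sup fun v => deg G v

/-- The number of neighbors of `u` in `G` whose degree is exactly `k`. -/
noncomputable def nDegEq {V : Type*} (G : SimpleGraph V) (u : V) (k : ℕ) : ℕ :=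
  {w | w ∈ G.neighborSet u ∧ deg G w = k}.ncard

/-- The number of neighbors of `u` in `G` whose degree is at most `k`. -/
noncomputable def nDegLe {V : Type*} (G : SimpleGraph V) (u : V) (k : ℕ) : ℕ :=
  {w | w ∈ G.neighborSet u ∧ deg G w ≤ k}.ncard

/-- The number of neighbors of `u` in `G` whose degree is at least `k`. -/
noncomputable def nDegGe {V : Type*} (G : SimpleGraph V) (u : V) (k : ℕ) : ℕ :=
  {w | w ∈ G.neighborSet u ∧ k ≤ deg G w}.ncard

/-- `H` is a minor of `G`: there is a family of pairwise disjoint connected branch sets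
indexed by the vertices of `H`, with an edge of `G` between the branch sets of any two
adjacent vertices of `H`. -/
def IsMinorOf {W V : Type*} (H : SimpleGraph W) (G : SimpleGraph V) : Prop :=
  ∃ φ : W → Set V,
    (∀ w, (G.induce (φ w)).Connected) ∧
    (∀ w₁ w₂, w₁ ≠ w₂ → Disjoint (φ w₁) (φ w₂)) ∧
    ∀ ⦃w₁ w₂⦄, H.Adj w₁ w₂ → ∃ a ∈ φ w₁, ∃ b ∈ φ w₂, G.Adj a b

/-- A graph is planar iff it can be embedded in the plane; by Wagner's theorem this is
equivalent to having neither a `K₅` nor a `K₃,₃` minor. -/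
def IsPlanar {V : Type*} (G : SimpleGraph V) : Prop :=
  ¬ IsMinorOf (completeGraph (Fin 5)) G ∧
  ¬ IsMinorOf (completeBipartiteGraph (Fin 3) (Fin 3)) G

/-- A graph is 2-connected: it has at least 3 vertices and deleting any single vertex
leaves a connected graph. -/
def TwoConnected {V : Type*} [Fintype V] (G : SimpleGraph V) : Prop :=
  3 ≤ Fintype.card V ∧ ∀ v : V, (G.induce {w | w ≠ v}).Connected

/-- A proper edge coloring: distinct edges sharing a vertex get different colors. -/
def ProperEdgeColoring {V α : Type*} (G : SimpleGraph V) (c : Sym2 V → α) : Prop :=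
  ∀ e₁ ∈ G.edgeSet, ∀ e₂ ∈ G.edgeSet, e₁ ≠ e₂ → (∃ v, v ∈ e₁ ∧ v ∈ e₂) → c e₁ ≠ c e₂

/-- An acyclic edge coloring: a proper edge coloring with no bichromatic cycle. -/
def AcyclicEdgeColoring {V α : Type*} (G : SimpleGraph V) (c : Sym2 V → α) : Prop :=
  ProperEdgeColoring G c ∧
  ∀ (v : V) (w : G.Walk v v), w.IsCycle →
    ¬ ∃ i j : α, ∀ e ∈ w.edges, c e = i ∨ c e = j

/-- Configuration (A₁): a path `u v w` with `d(v) = 2` and `d(u) ≤ 9`. -/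
def ConfigA1 {V : Type*} (G : SimpleGraph V) : Prop :=
  ∃ u v w : V, G.Adj u v ∧ G.Adj v w ∧ u ≠ w ∧ deg G v = 2 ∧ deg G u ≤ 9

/-- Configuration (A₂). -/
def ConfigA2 {V : Type*} (G : SimpleGraph V) : Prop :=
  ∃ u : V, 1 ≤ nDegEq G u 2 ∧
    ((deg G u : ℤ) - 7 ≤ (nDegLe G u 8 : ℤ) ∨
     ((nDegLe G u 8 : ℤ) = (deg G u : ℤ) - 8 ∧ (deg G u : ℤ) - 9 ≤ (nDegEq G u 2 : ℤ)))

/-- Configuration (A₃). -/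
def ConfigA3 {V : Type*} (G : SimpleGraph V) : Prop :=
  ∃ u v : V, G.Adj u v ∧ deg G u = 3 ∧
    (deg G v ≤ 8 ∨
     (deg G v = 9 ∧ ∃ w, G.Adj u w ∧ G.Adj v w) ∨
     (deg G v = 10 ∧ 5 ≤ nDegLe G v 5 ∧
       ∃ w₁ w₂, w₁ ≠ w₂ ∧ G.Adj u w₁ ∧ G.Adj v w₁ ∧ G.Adj u w₂ ∧ G.Adj v w₂))

/-- Configuration (A₄). -/
def ConfigA4 {V : Type*} (G : SimpleGraph V) : Prop :=
  (∃ v u v₂ v₃ v₄ : V,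
     deg G v = 4 ∧
     G.Adj v u ∧ G.Adj v v₂ ∧ G.Adj v v₃ ∧ G.Adj v v₄ ∧
     ([u, v₂, v₃, v₄] : List V).Pairwise (· ≠ ·) ∧
     deg G u ≤ deg G v₂ ∧ deg G v₂ ≤ deg G v₃ ∧ deg G v₃ ≤ deg G v₄ ∧
     4 ≤ deg G u ∧ deg G u ≤ 7 ∧ deg G u + deg G v₂ ≤ 17) ∨
  (∃ v u v₂ v₃ v₄ v₅ : V,
     deg G v = 5 ∧
     G.Adj v u ∧ G.Adj v v₂ ∧ G.Adj v v₃ ∧ G.Adj v v₄ ∧ G.Adj v v₅ ∧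
     ([u, v₂, v₃, v₄, v₅] : List V).Pairwise (· ≠ ·) ∧
     deg G u ≤ deg G v₂ ∧ deg G v₂ ≤ deg G v₃ ∧ deg G v₃ ≤ deg G v₄ ∧
       deg G v₄ ≤ deg G v₅ ∧
     ((4 ≤ deg G u ∧ deg G u ≤ 6 ∧ deg G u + deg G v₂ + deg G v₃ ≤ 18) ∨
      (deg G u = 6 ∧ deg G v₂ = 6 ∧ deg G v₃ = 7 ∧ deg G v₄ = 7 ∧ deg G v₅ = 7 ∧
        G.Adj u v₅)))

theorem List.IsChain.of_isInfix {α : Type*} {R : α → α → Prop} {l l' : List α}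
    (h : l.IsChain R) (hl : l' <:+: l) : l'.IsChain R := by
  obtain ⟨s, t, rfl⟩ := hl
  exact (List.isChain_append.1 (List.isChain_append.1 h).1).2.1

namespace Triangulation

variable {V : Type*}

section Rot

variable [DecidableEq V]

/-- The three rotations of an oriented triangle. -/
def rot (a b c : V) : Finset (V × V × V) := {(a, b, c), (b, c, a), (c, a, b)}

theorem mem_rot {a b c x y z : V} : (a, b, c) ∈ rot x y z ↔
    (a = x ∧ b = y ∧ c = z) ∨ (a = y ∧ b = z ∧ c = x) ∨ (a = z ∧ b = x ∧ c = y) := by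
  simp [rot]

theorem card_rot {a b c : V} (h : a ≠ b) : (rot a b c).card = 3 := by
  rw [rot, Finset.card_eq_three]
  refine ⟨_, _, _, ?_, ?_, ?_, rfl⟩ <;> grind

end Rot

/-- `S` is the set of oriented triangles of a triangulation of the sphere with vertex set `A`:
an oriented closed surface (`cyc`, `uniq`, `rev`) with connected vertex links, connected and of
Euler characteristic two. -/
structure IsSphere (A : Finset V) (S : Finset (V × V × V)) : Prop where
  cyc : ∀ {a b c}, (a, b, c) ∈ S → (b, c, a) ∈ S
  ne : ∀ {a b c}, (a, b, c) ∈ S → a ≠ b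
  uniq : ∀ {a b c d}, (a, b, c) ∈ S → (a, b, d) ∈ S → c = d
  rev : ∀ {a b c}, (a, b, c) ∈ S → ∃ d, (b, a, d) ∈ S
  mem : ∀ {a b c}, (a, b, c) ∈ S → a ∈ A
  link : ∀ (v : V) (P : V → Prop), (∀ b c, (v, b, c) ∈ S → P b → P c) →
    ∀ b c b' c', (v, b, c) ∈ S → (v, b', c') ∈ S → P b → P b'
  conn : ∀ P : V → Prop, (∀ a b c, (a, b, c) ∈ S → P a → P b) →
    ∀ a ∈ A, ∀ b ∈ A, P a → P b
  card : S.card + 12 = 6 * A.card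

namespace IsSphere

variable {A : Finset V} {S : Finset (V × V × V)}

theorem cyc' (h : IsSphere A S) {a b c : V} (h1 : (a, b, c) ∈ S) : (c, a, b) ∈ S :=
  h.cyc (h.cyc h1)

theorem ne₂ (h : IsSphere A S) {a b c : V} (h1 : (a, b, c) ∈ S) : b ≠ c := h.ne (h.cyc h1)

theorem ne₃ (h : IsSphere A S) {a b c : V} (h1 : (a, b, c) ∈ S) : c ≠ a := h.ne (h.cyc' h1)

theorem mem₂ (h : IsSphere A S) {a b c : V} (h1 : (a, b, c) ∈ S) : b ∈ A := h.mem (h.cyc h1)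

theorem mem₃ (h : IsSphere A S) {a b c : V} (h1 : (a, b, c) ∈ S) : c ∈ A := h.mem (h.cyc' h1)

theorem prev_uniq (h : IsSphere A S) {a b c d : V} (h1 : (a, b, c) ∈ S) (h2 : (a, d, c) ∈ S) :
    b = d := h.uniq (h.cyc' h1) (h.cyc' h2)

theorem exists_next (h : IsSphere A S) {a b c : V} (h1 : (a, b, c) ∈ S) : ∃ d, (a, c, d) ∈ S :=
  h.rev (h.cyc' h1)

theorem exists_prev (h : IsSphere A S) {a b c : V} (h1 : (a, b, c) ∈ S) : ∃ d, (a, d, b) ∈ S := by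
  obtain ⟨d, hd⟩ := h.rev h1
  exact ⟨d, h.cyc hd⟩

theorem rot_subset [DecidableEq V] (h : IsSphere A S) {a b c : V}
    (h1 : (a, b, c) ∈ S) : rot a b c ⊆ S := by
  intro ⟨x, y, z⟩ hx
  rw [mem_rot] at hx
  have := h.cyc h1
  have := h.cyc' h1
  grind

theorem exists_edge (h : IsSphere A S) (hA : 2 ≤ A.card) {a : V} (ha : a ∈ A) :
    ∃ b c, (a, b, c) ∈ S := by
  by_contra! hcon
  obtain ⟨b, hb, hne⟩ := Finset.exists_mem_ne (by omega : 1 < A.card) a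
  exact hne (h.conn (· = a) (by grind) a ha b hb rfl)

/-- Reversing the orientation. -/
def mirror (S : Finset (V × V × V)) : Finset (V × V × V) :=
  S.map ⟨fun t => (t.2.1, t.1, t.2.2), fun x y h => by grind⟩

theorem mem_mirror {a b c : V} : (a, b, c) ∈ mirror S ↔ (b, a, c) ∈ S := by
  simp only [mirror, Finset.mem_map, Prod.exists]
  constructor
  · rintro ⟨x, y, z, h, h'⟩
    cases h'
    exact h
  · exact fun h => ⟨b, a, c, h, rfl⟩

theorem isSphere_mirror (h : IsSphere A S) : IsSphere A (mirror S) where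
  cyc h1 := by rw [mem_mirror] at *; exact h.cyc' h1
  ne h1 := by rw [mem_mirror] at *; exact (h.ne h1).symm
  uniq h1 h2 := by rw [mem_mirror] at *; exact h.uniq h1 h2
  rev h1 := by
    rw [mem_mirror] at *
    obtain ⟨d, hd⟩ := h.rev h1
    exact ⟨d, mem_mirror.2 hd⟩
  mem h1 := by rw [mem_mirror] at *; exact h.mem₂ h1
  link v P hP b c b' c' h1 h2 hb := by
    simp only [mem_mirror] at *
    by_contra hb'
    have h3 := h.rev h1
    have h4 := h.rev h2
    obtain ⟨d, hd⟩ := h3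
    obtain ⟨d', hd'⟩ := h4
    refine h.link v (fun x => ¬ P x) (fun x y hxy hx hy => hx ?_) b' d' b d hd' hd hb' hb
    exact hP y x (h.cyc' hxy) hy
  conn P hP a ha b hb := by
    refine h.conn P (fun x y z hxy hx => ?_) a ha b hb
    obtain ⟨d, hd⟩ := h.rev hxy
    exact hP x y d (mem_mirror.2 hd) hx
  card := by rw [mirror, Finset.card_map]; exact h.card

end IsSphere

/-- The boundary of a tetrahedron. -/
theorem isSphere_tetrahedron [DecidableEq V] {a b c d : V} (hab : a ≠ b) (hac : a ≠ c)
    (had : a ≠ d) (hbc : b ≠ c) (hbd : b ≠ d) (hcd : c ≠ d) :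
    IsSphere {a, b, c, d} (rot a b c ∪ rot b a d ∪ rot c b d ∪ rot a c d) := by
  have key : ∀ {x y z}, (x, y, z) ∈ rot a b c ∪ rot b a d ∪ rot c b d ∪ rot a c d ↔
      x = a ∧ (y = b ∧ z = c ∨ y = c ∧ z = d ∨ y = d ∧ z = b) ∨
      x = b ∧ (y = c ∧ z = a ∨ y = a ∧ z = d ∨ y = d ∧ z = c) ∨
      x = c ∧ (y = a ∧ z = b ∨ y = b ∧ z = d ∨ y = d ∧ z = a) ∨
      x = d ∧ (y = b ∧ z = a ∨ y = c ∧ z = b ∨ y = a ∧ z = c) := by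
    intro x y z
    simp only [Finset.mem_union, mem_rot]
    constructor
    · rintro ((((⟨rfl, rfl, rfl⟩ | ⟨rfl, rfl, rfl⟩ | ⟨rfl, rfl, rfl⟩) |
        (⟨rfl, rfl, rfl⟩ | ⟨rfl, rfl, rfl⟩ | ⟨rfl, rfl, rfl⟩)) |
        (⟨rfl, rfl, rfl⟩ | ⟨rfl, rfl, rfl⟩ | ⟨rfl, rfl, rfl⟩)) |
        (⟨rfl, rfl, rfl⟩ | ⟨rfl, rfl, rfl⟩ | ⟨rfl, rfl, rfl⟩)) <;> simp
    · rintro (⟨rfl, ⟨rfl, rfl⟩ | ⟨rfl, rfl⟩ | ⟨rfl, rfl⟩⟩ |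
        ⟨rfl, ⟨rfl, rfl⟩ | ⟨rfl, rfl⟩ | ⟨rfl, rfl⟩⟩ | ⟨rfl, ⟨rfl, rfl⟩ | ⟨rfl, rfl⟩ | ⟨rfl, rfl⟩⟩ |
        ⟨rfl, ⟨rfl, rfl⟩ | ⟨rfl, rfl⟩ | ⟨rfl, rfl⟩⟩) <;> simp
  refine ⟨?_, ?_, ?_, ?_, ?_, ?_, ?_, ?_⟩
  · intro x y z h
    rw [key] at h
    rcases h with ⟨rfl, h⟩ | ⟨rfl, h⟩ | ⟨rfl, h⟩ | ⟨rfl, h⟩ <;>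
    rcases h with ⟨rfl, rfl⟩ | ⟨rfl, rfl⟩ | ⟨rfl, rfl⟩ <;> simp only [key] <;> simp
  · intro x y z h; rw [key] at h
    rcases h with ⟨rfl, h⟩ | ⟨rfl, h⟩ | ⟨rfl, h⟩ | ⟨rfl, h⟩ <;>
    rcases h with ⟨rfl, rfl⟩ | ⟨rfl, rfl⟩ | ⟨rfl, rfl⟩ <;> first | assumption | (symm; assumption)
  · intro x y z w h h'; rw [key] at *
    rcases h with ⟨rfl, h⟩ | ⟨rfl, h⟩ | ⟨rfl, h⟩ | ⟨rfl, h⟩ <;>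
    rcases h with ⟨rfl, rfl⟩ | ⟨rfl, rfl⟩ | ⟨rfl, rfl⟩ <;>
    simp_all [eq_comm]
  · intro x y z h; simp only [key] at *
    rcases h with ⟨rfl, h⟩ | ⟨rfl, h⟩ | ⟨rfl, h⟩ | ⟨rfl, h⟩ <;>
    rcases h with ⟨rfl, rfl⟩ | ⟨rfl, rfl⟩ | ⟨rfl, rfl⟩ <;>
    simp_all [eq_comm]
  · intro x y z h
    rw [key] at h
    rcases h with ⟨rfl, -⟩ | ⟨rfl, -⟩ | ⟨rfl, -⟩ | ⟨rfl, -⟩ <;> simp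
  · intro v P hP x y x' y' h h' hx
    have tri : ∀ p q r : V, (v, p, q) ∈ rot a b c ∪ rot b a d ∪ rot c b d ∪ rot a c d →
        (v, q, r) ∈ rot a b c ∪ rot b a d ∪ rot c b d ∪ rot a c d →
        (v, r, p) ∈ rot a b c ∪ rot b a d ∪ rot c b d ∪ rot a c d →
        (x = p ∨ x = q ∨ x = r) → (x' = p ∨ x' = q ∨ x' = r) → P x' := by
      intro p q r h1 h2 h3 h4 h5
      have := hP _ _ h1
      have := hP _ _ h2
      have := hP _ _ h3
      clear key h h' h1 h2 h3 hP
      rcases h4 with rfl | rfl | rfl <;> rcases h5 with rfl | rfl | rfl <;> tauto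
    simp only [key] at h h'
    rcases h with ⟨rfl, h⟩ | ⟨rfl, h⟩ | ⟨rfl, h⟩ | ⟨rfl, h⟩ <;>
    simp only [hab, hac, had, hbc, hbd, hcd, hab.symm, hac.symm, had.symm, hbc.symm, hbd.symm,
      hcd.symm, false_and, false_or, or_false, true_and] at h'
    · exact tri b c d (key.2 (by simp)) (key.2 (by simp)) (key.2 (by simp))
        (by rcases h with ⟨rfl, -⟩ | ⟨rfl, -⟩ | ⟨rfl, -⟩ <;> simp)
        (by rcases h' with ⟨rfl, -⟩ | ⟨rfl, -⟩ | ⟨rfl, -⟩ <;> simp)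
    · exact tri c a d (key.2 (by simp)) (key.2 (by simp)) (key.2 (by simp))
        (by rcases h with ⟨rfl, -⟩ | ⟨rfl, -⟩ | ⟨rfl, -⟩ <;> simp)
        (by rcases h' with ⟨rfl, -⟩ | ⟨rfl, -⟩ | ⟨rfl, -⟩ <;> simp)
    · exact tri a b d (key.2 (by simp)) (key.2 (by simp)) (key.2 (by simp))
        (by rcases h with ⟨rfl, -⟩ | ⟨rfl, -⟩ | ⟨rfl, -⟩ <;> simp)
        (by rcases h' with ⟨rfl, -⟩ | ⟨rfl, -⟩ | ⟨rfl, -⟩ <;> simp)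
    · exact tri b a c (key.2 (by simp)) (key.2 (by simp)) (key.2 (by simp))
        (by rcases h with ⟨rfl, -⟩ | ⟨rfl, -⟩ | ⟨rfl, -⟩ <;> simp)
        (by rcases h' with ⟨rfl, -⟩ | ⟨rfl, -⟩ | ⟨rfl, -⟩ <;> simp)
  · intro P hP
    have h1 := hP a b c (key.2 (by simp))
    have h2 := hP b c a (key.2 (by simp))
    have h3 := hP c d a (key.2 (by simp))
    have h4 := hP d a c (key.2 (by simp))
    clear key hP
    intro x hx y hy
    simp only [Finset.mem_insert, Finset.mem_singleton] at hx hy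
    rcases hx with rfl | rfl | rfl | rfl <;> rcases hy with rfl | rfl | rfl | rfl <;> tauto
  · rw [Finset.card_union_of_disjoint, Finset.card_union_of_disjoint, Finset.card_union_of_disjoint,
      card_rot, card_rot, card_rot, card_rot]
    · rw [Finset.card_eq_succ.2 ⟨a, {b, c, d}, by simp_all, rfl, Finset.card_eq_three.2
        ⟨b, c, d, hbc, hbd, hcd, rfl⟩⟩]
    all_goals first | assumption | (symm; assumption) | skip
    all_goals
      rw [Finset.disjoint_left]; rintro ⟨x, y, z⟩ h h'
      simp only [Finset.mem_union, mem_rot] at *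
      grind

end Triangulation

namespace Triangulation

variable {V : Type*} {A B : Finset V} {S T : Finset (V × V × V)}

theorem rot_rotate [DecidableEq V] (a b c : V) : rot b c a = rot a b c := by
  ext ⟨x, y, z⟩
  simp only [mem_rot]
  grind

namespace IsSphere

theorem link_of_removed (h : IsSphere A S) {v b c : V} (hv : (v, b, c) ∈ S) {P : V → Prop}
    (hP : ∀ x y, (v, x, y) ∈ S → ¬ (x = b ∧ y = c) → P x → P y) :
    (P c → ∀ x y, (v, x, y) ∈ S → P x) ∧ ((∃ x y, (v, x, y) ∈ S ∧ P x) → P b) := by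
  constructor
  · intro hc x y hxy
    obtain ⟨d, hd⟩ := h.exists_next hv
    exact h.link v P (fun x y hxy hx => by grind) c d x y hd hxy hc
  · rintro ⟨x, y, hxy, hx⟩
    by_contra hb
    exact hb (h.link v P (fun x y hxy hx => by grind) x y b c hxy hv hx)

variable [DecidableEq V]

theorem glue_link_aux (h : IsSphere A S) (k : IsSphere B T) {a b c : V}
    (hS : (a, b, c) ∈ S) (hT : (b, a, c) ∈ T) (P : V → Prop)
    (hP : ∀ x y, (a, x, y) ∈ (S \ rot a b c) ∪ (T \ rot b a c) → P x → P y) {x y x' y' : V}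
    (h1 : (a, x, y) ∈ S ∨ (a, x, y) ∈ T) (h2 : (a, x', y') ∈ S ∨ (a, x', y') ∈ T) (hx : P x) :
    P x' := by
  have hab := h.ne hS
  have hac := (h.ne₃ hS).symm
  simp only [Finset.mem_union, Finset.mem_sdiff, mem_rot] at hP
  have hT' := k.cyc hT
  obtain ⟨s1, s2⟩ := h.link_of_removed hS (P := P) (fun x y hxy hn => hP x y (by grind))
  obtain ⟨t1, t2⟩ := k.link_of_removed hT' (P := P) (fun x y hxy hn => hP x y (by grind))
  have hb : P b := by
    rcases h1 with h1 | h1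
    · exact s2 ⟨_, _, h1, hx⟩
    · obtain ⟨d, hd⟩ := h.exists_next hS
      exact s1 (t2 ⟨_, _, h1, hx⟩) _ _ hS
  have hc : P c := t1 hb _ _ hT'
  rcases h2 with h2 | h2
  · exact s1 hc _ _ h2
  · exact t1 hb _ _ h2

set_option maxHeartbeats 800000 in
/-- The connected sum of two spheres along a common triangle. -/
theorem glue (h : IsSphere A S) (k : IsSphere B T) {a b c : V} (hAB : A ∩ B = {a, b, c})
    (hS : (a, b, c) ∈ S) (hT : (b, a, c) ∈ T) :
    IsSphere (A ∪ B) ((S \ rot a b c) ∪ (T \ rot b a c)) := by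
  have hab := h.ne hS
  have hbc := h.ne₂ hS
  have hca := h.ne₃ hS
  have hI : ∀ x, x ∈ A → x ∈ B → x = a ∨ x = b ∨ x = c := by
    intro x h1 h2
    simpa [hAB] using Finset.mem_inter.2 ⟨h1, h2⟩
  have hS' := h.cyc hS
  have hS'' := h.cyc' hS
  have hT' := k.cyc hT
  have hT'' := k.cyc' hT
  have disj : ∀ x y z w, (x, y, z) ∈ S → (x, y, w) ∈ T →
      (x, y, z) ∈ rot a b c ∨ (x, y, w) ∈ rot b a c := by
    intro x y z w h1 h2
    have e1 := hI x (h.mem h1) (k.mem h2)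
    have e2 := hI y (h.mem₂ h1) (k.mem₂ h2)
    have e3 := h.ne h1
    simp only [mem_rot]
    have e4 := @h.uniq x y
    have e5 := @k.uniq x y
    rcases e1 with rfl | rfl | rfl <;> rcases e2 with rfl | rfl | rfl <;> grind
  refine ⟨?_, ?_, ?_, ?_, ?_, ?_, ?_, ?_⟩
  · intro x y z hx
    simp only [Finset.mem_union, Finset.mem_sdiff, mem_rot] at *
    have := @h.cyc x y z
    have := @k.cyc x y z
    grind
  · intro x y z hx
    simp only [Finset.mem_union, Finset.mem_sdiff] at hx
    rcases hx with hx | hx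
    · exact h.ne hx.1
    · exact k.ne hx.1
  · intro x y z w h1 h2
    simp only [Finset.mem_union, Finset.mem_sdiff] at h1 h2
    rcases h1 with h1 | h1 <;> rcases h2 with h2 | h2
    · exact h.uniq h1.1 h2.1
    · exact ((disj _ _ _ _ h1.1 h2.1).elim h1.2 h2.2).elim
    · exact ((disj _ _ _ _ h2.1 h1.1).elim h2.2 h1.2).elim
    · exact k.uniq h1.1 h2.1
  · intro x y z hx
    simp only [Finset.mem_union, Finset.mem_sdiff] at *
    rcases hx with hx | hx
    · obtain ⟨d, hd⟩ := h.rev hx.1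
      by_cases hr : (y, x, d) ∈ rot a b c
      · rw [mem_rot] at hr
        rcases hr with ⟨rfl, rfl, rfl⟩ | ⟨rfl, rfl, rfl⟩ | ⟨rfl, rfl, rfl⟩
        · obtain ⟨e, he⟩ := k.rev hT
          exact ⟨e, Or.inr ⟨he, by rw [mem_rot]; grind⟩⟩
        · obtain ⟨e, he⟩ := k.rev hT''
          exact ⟨e, Or.inr ⟨he, by rw [mem_rot]; grind⟩⟩
        · obtain ⟨e, he⟩ := k.rev hT'
          exact ⟨e, Or.inr ⟨he, by rw [mem_rot]; grind⟩⟩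
      · exact ⟨d, Or.inl ⟨hd, hr⟩⟩
    · obtain ⟨d, hd⟩ := k.rev hx.1
      by_cases hr : (y, x, d) ∈ rot b a c
      · rw [mem_rot] at hr
        rcases hr with ⟨rfl, rfl, rfl⟩ | ⟨rfl, rfl, rfl⟩ | ⟨rfl, rfl, rfl⟩
        · obtain ⟨e, he⟩ := h.rev hS
          exact ⟨e, Or.inl ⟨he, by rw [mem_rot]; grind⟩⟩
        · obtain ⟨e, he⟩ := h.rev hS''
          exact ⟨e, Or.inl ⟨he, by rw [mem_rot]; grind⟩⟩
        · obtain ⟨e, he⟩ := h.rev hS'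
          exact ⟨e, Or.inl ⟨he, by rw [mem_rot]; grind⟩⟩
      · exact ⟨d, Or.inr ⟨hd, hr⟩⟩
  · intro x y z hx
    simp only [Finset.mem_union, Finset.mem_sdiff] at *
    rcases hx with hx | hx
    · exact Or.inl (h.mem hx.1)
    · exact Or.inr (k.mem hx.1)
  · intro v P hP x y x' y' h1 h2 hx
    have h1' : (v, x, y) ∈ S ∨ (v, x, y) ∈ T := by
      simp only [Finset.mem_union, Finset.mem_sdiff] at h1; exact h1.imp And.left And.left
    have h2' : (v, x', y') ∈ S ∨ (v, x', y') ∈ T := by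
      simp only [Finset.mem_union, Finset.mem_sdiff] at h2; exact h2.imp And.left And.left
    by_cases hv : v = a ∨ v = b ∨ v = c
    · rcases hv with rfl | rfl | rfl
      · exact glue_link_aux h k hS hT P hP h1' h2' hx
      · exact glue_link_aux h k hS' hT'' P (by rwa [rot_rotate, ← rot_rotate c _ _]) h1' h2' hx
      · exact glue_link_aux h k hS'' hT' P (by rwa [rot_rotate b v a, rot_rotate a b v,
          rot_rotate b a v]) h1' h2' hx
    · simp only [Finset.mem_union, Finset.mem_sdiff, mem_rot] at hP
      by_cases hvA : v ∈ A
      · have hvB : v ∉ B := fun hB => hv (hI v hvA hB)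
        have n : ∀ x y, (v, x, y) ∉ T := fun x y hm => hvB (k.mem hm)
        exact h.link v P (fun x y hxy => hP x y (by grind)) x y x' y'
          (h1'.resolve_right (n _ _)) (h2'.resolve_right (n _ _)) hx
      · have n : ∀ x y, (v, x, y) ∉ S := fun x y hm => hvA (h.mem hm)
        exact k.link v P (fun x y hxy => hP x y (by grind)) x y x' y'
          (h1'.resolve_left (n _ _)) (h2'.resolve_left (n _ _)) hx
  · intro P hP
    simp only [Finset.mem_union, Finset.mem_sdiff] at hP
    have dT : ∀ x y z w, (x, y, z) ∈ rot a b c → (y, x, w) ∈ S → P y → P x := by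
      intro x y z w hr hs hy
      exact hP y x w (Or.inl ⟨hs, by rw [mem_rot] at *; grind⟩) hy
    have dS : ∀ x y z w, (x, y, z) ∈ rot b a c → (y, x, w) ∈ T → P y → P x := by
      intro x y z w hr hs hy
      exact hP y x w (Or.inr ⟨hs, by rw [mem_rot] at *; grind⟩) hy
    obtain ⟨e1, he1⟩ := h.rev hS
    obtain ⟨e2, he2⟩ := h.rev hS'
    obtain ⟨e3, he3⟩ := h.rev hS''
    obtain ⟨f1, hf1⟩ := k.rev hT
    obtain ⟨f2, hf2⟩ := k.rev hT'
    obtain ⟨f3, hf3⟩ := k.rev hT''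
    have g1 := dT a b c _ (by simp [mem_rot]) he1
    have g2 := dT b c a _ (by simp [mem_rot]) he2
    have g3 := dT c a b _ (by simp [mem_rot]) he3
    have i1 := dS b a c _ (by simp [mem_rot]) hf1
    have i2 := dS a c b _ (by simp [mem_rot]) hf2
    have i3 := dS c b a _ (by simp [mem_rot]) hf3
    have cS : ∀ x y z, (x, y, z) ∈ S → P x → P y := by
      intro x y z hx
      by_cases hr : (x, y, z) ∈ rot a b c
      · rw [mem_rot] at hr; grind
      · exact hP x y z (Or.inl ⟨hx, hr⟩)
    have cT : ∀ x y z, (x, y, z) ∈ T → P x → P y := by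
      intro x y z hx
      by_cases hr : (x, y, z) ∈ rot b a c
      · rw [mem_rot] at hr; grind
      · exact hP x y z (Or.inr ⟨hx, hr⟩)
    have hcS := h.conn P cS
    have hcT := k.conn P cT
    have haA := h.mem hS
    have haB := k.mem₂ hT
    intro x hx y hy hpx
    rw [Finset.mem_union] at hx hy
    have hpa : P a := by
      rcases hx with hx | hx
      · exact hcS x hx a haA hpx
      · exact hcT x hx a haB hpx
    rcases hy with hy | hy
    · exact hcS a haA y hy hpa
    · exact hcT a haB y hy hpa
  · have d : Disjoint (S \ rot a b c) (T \ rot b a c) := by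
      rw [Finset.disjoint_left]
      rintro ⟨x, y, z⟩ h1 h2
      rw [Finset.mem_sdiff] at h1 h2
      have := disj x y z z h1.1 h2.1
      tauto
    have c1 := Finset.card_sdiff_add_card_eq_card (h.rot_subset hS)
    have c2 := Finset.card_sdiff_add_card_eq_card (k.rot_subset hT)
    have c3 := Finset.card_union_add_card_inter A B
    rw [hAB, Finset.card_eq_three.2 ⟨a, b, c, hab, hca.symm, hbc, rfl⟩] at c3
    rw [card_rot hab] at c1
    rw [card_rot hab.symm] at c2
    rw [Finset.card_union_of_disjoint d]
    have := h.card
    have := k.card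
    omega

end IsSphere

end Triangulation

namespace Triangulation

variable {V : Type*} {A B : Finset V} {S T : Finset (V × V × V)}

/-- The faces obtained from `S` by replacing the diagonal `p q` of the quadrilateral `p r q z`
by the diagonal `z r`. -/
def flip [DecidableEq V] (S : Finset (V × V × V)) (p q z r : V) : Finset (V × V × V) :=
  (S \ (rot p q z ∪ rot q p r)) ∪ (rot z p r ∪ rot r q z)

theorem mem_flip [DecidableEq V] {p q z r a b c : V} : (a, b, c) ∈ flip S p q z r ↔
    ((a, b, c) ∈ S ∧ (a, b, c) ∉ rot p q z ∧ (a, b, c) ∉ rot q p r) ∨ (a, b, c) ∈ rot z p r ∨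
      (a, b, c) ∈ rot r q z := by
  simp only [flip, Finset.mem_union, Finset.mem_sdiff, not_or]

theorem flip_swap [DecidableEq V] (S : Finset (V × V × V)) (p q z r : V) :
    flip S q p r z = flip S p q z r := by
  rw [flip, flip, Finset.union_comm (rot q p r), Finset.union_comm (rot z p r)]

namespace IsSphere

variable [DecidableEq V]

theorem flip_link_diag (h : IsSphere A S) {p q z r : V} (h1 : (p, q, z) ∈ S) (h2 : (q, p, r) ∈ S)
    {P : V → Prop} (hP : ∀ b c, (p, b, c) ∈ flip S p q z r → P b → P c) {b c b' c' : V}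
    (hb : (p, b, c) ∈ flip S p q z r) (hb' : (p, b', c') ∈ flip S p q z r) (hPb : P b) :
    P b' := by
  have e1 := h.ne h1
  have e2 := h.ne₂ h1
  have e3 := h.ne₃ h1
  have e4 := h.ne₂ h2
  have e5 := h.ne₃ h2
  have h2' := h.cyc h2
  have hrz : P r → P z := hP r z (by simp [mem_flip, mem_rot])
  have inS : ∀ b c, (p, b, c) ∈ flip S p q z r → b ≠ q ∧ ∃ c', (p, b, c') ∈ S := by
    intro b c hb
    have := @h.uniq p q
    rw [mem_flip, mem_rot, mem_rot, mem_rot, mem_rot] at hb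
    grind
  obtain ⟨n, d, hd⟩ := inS _ _ hb
  obtain ⟨n', d', hd'⟩ := inS _ _ hb'
  have := h.link p (fun x => if x = q then P r else P x) ?_ b d b' d' hd hd' (by simpa [n])
  · simpa [n'] using this
  · intro x y hxy
    have u1 := @h.uniq p q
    have u2 := @h.prev_uniq _ _ _ p
    by_cases hx : x = q
    · subst hx
      have := h.uniq hxy h1
      subst this
      simpa [e2.symm] using hrz
    · by_cases hy : y = q
      · subst hy
        have := h.prev_uniq hxy h2'
        subst this
        simp [hx]
      · simp only [hx, hy, if_false]
        exact hP x y (by rw [mem_flip, mem_rot, mem_rot]; grind)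

theorem flip_link_apex (h : IsSphere A S) {p q z r : V} (h1 : (p, q, z) ∈ S) (h2 : (q, p, r) ∈ S)
    (hzr : z ≠ r) {P : V → Prop} (hP : ∀ b c, (z, b, c) ∈ flip S p q z r → P b → P c)
    {b c b' c' : V} (hb : (z, b, c) ∈ flip S p q z r) (hb' : (z, b', c') ∈ flip S p q z r)
    (hPb : P b) : P b' := by
  have e1 := h.ne h1
  have e2 := h.ne₂ h1
  have e3 := h.ne₃ h1
  have e4 := h.ne₂ h2
  have e5 := h.ne₃ h2
  have h1' := h.cyc' h1
  obtain ⟨w, hw⟩ := h.exists_next h1'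
  have pr : P p → P r := hP p r (by simp [mem_flip, mem_rot])
  have rq : P r → P q := hP r q (by simp [mem_flip, mem_rot])
  have inS : ∀ b c, (z, b, c) ∈ flip S p q z r → b = r ∨ ∃ c', (z, b, c') ∈ S := by
    intro b c hb
    rw [mem_flip, mem_rot, mem_rot, mem_rot, mem_rot] at hb
    grind
  have cl : ∀ x y, (z, x, y) ∈ S → P x → P y := by
    intro x y hxy hx
    by_cases hxp : x = p
    · subst hxp
      rw [h.uniq hxy h1']
      exact rq (pr hx)
    · exact hP x y (by rw [mem_flip, mem_rot, mem_rot]; grind) hx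
  have key := h.link z P cl
  have hp : P p := by
    rcases inS _ _ hb with rfl | ⟨d, hd⟩
    · exact key _ _ _ _ hw h1' (rq hPb)
    · exact key _ _ _ _ hd h1' hPb
  rcases inS _ _ hb' with rfl | ⟨d, hd⟩
  · exact pr hp
  · exact key _ _ _ _ h1' hd hp

set_option maxHeartbeats 800000 in
/-- Flipping an edge of a triangulated sphere. -/
theorem isSphere_flip (h : IsSphere A S) {p q z r : V} (h1 : (p, q, z) ∈ S) (h2 : (q, p, r) ∈ S)
    (hzr : z ≠ r) (hn : ∀ w, (z, r, w) ∉ S) : IsSphere A (flip S p q z r) := by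
  have e1 := h.ne h1
  have e2 := h.ne₂ h1
  have e3 := h.ne₃ h1
  have e4 := h.ne₂ h2
  have e5 := h.ne₃ h2
  have h1' := h.cyc h1
  have h1'' := h.cyc' h1
  have h2' := h.cyc h2
  have h2'' := h.cyc' h2
  have hn' : ∀ w, (r, z, w) ∉ S := fun w hw => by
    obtain ⟨d, hd⟩ := h.rev hw
    exact hn d hd
  refine ⟨?_, ?_, ?_, ?_, ?_, ?_, ?_, ?_⟩
  · intro x y w hx
    rw [mem_flip, mem_rot, mem_rot, mem_rot, mem_rot] at *
    have := @h.cyc x y w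
    grind
  · intro x y w hx
    rw [mem_flip, mem_rot, mem_rot, mem_rot, mem_rot] at *
    have := @h.ne x y w
    grind
  · have key : ∀ x y w w', ((x, y, w) ∈ rot z p r ∨ (x, y, w) ∈ rot r q z) →
        (x, y, w') ∈ S → (x, y, w') ∈ rot p q z ∨ (x, y, w') ∈ rot q p r := by
      intro x y w w' hx hs
      rw [mem_rot, mem_rot] at hx
      rw [mem_rot, mem_rot]
      rcases hx with (⟨rfl, rfl, -⟩ | ⟨rfl, rfl, -⟩ | ⟨rfl, rfl, -⟩) |
        (⟨rfl, rfl, -⟩ | ⟨rfl, rfl, -⟩ | ⟨rfl, rfl, -⟩)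
      · simp [h.uniq hs h1'']
      · simp [h.uniq hs h2']
      · exact (hn' _ hs).elim
      · simp [h.uniq hs h2'']
      · simp [h.uniq hs h1']
      · exact (hn _ hs).elim
    intro x y w w' hx hx'
    rw [mem_flip] at hx hx'
    rcases hx with hx | hx <;> rcases hx' with hx' | hx'
    · exact h.uniq hx.1 hx'.1
    · have := key _ _ _ _ hx' hx.1
      tauto
    · have := key _ _ _ _ hx hx'.1
      tauto
    · rw [mem_rot, mem_rot] at hx hx'
      grind
  · have key : ∀ x y w, (x, y, w) ∈ S → ¬ (x = p ∧ y = q) → ¬ (x = q ∧ y = p) →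
        ∃ d, (x, y, d) ∈ flip S p q z r := by
      intro x y w hx n1 n2
      by_cases hr : (x, y, w) ∉ rot p q z ∧ (x, y, w) ∉ rot q p r
      · exact ⟨w, mem_flip.2 (Or.inl ⟨hx, hr⟩)⟩
      · simp only [mem_flip, mem_rot] at *
        grind
    intro x y w hx
    rcases mem_flip.1 hx with hs | hs
    · obtain ⟨d, hd⟩ := h.rev hs.1
      have u1 := @h.uniq x y
      rw [mem_rot, mem_rot] at hs
      exact key y x d hd (by grind) (by grind)
    · have hzr1 : (z, r, q) ∈ flip S p q z r := by simp [mem_flip, mem_rot]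
      have hzr2 : (r, z, p) ∈ flip S p q z r := by simp [mem_flip, mem_rot]
      rw [mem_rot, mem_rot] at hs
      by_cases hd : (x = z ∧ y = r) ∨ (x = r ∧ y = z)
      · rcases hd with ⟨rfl, rfl⟩ | ⟨rfl, rfl⟩
        · exact ⟨_, hzr2⟩
        · exact ⟨_, hzr1⟩
      · obtain ⟨u, hu⟩ : ∃ u, (x, y, u) ∈ S := by grind
        obtain ⟨d, hd⟩ := h.rev hu
        exact key y x d hd (by grind) (by grind)
  · intro x y w hx
    have := h.mem h1
    have := h.mem₂ h1
    have := h.mem₃ h1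
    have := h.mem₃ h2
    rw [mem_flip, mem_rot, mem_rot, mem_rot, mem_rot] at *
    have := @h.mem x y w
    grind
  · intro v P hP x y x' y' hx hx' hpx
    by_cases hv : v = p ∨ v = q ∨ v = z ∨ v = r
    · rcases hv with rfl | rfl | rfl | rfl
      · exact h.flip_link_diag h1 h2 hP hx hx' hpx
      · rw [← flip_swap] at *
        exact h.flip_link_diag h2 h1 hP hx hx' hpx
      · exact h.flip_link_apex h1 h2 hzr hP hx hx' hpx
      · rw [← flip_swap] at *
        exact h.flip_link_apex h2 h1 hzr.symm hP hx hx' hpx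
    · have key : ∀ x y, (v, x, y) ∈ flip S p q z r ↔ (v, x, y) ∈ S := by
        intro x y
        rw [mem_flip, mem_rot, mem_rot, mem_rot, mem_rot]
        grind
      simp only [key] at *
      exact h.link v P hP x y x' y' hx hx' hpx
  · intro P hP
    have pr : P p → P r := hP p r z (by simp [mem_flip, mem_rot])
    have rq : P r → P q := hP r q z (by simp [mem_flip, mem_rot])
    have qz : P q → P z := hP q z r (by simp [mem_flip, mem_rot])
    have zp : P z → P p := hP z p r (by simp [mem_flip, mem_rot])
    refine h.conn P fun x y w hx hpx => ?_
    by_cases hr : (x, y, w) ∉ rot p q z ∧ (x, y, w) ∉ rot q p r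
    · exact hP x y w (mem_flip.2 (Or.inl ⟨hx, hr⟩)) hpx
    · rw [mem_rot, mem_rot] at hr
      grind
  · have d1 : Disjoint (rot p q z) (rot q p r) := by
      rw [Finset.disjoint_left]
      rintro ⟨x, y, w⟩ h1 h2
      rw [mem_rot] at h1 h2
      grind
    have d2 : Disjoint (rot z p r) (rot r q z) := by
      rw [Finset.disjoint_left]
      rintro ⟨x, y, w⟩ h1 h2
      rw [mem_rot] at h1 h2
      grind
    have d3 : Disjoint (S \ (rot p q z ∪ rot q p r)) (rot z p r ∪ rot r q z) := by
      rw [Finset.disjoint_left]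
      rintro ⟨x, y, w⟩ h1 h2
      simp only [Finset.mem_union, Finset.mem_sdiff, mem_rot] at h1 h2
      have := @h.uniq x y w
      grind
    have c1 := Finset.card_sdiff_add_card_eq_card
      (Finset.union_subset (h.rot_subset h1) (h.rot_subset h2))
    rw [Finset.card_union_of_disjoint d1, card_rot e1, card_rot e1.symm] at c1
    rw [flip, Finset.card_union_of_disjoint d3, Finset.card_union_of_disjoint d2, card_rot e3,
      card_rot e5]
    · have := h.card
      omega

end IsSphere

end Triangulation

namespace Triangulation

variable {V : Type*} {A B : Finset V} {S T : Finset (V × V × V)}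

/-- Adjacency in the graph underlying a triangulation. -/
def IsEdge (S : Finset (V × V × V)) (a b : V) : Prop := ∃ c, (a, b, c) ∈ S

namespace IsSphere

theorem edge_symm (h : IsSphere A S) {a b : V} (he : IsEdge S a b) : IsEdge S b a := by
  obtain ⟨c, hc⟩ := he
  exact h.rev hc

theorem edge₂ (h : IsSphere A S) {a b c : V} (hc : (a, b, c) ∈ S) : IsEdge S b c := ⟨a, h.cyc hc⟩

theorem edge₃ (h : IsSphere A S) {a b c : V} (hc : (a, b, c) ∈ S) : IsEdge S a c :=
  h.edge_symm ⟨b, h.cyc' hc⟩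

theorem edge_ne (h : IsSphere A S) {a b : V} (he : IsEdge S a b) : a ≠ b := h.ne he.choose_spec

theorem edge_mem (h : IsSphere A S) {a b : V} (he : IsEdge S a b) : a ∈ A := h.mem he.choose_spec

theorem mirror_edge (h : IsSphere A S) {a b : V} (he : IsEdge S a b) : IsEdge (mirror S) a b := by
  obtain ⟨c, hc⟩ := h.edge_symm he
  exact ⟨c, mem_mirror.2 hc⟩

variable [DecidableEq V]

theorem flip_edge {p q z r x y : V} (he : IsEdge S x y) (n1 : ¬ (x = p ∧ y = q))
    (n2 : ¬ (x = q ∧ y = p)) : IsEdge (flip S p q z r) x y := by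
  obtain ⟨w, hx⟩ := he
  by_cases hr : (x, y, w) ∉ rot p q z ∧ (x, y, w) ∉ rot q p r
  · exact ⟨w, mem_flip.2 (Or.inl ⟨hx, hr⟩)⟩
  · simp only [IsEdge, mem_flip, mem_rot] at *
    grind

theorem glue_edge_left (h : IsSphere A S) (k : IsSphere B T) {a b c : V}
    (hS : (a, b, c) ∈ S) (hT : (b, a, c) ∈ T) {x y : V} (he : IsEdge S x y) :
    IsEdge ((S \ rot a b c) ∪ (T \ rot b a c)) x y := by
  obtain ⟨z, hz⟩ := he
  by_cases hr : (x, y, z) ∈ rot a b c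
  · have e1 := h.ne hS
    have e2 := h.ne₂ hS
    have e3 := h.ne₃ hS
    obtain ⟨w, hw⟩ := k.rev (k.rot_subset hT (show (y, x, z) ∈ rot b a c by
      rw [mem_rot] at *; grind))
    refine ⟨w, ?_⟩
    rw [Finset.mem_union, Finset.mem_sdiff, Finset.mem_sdiff]
    refine Or.inr ⟨hw, ?_⟩
    rw [mem_rot] at *
    grind
  · exact ⟨z, by rw [Finset.mem_union, Finset.mem_sdiff]; exact Or.inl ⟨hz, hr⟩⟩

theorem glue_edge_right (h : IsSphere A S) (k : IsSphere B T) {a b c : V}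
    (hS : (a, b, c) ∈ S) (hT : (b, a, c) ∈ T) {x y : V} (he : IsEdge T x y) :
    IsEdge ((S \ rot a b c) ∪ (T \ rot b a c)) x y := by
  rw [Finset.union_comm]
  exact k.glue_edge_left h hT hS he

/-- Inserting a new vertex into a face. -/
theorem exists_insert (h : IsSphere A S) {a b c v : V} (hS : (a, b, c) ∈ S) (hv : v ∉ A) :
    ∃ T, IsSphere (insert v A) T ∧ (∀ x y, IsEdge S x y → IsEdge T x y) ∧
      (∀ t ∈ S, t ∉ rot a b c → t ∈ T) ∧ (∀ x, IsEdge T x v → x = a ∨ x = b ∨ x = c) ∧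
      (a, b, v) ∈ T ∧ (b, c, v) ∈ T ∧ (c, a, v) ∈ T := by
  have ha := h.mem hS
  have hb := h.mem₂ hS
  have hc := h.mem₃ hS
  have hab := h.ne hS
  have hbc := h.ne₂ hS
  have hca := h.ne₃ hS
  have k := isSphere_tetrahedron hab.symm hbc (fun e : b = v => hv (e ▸ hb)) hca.symm
    (fun e : a = v => hv (e ▸ ha)) (fun e : c = v => hv (e ▸ hc))
  have hT : (b, a, c) ∈ rot b a c ∪ rot a b v ∪ rot c a v ∪ rot b c v := by simp [mem_rot]
  have hI : A ∩ {b, a, c, v} = {a, b, c} := by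
    ext x
    simp only [Finset.mem_inter, Finset.mem_insert, Finset.mem_singleton]
    grind
  refine ⟨_, ?_, fun x y => h.glue_edge_left k hS hT, ?_, ?_, ?_, ?_, ?_⟩
  · convert h.glue k hI hS hT using 1
    ext x
    simp only [Finset.mem_union, Finset.mem_insert, Finset.mem_singleton]
    grind
  · intro t ht hr
    exact Finset.mem_union_left _ (Finset.mem_sdiff.2 ⟨ht, hr⟩)
  · rintro x ⟨w, hw⟩
    rcases Finset.mem_union.1 hw with hw | hw
    · exact (hv (h.mem₂ (Finset.mem_sdiff.1 hw).1)).elim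
    · have h1 := k.mem (Finset.mem_sdiff.1 hw).1
      have h2 := k.ne (Finset.mem_sdiff.1 hw).1
      simp only [Finset.mem_insert, Finset.mem_singleton] at h1
      tauto
  all_goals
    refine Finset.mem_union_right _ (Finset.mem_sdiff.2 ⟨by simp [mem_rot], ?_⟩)
    rw [mem_rot]
    grind

/-- Inserting up to three vertices, keeping a given part of a face together. -/
theorem exists_insert_of_card (Y : Finset V) : ∀ {A : Finset V} {S : Finset (V × V × V)}
    {X : Finset V} {a b c : V}, IsSphere A S → (a, b, c) ∈ S → X ⊆ {a, b, c} →
    (∀ y ∈ Y, y ∉ A) → X.card + Y.card ≤ 3 →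
    ∃ T, IsSphere (A ∪ Y) T ∧ (∀ x y, IsEdge S x y → IsEdge T x y) ∧
      ∃ a b c, (a, b, c) ∈ T ∧ X ∪ Y ⊆ {a, b, c} := by
  induction Y using Finset.induction_on with
  | empty => exact fun h hS hX _ _ => ⟨_, by simpa, fun _ _ => id, _, _, _, hS, by simpa⟩
  | insert v Y hv ih =>
    intro A S X a b c h hS hX hY hcard
    rw [Finset.card_insert_of_notMem hv] at hcard
    have hvA := hY v (by simp)
    obtain ⟨T, hT, hE, -, -, h1, h2, h3⟩ := h.exists_insert hS hvA
    obtain ⟨a', b', hf, hX'⟩ : ∃ a' b', (a', b', v) ∈ T ∧ X ⊆ {a', b'} := by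
      have hne : ∃ u ∈ ({a, b, c} : Finset V), u ∉ X := by
        by_contra! hcon
        have := Finset.card_le_card hcon
        rw [Finset.card_eq_three.2 ⟨a, b, c, h.ne hS, (h.ne₃ hS).symm, h.ne₂ hS, rfl⟩] at this
        omega
      obtain ⟨u, hu, huX⟩ := hne
      simp only [Finset.mem_insert, Finset.mem_singleton] at hu
      rcases hu with rfl | rfl | rfl
      · refine ⟨b, c, h2, fun x hx => ?_⟩
        have := hX hx
        simp only [Finset.mem_insert, Finset.mem_singleton] at *
        grind
      · refine ⟨c, a, h3, fun x hx => ?_⟩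
        have := hX hx
        simp only [Finset.mem_insert, Finset.mem_singleton] at *
        grind
      · refine ⟨a, b, h1, fun x hx => ?_⟩
        have := hX hx
        simp only [Finset.mem_insert, Finset.mem_singleton] at *
        grind
    have hcX := Finset.card_insert_le v X
    obtain ⟨T', hT', hE', a'', b'', c'', hf', hX''⟩ := ih (X := insert v X) hT hf (by
        intro x hx
        simp only [Finset.mem_insert, Finset.mem_singleton] at *
        rcases hx with rfl | hx
        · simp
        · have := hX' hx
          simp only [Finset.mem_insert, Finset.mem_singleton] at this
          tauto) (by
        intro y hy
        have := hY y (by simp [hy])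
        rw [Finset.mem_insert]
        rintro (rfl | h)
        · exact hv hy
        · exact this h) (by omega)
    refine ⟨T', ?_, fun x y hxy => hE' _ _ (hE _ _ hxy), a'', b'', c'', hf', ?_⟩
    · rwa [Finset.union_insert, ← Finset.insert_union]
    · rwa [Finset.union_insert, ← Finset.insert_union]

end IsSphere

end Triangulation

namespace Triangulation

variable {V : Type*} [DecidableEq V] {A B : Finset V} {S T : Finset (V × V × V)}

/-- The unoriented edges of a triangulation. -/
def edges (S : Finset (V × V × V)) : Finset (Sym2 V) := S.image fun t => s(t.1, t.2.1)

/-- The faces of a triangulation. -/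
def faces (S : Finset (V × V × V)) : Finset (Finset (V × V × V)) :=
  S.image fun t => rot t.1 t.2.1 t.2.2

/-- The edge below a dart. -/
def edgeOf (t : S) : edges S := ⟨s(t.1.1, t.1.2.1), Finset.mem_image_of_mem _ t.2⟩

/-- The face to the left of a dart. -/
def faceOf (t : S) : faces S := ⟨rot t.1.1 t.1.2.1 t.1.2.2, Finset.mem_image_of_mem _ t.2⟩

theorem edgeOf_surjective : Function.Surjective (edgeOf (S := S)) := by
  rintro ⟨e, he⟩
  obtain ⟨t, ht, rfl⟩ := Finset.mem_image.1 he
  exact ⟨⟨t, ht⟩, rfl⟩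

theorem faceOf_surjective : Function.Surjective (faceOf (S := S)) := by
  rintro ⟨e, he⟩
  obtain ⟨t, ht, rfl⟩ := Finset.mem_image.1 he
  exact ⟨⟨t, ht⟩, rfl⟩

namespace IsSphere

theorem card_faces (h : IsSphere A S) : 3 * (faces S).card = S.card := by
  rw [Finset.card_eq_sum_card_image (fun t => rot t.1 t.2.1 t.2.2) S, ← faces,
    Finset.sum_const_nat (m := 3), mul_comm]
  intro x hx
  obtain ⟨⟨a, b, c⟩, ht, rfl⟩ := Finset.mem_image.1 hx
  rw [← card_rot (h.ne ht) (c := c)]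
  congr 1
  ext ⟨x, y, z⟩
  rw [Finset.mem_filter]
  constructor
  · rintro ⟨-, h2⟩
    simp only at h2
    rw [← h2]
    simp [mem_rot]
  · intro hr
    refine ⟨h.rot_subset ht hr, ?_⟩
    rw [mem_rot] at hr
    rcases hr with ⟨rfl, rfl, rfl⟩ | ⟨rfl, rfl, rfl⟩ | ⟨rfl, rfl, rfl⟩
    · rfl
    · exact rot_rotate _ _ _
    · exact (rot_rotate _ _ _).symm

theorem card_edges (h : IsSphere A S) : 2 * (edges S).card = S.card := by
  rw [Finset.card_eq_sum_card_image (fun t => s(t.1, t.2.1)) S, ← edges,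
    Finset.sum_const_nat (m := 2), mul_comm]
  intro x hx
  obtain ⟨⟨a, b, c⟩, ht, rfl⟩ := Finset.mem_image.1 hx
  obtain ⟨d, hd⟩ := h.rev ht
  have hab := h.ne ht
  rw [Finset.card_eq_two]
  refine ⟨(a, b, c), (b, a, d), by simp [hab], ?_⟩
  ext ⟨x, y, z⟩
  simp only [Finset.mem_filter, Finset.mem_insert, Finset.mem_singleton, Prod.mk.injEq,
    Sym2.eq_iff]
  constructor
  · rintro ⟨h1, ⟨rfl, rfl⟩ | ⟨rfl, rfl⟩⟩
    · simp [h.uniq h1 ht]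
    · simp [h.uniq h1 hd]
  · rintro (⟨rfl, rfl, rfl⟩ | ⟨rfl, rfl, rfl⟩)
    · exact ⟨ht, by simp⟩
    · exact ⟨hd, by simp⟩

/-- The reverse dart. -/
noncomputable def revDart (h : IsSphere A S) (t : S) : S :=
  ⟨(t.1.2.1, t.1.1, (h.rev t.2).choose), (h.rev t.2).choose_spec⟩

theorem revDart_eq (h : IsSphere A S) {a b c d : V} (h1 : (a, b, c) ∈ S) (h2 : (b, a, d) ∈ S) :
    h.revDart ⟨(a, b, c), h1⟩ = ⟨(b, a, d), h2⟩ := by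
  have := h.uniq h2 (h.rev h1).choose_spec
  subst this
  rfl

theorem revDart_revDart (h : IsSphere A S) (t : S) : h.revDart (h.revDart t) = t := by
  obtain ⟨⟨a, b, c⟩, ht⟩ := t
  obtain ⟨d, hd⟩ := h.rev ht
  rw [h.revDart_eq ht hd, h.revDart_eq hd ht]

theorem edgeOf_eq_iff (h : IsSphere A S) {t t' : S} :
    edgeOf t' = edgeOf t ↔ t' = t ∨ t' = h.revDart t := by
  obtain ⟨⟨a, b, c⟩, ht⟩ := t
  obtain ⟨⟨x, y, z⟩, ht'⟩ := t'
  obtain ⟨d, hd⟩ := h.rev ht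
  rw [h.revDart_eq ht hd]
  simp only [edgeOf, Subtype.ext_iff, Sym2.eq_iff, Prod.mk.injEq]
  constructor
  · rintro (⟨rfl, rfl⟩ | ⟨rfl, rfl⟩)
    · simp [h.uniq ht ht']
    · simp [h.uniq hd ht']
  · tauto

/-- The sum of the two face values along each edge. -/
noncomputable def bdry (h : IsSphere A S) : (faces S → ZMod 2) →ₗ[ZMod 2] (edges S → ZMod 2) where
  toFun f e := f (faceOf (Function.surjInv edgeOf_surjective e)) +
    f (faceOf (h.revDart (Function.surjInv edgeOf_surjective e)))
  map_add' f g := by ext e; simp only [Pi.add_apply]; ring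
  map_smul' r f := by ext e; simp [mul_add]

theorem bdry_apply (h : IsSphere A S) (f : faces S → ZMod 2) (t : S) :
    h.bdry f (edgeOf t) = f (faceOf t) + f (faceOf (h.revDart t)) := by
  simp only [bdry, LinearMap.coe_mk, AddHom.coe_mk]
  rcases h.edgeOf_eq_iff.1 (Function.surjInv_eq edgeOf_surjective (edgeOf t)) with e | e
  · rw [e]
  · rw [e, revDart_revDart, add_comm]

end IsSphere

/-- The sum of the edge values around each vertex. -/
def cobdry (A : Finset V) (S : Finset (V × V × V)) :
    (edges S → ZMod 2) →ₗ[ZMod 2] (A → ZMod 2) where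
  toFun g v := ∑ t : S with t.1.1 = (v : V), g (edgeOf t)
  map_add' f g := by ext e; simp [Finset.sum_add_distrib]
  map_smul' r f := by ext e; simp [Finset.mul_sum]

theorem cobdry_apply (g : edges S → ZMod 2) (v : A) :
    cobdry A S g v = ∑ t : S with t.1.1 = (v : V), g (edgeOf t) := rfl

namespace IsSphere

/-- The next dart around the initial vertex. -/
noncomputable def nextDart (h : IsSphere A S) (t : S) : S :=
  ⟨((h.revDart t).1.2.1, (h.revDart t).1.2.2, (h.revDart t).1.1), h.cyc (h.revDart t).2⟩

theorem nextDart_injective (h : IsSphere A S) : Function.Injective h.nextDart := by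
  intro t t' ht
  rw [← h.revDart_revDart t, ← h.revDart_revDart t']
  congr 1
  simp only [nextDart, Subtype.mk.injEq, Prod.mk.injEq] at ht
  ext
  exacts [ht.2.2, ht.1, ht.2.1]

theorem faceOf_nextDart (h : IsSphere A S) (t : S) :
    faceOf (h.nextDart t) = faceOf (h.revDart t) :=
  Subtype.ext (rot_rotate _ _ _)

theorem range_bdry_le (h : IsSphere A S) :
    LinearMap.range h.bdry ≤ LinearMap.ker (cobdry A S) := by
  rintro _ ⟨f, rfl⟩
  rw [LinearMap.mem_ker]
  ext v
  simp only [cobdry_apply, h.bdry_apply, Finset.sum_add_distrib, Pi.zero_apply]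
  rw [← Finset.sum_bijective h.nextDart (Finite.injective_iff_bijective.1 h.nextDart_injective)
    (s := {t : S | t.1.1 = (v : V)}) (t := {t : S | t.1.1 = (v : V)})
    (f := fun t => f (faceOf (h.revDart t))) (g := fun t => f (faceOf t))]
  · exact CharTwo.add_self_eq_zero _
  · intro t
    simp only [Finset.mem_filter, Finset.mem_univ, true_and]
    rfl
  · intro t _
    rw [h.faceOf_nextDart]

theorem ker_bdry_le (h : IsSphere A S) :
    LinearMap.ker h.bdry ≤ Submodule.span (ZMod 2) {fun _ => 1} := by
  intro f hf
  rw [LinearMap.mem_ker] at hf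
  have hr : ∀ t, f (faceOf (h.revDart t)) = f (faceOf t) := by
    intro t
    have := congrFun hf (edgeOf t)
    rw [h.bdry_apply, Pi.zero_apply] at this
    exact (CharTwo.add_eq_zero.1 this).symm
  rcases isEmpty_or_nonempty S with hS | ⟨⟨⟨a, b, c⟩, h0⟩⟩
  · have : f = 0 := by
      ext x
      obtain ⟨t, -⟩ := faceOf_surjective x
      exact hS.elim t
    rw [this]
    exact zero_mem _
  rw [Submodule.mem_span_singleton]
  set z := f (faceOf ⟨_, h0⟩) with hz
  refine ⟨z, ?_⟩
  ext x
  obtain ⟨⟨⟨u, v, w⟩, ht⟩, rfl⟩ := faceOf_surjective x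
  simp only [Pi.smul_apply, smul_eq_mul, mul_one]
  have hlink : ∀ v b c, (v, b, c) ∈ S → (∃ hb : (v, b, c) ∈ S, f (faceOf ⟨_, hb⟩) = z) →
      ∀ b' c', ∀ h' : (v, b', c') ∈ S, f (faceOf ⟨_, h'⟩) = z := by
    rintro v b c - ⟨hb, hfb⟩ b' c' h'
    have := h.link v (fun x => ∃ y, ∃ hy : (v, x, y) ∈ S, f (faceOf ⟨_, hy⟩) = z) ?_ b c b' c' hb h'
      ⟨_, _, hfb⟩
    · obtain ⟨y, hy, h1⟩ := this
      have := h.uniq hy h'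
      subst this
      exact h1
    · rintro x y hxy ⟨y', hy', h1⟩
      have := h.uniq hxy hy'
      subst this
      obtain ⟨d, hd⟩ := h.exists_next hxy
      refine ⟨d, hd, ?_⟩
      rw [← h1, ← hr ⟨_, hd⟩, h.revDart_eq hd (h.cyc' hxy)]
      congr 1
      exact Subtype.ext (rot_rotate _ _ _).symm
  refine (h.conn (fun u => ∀ v w, ∀ hw : (u, v, w) ∈ S, f (faceOf ⟨_, hw⟩) = z) ?_ a (h.mem h0) u
    (h.mem ht) (hlink _ _ _ h0 ⟨h0, hz.symm⟩) v w ht).symm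
  intro u v w hw hu
  refine hlink v w u (h.cyc hw) ⟨h.cyc hw, ?_⟩
  rw [← hu _ _ hw]
  congr 1
  exact Subtype.ext (rot_rotate _ _ _)

theorem cobdry_single (h : IsSphere A S) {a b c : V} (ht : (a, b, c) ∈ S) :
    cobdry A S (Pi.single (edgeOf ⟨_, ht⟩) 1) =
      Pi.single ⟨a, h.mem ht⟩ 1 + Pi.single ⟨b, h.mem₂ ht⟩ 1 := by
  ext v
  obtain ⟨d, hd⟩ := h.rev ht
  have hab := h.ne ht
  rw [cobdry_apply]
  simp only [Pi.single_apply, Pi.add_apply]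
  rw [Finset.sum_filter]
  simp_rw [h.edgeOf_eq_iff, h.revDart_eq ht hd]
  rw [Finset.sum_eq_add (⟨(a, b, c), ht⟩ : S) ⟨(b, a, d), hd⟩]
  · simp [Subtype.ext_iff, eq_comm]
  · simp [hab]
  · intro t _ h1
    simp [h1]
  · simp
  · simp

theorem finrank_range_cobdry (h : IsSphere A S) :
    A.card ≤ Module.finrank (ZMod 2) (LinearMap.range (cobdry A S)) + 1 := by
  rcases A.eq_empty_or_nonempty with hA | ⟨a, ha⟩
  · simp [hA]
  have key : ∀ u (hu : u ∈ A), Pi.single ⟨a, ha⟩ 1 + Pi.single ⟨u, hu⟩ 1 ∈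
      LinearMap.range (cobdry A S) := by
    intro u hu
    refine (h.conn (fun u => ∃ hu : u ∈ A, Pi.single ⟨a, ha⟩ 1 + Pi.single ⟨u, hu⟩ 1 ∈
      LinearMap.range (cobdry A S)) ?_ a ha u hu ⟨ha, ?_⟩).2
    · rintro x y z hx ⟨h1, h2⟩
      refine ⟨h.mem₂ hx, ?_⟩
      have := add_mem h2 ⟨_, h.cobdry_single hx⟩
      convert this using 1
      have e : ∀ p q r : ZMod 2, p + q = p + r + (r + q) := by decide
      exact funext fun j => e _ _ _
    · convert zero_mem (LinearMap.range (cobdry A S)) using 1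
      exact funext fun j => CharTwo.add_self_eq_zero _
  have top : LinearMap.range (cobdry A S) ⊔
      Submodule.span (ZMod 2) {(Pi.single ⟨a, ha⟩ 1 : A → ZMod 2)} = ⊤ := by
    rw [eq_top_iff]
    intro x _
    rw [pi_eq_sum_univ x]
    refine Submodule.sum_mem _ fun u _ => Submodule.smul_mem _ _ ?_
    have h1 := Submodule.mem_sup_left (T := Submodule.span (ZMod 2)
      {(Pi.single ⟨a, ha⟩ 1 : A → ZMod 2)}) (key u u.2)
    have h2 := Submodule.mem_sup_right (S := LinearMap.range (cobdry A S))
      (Submodule.mem_span_singleton_self (R := ZMod 2) (Pi.single ⟨a, ha⟩ 1 : A → ZMod 2))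
    have h3 := add_mem h2 h1
    convert h3 using 1
    ext j
    have e : ∀ p q : ZMod 2, q = p + (p + q) := by decide
    rw [Pi.add_apply, Pi.add_apply, ← e]
    simp [Pi.single_apply, eq_comm]
  have h1 := Submodule.finrank_add_le_finrank_add_finrank (LinearMap.range (cobdry A S))
    (Submodule.span (ZMod 2) {(Pi.single ⟨a, ha⟩ 1 : A → ZMod 2)})
  rw [top, finrank_top, Module.finrank_fintype_fun_eq_card, Fintype.card_coe] at h1
  have h2 := finrank_span_le_card (R := ZMod 2) {(Pi.single ⟨a, ha⟩ 1 : A → ZMod 2)}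
  simp at h2
  omega

theorem range_bdry_eq (h : IsSphere A S) :
    LinearMap.range h.bdry = LinearMap.ker (cobdry A S) := by
  refine Submodule.eq_of_le_of_finrank_le h.range_bdry_le ?_
  have h1 := LinearMap.finrank_range_add_finrank_ker h.bdry
  have h2 := LinearMap.finrank_range_add_finrank_ker (cobdry A S)
  have h3 := Submodule.finrank_mono h.ker_bdry_le
  have h4 := finrank_span_le_card (R := ZMod 2) {(fun _ => 1 : faces S → ZMod 2)}
  have h5 := h.finrank_range_cobdry
  have h6 := h.card_edges
  have h7 := h.card_faces
  have h8 := h.card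
  rw [Module.finrank_fintype_fun_eq_card, Fintype.card_coe] at h1 h2
  simp at h4
  omega

/-- The discrete Jordan curve theorem for triangles: any triangle separates the faces. -/
theorem exists_side (h : IsSphere A S) {a b c : V} (hab : IsEdge S a b) (hbc : IsEdge S b c)
    (hca : IsEdge S c a) : ∃ s : V → V → ZMod 2, (∀ u v w, (u, v, w) ∈ S → s u v = s v w) ∧
      ∀ u v, IsEdge S u v → s u v + s v u =
        if u ∈ ({a, b, c} : Finset V) ∧ v ∈ ({a, b, c} : Finset V) then 1 else 0 := by
  classical
  obtain ⟨g, hg⟩ : ∃ g : edges S → ZMod 2, g = fun e =>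
    if ∀ x ∈ e.1, x ∈ ({a, b, c} : Finset V) then 1 else 0 := ⟨_, rfl⟩
  have key : ∀ {a b c : V} (ha : a ∈ A), IsEdge S a b → IsEdge S a c → b ≠ c →
      (∀ e, g e = if ∀ x ∈ e.1, x ∈ ({a, b, c} : Finset V) then 1 else 0) →
      cobdry A S g ⟨a, ha⟩ = 0 := by
    rintro a b c ha ⟨x, hx⟩ ⟨y, hy⟩ hbc hg
    rw [cobdry_apply, Finset.sum_filter,
      Finset.sum_eq_add (⟨(a, b, x), hx⟩ : S) ⟨(a, c, y), hy⟩]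
    · simp [hg, edgeOf]
      rfl
    · simp [hbc]
    · rintro ⟨⟨p, q, r⟩, ht⟩ - ⟨h1, h2⟩
      by_cases hp : p = a
      · subst hp
        have hpq := (h.ne ht).symm
        rw [if_pos rfl, hg, if_neg]
        simp only [edgeOf, Sym2.mem_iff, Finset.mem_insert, Finset.mem_singleton]
        intro h3
        rcases h3 q (by simp) with e | rfl | rfl
        · exact hpq e
        · exact h1 (by simp [h.uniq ht hx])
        · exact h2 (by simp [h.uniq ht hy])
      · simp [hp]
    · simp
    · simp
  have hker : g ∈ LinearMap.ker (cobdry A S) := by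
    rw [LinearMap.mem_ker]
    ext ⟨v, hv⟩
    rw [Pi.zero_apply]
    by_cases hv' : v = a ∨ v = b ∨ v = c
    · rcases hv' with rfl | rfl | rfl
      · exact key hv hab (h.edge_symm hca) (h.edge_ne hbc) (fun e => by rw [hg])
      · exact key hv (h.edge_symm hab) hbc (h.edge_ne hca).symm
          (fun e => by rw [hg, Finset.insert_comm])
      · exact key hv hca (h.edge_symm hbc) (h.edge_ne hab)
          (fun e => by rw [hg, Finset.insert_comm v a, Finset.pair_comm v b])
    · rw [cobdry_apply]
      refine Finset.sum_eq_zero fun t ht => ?_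
      rw [Finset.mem_filter] at ht
      rw [hg]
      refine if_neg fun h1 => hv' ?_
      simpa [edgeOf, ht.2] using h1 t.1.1 (by simp [edgeOf])
  rw [← h.range_bdry_eq] at hker
  obtain ⟨f, hf⟩ := hker
  refine ⟨fun u v => if hw : ∃ w, (u, v, w) ∈ S then f (faceOf ⟨_, hw.choose_spec⟩) else 0, ?_, ?_⟩
  all_goals
    have ev : ∀ u v w (hw : (u, v, w) ∈ S), (if hw : ∃ w, (u, v, w) ∈ S then
        f (faceOf ⟨(u, v, hw.choose), hw.choose_spec⟩) else 0) = f (faceOf ⟨_, hw⟩) := by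
      intro u v w hw
      have hex : ∃ w, (u, v, w) ∈ S := ⟨w, hw⟩
      rw [dif_pos hex]
      congr 3
      rw [h.uniq hex.choose_spec hw]
  · intro u v w hw
    beta_reduce
    rw [ev u v w hw, ev v w u (h.cyc hw)]
    congr 1
    exact Subtype.ext (rot_rotate _ _ _).symm
  · rintro u v ⟨w, hw⟩
    obtain ⟨d, hd⟩ := h.rev hw
    have := congrFun hf (edgeOf ⟨_, hw⟩)
    rw [h.bdry_apply, h.revDart_eq hw hd] at this
    beta_reduce
    rw [ev u v w hw, ev v u d hd, this, hg]
    simp [edgeOf]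

end IsSphere

end Triangulation

namespace Triangulation

variable {V : Type*} [DecidableEq V] {A : Finset V} {S : Finset (V × V × V)}

namespace IsSphere

theorem side_const (h : IsSphere A S) {X : Finset V} {s : V → V → ZMod 2}
    (h1 : ∀ u v w, (u, v, w) ∈ S → s u v = s v w)
    (h2 : ∀ u v, IsEdge S u v → s u v + s v u = if u ∈ X ∧ v ∈ X then 1 else 0) {u w w' : V}
    (hu : u ∉ X) (hw : IsEdge S u w) (hw' : IsEdge S u w') : s u w = s u w' := by
  obtain ⟨x, hx⟩ := hw
  obtain ⟨y, hy⟩ := hw'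
  refine (h.link u (fun v => s u w = s u v) ?_ w x w' y hx hy rfl)
  intro b c hbc e
  have h3 := h2 u c (h.edge₃ hbc)
  rw [if_neg (by tauto), CharTwo.add_eq_zero] at h3
  rw [e, h1 _ _ _ hbc, h1 _ _ _ (h.cyc hbc), h3]

/-- A triangle whose complement is connected bounds a face. -/
theorem face_of_connected (h : IsSphere A S) {a b c : V} (hab : IsEdge S a b) (hbc : IsEdge S b c)
    (hca : IsEdge S c a)
    (hc : ∀ P : V → Prop, (∀ x y, IsEdge S x y → x ∉ ({a, b, c} : Finset V) →
      y ∉ ({a, b, c} : Finset V) → P x → P y) → ∀ x ∈ A, ∀ y ∈ A, x ∉ ({a, b, c} : Finset V) →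
      y ∉ ({a, b, c} : Finset V) → P x → P y) :
    (a, b, c) ∈ S ∨ (b, a, c) ∈ S := by
  obtain ⟨s, h1, h2⟩ := h.exists_side hab hbc hca
  obtain ⟨x, hx⟩ := hab
  obtain ⟨y, hy⟩ := h.rev hx
  by_cases hxc : x = c
  · exact Or.inl (hxc ▸ hx)
  by_cases hyc : y = c
  · exact Or.inr (hyc ▸ hy)
  have hx' : x ∉ ({a, b, c} : Finset V) := by
    simp [hxc, h.ne₃ hx, (h.ne₂ hx).symm]
  have hy' : y ∉ ({a, b, c} : Finset V) := by
    simp [hyc, h.ne₃ hy, (h.ne₂ hy).symm]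
  have sx : s x a = s a b := by rw [h1 _ _ _ hx, h1 _ _ _ (h.cyc hx)]
  have sy : s y b = s b a := by rw [h1 _ _ _ hy, h1 _ _ _ (h.cyc hy)]
  have key := hc (fun u => ∀ w, IsEdge S u w → s u w = s a b) ?_ x (h.mem₃ hx) y (h.mem₃ hy) hx' hy'
    (fun w hw => by rw [← sx]; exact h.side_const h1 h2 hx' hw ⟨b, h.cyc' hx⟩) b ⟨a, h.cyc' hy⟩
  · have := h2 a b ⟨x, hx⟩
    rw [← key, sy, CharTwo.add_self_eq_zero] at this
    simp at this
  · intro u v huv hu hv hP w hw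
    have h3 := h2 u v huv
    rw [if_neg (by tauto), CharTwo.add_eq_zero] at h3
    rw [← hP v huv, h3]
    exact h.side_const h1 h2 hv hw (h.edge_symm huv)

/-- If the two apexes `z`, `r` over the edge `p q` are adjacent, then `z`, `r` and the edge `p q`
together separate `p` from `q`. -/
theorem exists_separation (h : IsSphere A S) {p q z r : V} (hz : (p, q, z) ∈ S)
    (hr : (q, p, r) ∈ S) (hzr : IsEdge S z r) : ∃ P : V → Prop, P q ∧ ¬ P p ∧
      ∀ x y, IsEdge S x y → x ≠ z → x ≠ r → y ≠ z → y ≠ r → ¬ (x = p ∧ y = q) →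
        ¬ (x = q ∧ y = p) → P x → P y := by
  have hr' := h.cyc hr
  have hpr : IsEdge S p r := ⟨_, hr'⟩
  have hpz : IsEdge S p z := h.edge₃ hz
  have hpq : IsEdge S p q := ⟨_, hz⟩
  obtain ⟨s, h1, h2⟩ := h.exists_side hzr (h.edge_symm hpr) hpz
  have hqX : q ∉ ({z, r, p} : Finset V) := by
    simp [h.ne₂ hz, (h.ne₃ hr).symm, h.ne hr]
  have hpX : p ∈ ({z, r, p} : Finset V) := by simp
  have ezp := h.ne₃ hz
  have next : ∀ x y, (p, x, y) ∈ S →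
      s p y = s p x + if y ∈ ({z, r, p} : Finset V) then 1 else 0 := by
    intro x y hxy
    have h3 := h2 p y (h.edge₃ hxy)
    rw [h1 _ _ _ hxy, h1 _ _ _ (h.cyc hxy)]
    simp only [hpX, true_and] at h3
    rw [← h3]
    have : ∀ a b : ZMod 2, a = b + (a + b) := by decide
    exact this _ _
  have hq : s p q = s q p := by
    have := h2 p q hpq
    rwa [if_neg (by tauto), CharTwo.add_eq_zero] at this
  have hz' : s p z = s q p + 1 := by
    rw [next _ _ hz, hq]
    simp
  have around : ∀ x, IsEdge S p x → x = q ∨ x = r ∨ s p x = s p z := by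
    rintro x ⟨y, hy⟩
    obtain ⟨w, hw⟩ := h.exists_next hz
    refine h.link p (fun x => x = q ∨ x = r ∨ s p x = s p z) ?_ z w x y hw hy (by simp)
    intro b c hbc hb
    by_cases hcr : c = r
    · simp [hcr]
    by_cases hcz : c = z
    · simp [hcz]
    have hcp := h.ne₃ hbc
    rcases hb with rfl | rfl | hb
    · exact (hcz (h.uniq hbc hz)).elim
    · exact Or.inl (h.uniq hbc hr')
    · refine Or.inr (Or.inr ?_)
      rw [next _ _ hbc, hb]
      simp [hcr, hcz, hcp]
  refine ⟨fun x => x ≠ p ∧ ∀ w, IsEdge S x w → s x w = s q p, ?_, by simp, ?_⟩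
  · exact ⟨h.ne hr, fun w hw => h.side_const h1 h2 hqX hw ⟨r, hr⟩⟩
  · rintro x y hxy hxz hxr hyz hyr n1 n2 ⟨hxp, hP⟩
    have hxX : x ∉ ({z, r, p} : Finset V) := by simp [*]
    have h3 := h2 x y hxy
    rw [if_neg (by tauto), CharTwo.add_eq_zero, hP y hxy] at h3
    by_cases hyp : y = p
    · subst hyp
      rcases around x (h.edge_symm hxy) with e | e | e
      · exact (n2 ⟨e, rfl⟩).elim
      · exact (hxr e).elim
      · rw [e, hz'] at h3
        simp at h3
    · refine ⟨hyp, fun w hw => ?_⟩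
      rw [h3]
      exact h.side_const h1 h2 (by simp [*]) hw (h.edge_symm hxy)

end IsSphere

end Triangulation

namespace Minor

open SimpleGraph

variable {V W : Type*} {G G' H H' : SimpleGraph V} {K : SimpleGraph W}

/-- The subgraph induced on `s` is connected, phrased through invariant predicates. -/
def ConnOn (G : SimpleGraph V) (s : Set V) : Prop :=
  s.Nonempty ∧ ∀ P : V → Prop, (∀ a ∈ s, ∀ b ∈ s, G.Adj a b → P a → P b) →
    ∀ a ∈ s, ∀ b ∈ s, P a → P b

theorem connOn_iff {s : Set V} : ConnOn G s ↔ (G.induce s).Connected := by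
  rw [SimpleGraph.connected_iff]
  constructor
  · rintro ⟨⟨x, hx⟩, h⟩
    refine ⟨?_, ⟨x, hx⟩⟩
    rintro ⟨a, ha⟩ ⟨b, hb⟩
    have hP : ∀ u ∈ s, ∀ v ∈ s, G.Adj u v →
        (∃ hz : u ∈ s, (G.induce s).Reachable ⟨a, ha⟩ ⟨u, hz⟩) →
        ∃ hz : v ∈ s, (G.induce s).Reachable ⟨a, ha⟩ ⟨v, hz⟩ := by
      rintro u hu v hv huv ⟨_, h2⟩
      exact ⟨hv, h2.trans (Adj.reachable (by simpa using huv))⟩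
    exact (h _ hP a ha b hb ⟨ha, Reachable.refl _⟩).2
  · rintro ⟨h, ⟨x, hx⟩⟩
    refine ⟨⟨x, hx⟩, fun P hP a ha b hb hPa => ?_⟩
    obtain ⟨p⟩ := h ⟨a, ha⟩ ⟨b, hb⟩
    have : ∀ u v : s, (G.induce s).Walk u v → P u → P v := by
      intro u v p
      induction p with
      | nil => exact id
      | cons huv _ ih =>
        exact fun hu => ih (hP _ (Subtype.coe_prop _) _ (Subtype.coe_prop _) huv hu)
    exact this _ _ p hPa

theorem ConnOn.mono {s : Set V} (h : ConnOn G s)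
    (hG : ∀ a ∈ s, ∀ b ∈ s, G.Adj a b → H.Adj a b) : ConnOn H s :=
  ⟨h.1, fun P hP => h.2 P fun a ha b hb hab => hP a ha b hb (hG a ha b hb hab)⟩

theorem connOn_singleton (v : V) : ConnOn G {v} :=
  ⟨⟨v, rfl⟩, fun P _ a ha b hb h => by rw [Set.mem_singleton_iff] at ha hb; rwa [hb, ← ha]⟩

theorem connOn_union {s t : Set V} (h : ConnOn H' s) (ht : ConnOn H t)
    (hs : ∀ a ∈ s, ∀ b ∈ s, H'.Adj a b →
      H.Adj a b ∨ (∃ d ∈ t, H.Adj a d) ∧ ∃ d ∈ t, H.Adj b d)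
    (ha : ∃ a ∈ s, ∃ d ∈ t, H.Adj a d) : ConnOn H (s ∪ t) := by
  obtain ⟨x, hx, d, hd, hxd⟩ := ha
  refine ⟨⟨x, Or.inl hx⟩, fun P hP => ?_⟩
  have hT := ht.2 P fun a ha b hb => hP a (Or.inr ha) b (Or.inr hb)
  have hto : ∀ a ∈ s, ∀ d ∈ t, H.Adj a d → P a → P d :=
    fun a ha d hd => hP a (Or.inl ha) d (Or.inr hd)
  have hfrom : ∀ a ∈ s, ∀ d ∈ t, H.Adj a d → P d → P a :=
    fun a ha d hd hh => hP d (Or.inr hd) a (Or.inl ha) hh.symm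
  have hS := h.2 P fun a ha b hb hab hPa => by
    rcases hs a ha b hb hab with h1 | ⟨⟨d, hd, h1⟩, d', hd', h2⟩
    · exact hP a (Or.inl ha) b (Or.inl hb) h1 hPa
    · exact hfrom b hb d' hd' h2 (hT d hd d' hd' (hto a ha d hd h1 hPa))
  rintro a (ha | ha) b (hb | hb) hPa
  · exact hS a ha b hb hPa
  · exact hT d hd b hb (hto x hx d hd hxd (hS a ha x hx hPa))
  · exact hS x hx b hb (hfrom x hx d hd hxd (hT a ha d hd hPa))
  · exact hT a ha b hb hPa

theorem ConnOn.union {s t : Set V} (h : ConnOn H s) (ht : ConnOn H t)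
    (ha : ∃ a ∈ s, ∃ d ∈ t, H.Adj a d) : ConnOn H (s ∪ t) :=
  connOn_union h ht (fun _ _ _ _ => Or.inl) ha

theorem ConnOn.insert {s : Set V} (h : ConnOn H s) {v : V} (hv : ∃ d ∈ s, H.Adj v d) :
    ConnOn H (insert v s) := by
  rw [Set.insert_eq]
  exact (connOn_singleton v).union h ⟨v, rfl, hv⟩

/-- `φ` is a family of branch sets exhibiting `K` as a minor of `G`. -/
structure IsModel (K : SimpleGraph W) (G : SimpleGraph V) (φ : W → Set V) : Prop where
  conn : ∀ w, ConnOn G (φ w)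
  disj : ∀ w₁ w₂, w₁ ≠ w₂ → Disjoint (φ w₁) (φ w₂)
  adj : ∀ w₁ w₂, K.Adj w₁ w₂ → ∃ a ∈ φ w₁, ∃ b ∈ φ w₂, G.Adj a b

theorem isMinorOf_iff : IsMinorOf K G ↔ ∃ φ, IsModel K G φ :=
  ⟨fun ⟨φ, h1, h2, h3⟩ => ⟨φ, fun w => connOn_iff.2 (h1 w), h2, fun _ _ h => h3 h⟩,
    fun ⟨φ, h⟩ => ⟨φ, fun w => connOn_iff.1 (h.conn w), h.disj, fun _ _ h1 => h.adj _ _ h1⟩⟩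

theorem IsModel.mono {φ : W → Set V} (h : IsModel K H' φ)
    (h1 : ∀ w, ∀ a ∈ φ w, ∀ b ∈ φ w, H'.Adj a b → H.Adj a b)
    (h2 : ∀ w w', K.Adj w w' → ∀ a ∈ φ w, ∀ b ∈ φ w', H'.Adj a b → H.Adj a b) :
    IsModel K H φ where
  conn w := (h.conn w).mono (h1 w)
  disj := h.disj
  adj w w' hw := by
    obtain ⟨a, ha, b, hb, hab⟩ := h.adj w w' hw
    exact ⟨a, ha, b, hb, h2 w w' hw a ha b hb hab⟩

theorem IsModel.notMem_of_isolated {φ : W → Set V} (h : IsModel K H φ) {w w' : W}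
    (hw : K.Adj w w') {x : V} (hx : ∀ y, ¬ H.Adj x y) : x ∉ φ w := by
  intro hxw
  obtain ⟨a, ha, b, -, hab⟩ := h.adj w w' hw
  have : a = x := (h.conn w).2 (· = x) (fun u _ v _ huv hu => (hx v (hu ▸ huv)).elim) x hxw a ha rfl
  exact hx b (this ▸ hab)

/-- Enlarging the branch set of `w₀` by `D`. -/
theorem IsModel.absorb {φ : W → Set V} (h : IsModel K H' φ) (w₀ : W) {D : Set V}
    (hD : ∀ w, Disjoint (φ w) D) (h0 : ConnOn H (φ w₀ ∪ D))
    (h1 : ∀ w, w ≠ w₀ → ∀ a ∈ φ w, ∀ b ∈ φ w, H'.Adj a b → H.Adj a b)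
    (h2 : ∀ w w', K.Adj w w' → w ≠ w₀ → w' ≠ w₀ → ∀ a ∈ φ w, ∀ b ∈ φ w', H'.Adj a b → H.Adj a b)
    (h3 : ∀ w, w ≠ w₀ → ∀ a ∈ φ w₀, ∀ b ∈ φ w, H'.Adj a b → H.Adj a b ∨ ∃ d ∈ D, H.Adj b d) :
    IsMinorOf K H := by
  classical
  have key : ∀ w, K.Adj w₀ w → ∃ a ∈ φ w₀ ∪ D, ∃ b ∈ φ w, H.Adj a b := by
    intro w hw
    obtain ⟨a, ha, b, hb, hab⟩ := h.adj _ _ hw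
    rcases h3 w hw.ne' a ha b hb hab with h4 | ⟨d, hd, h4⟩
    · exact ⟨a, Or.inl ha, b, hb, h4⟩
    · exact ⟨d, Or.inr hd, b, hb, h4.symm⟩
  refine isMinorOf_iff.2 ⟨Function.update φ w₀ (φ w₀ ∪ D), ?_, ?_, ?_⟩
  · intro w
    by_cases hw : w = w₀
    · subst hw
      rwa [Function.update_self]
    · rw [Function.update_of_ne hw]
      exact (h.conn w).mono (h1 w hw)
  · intro w w' hne
    by_cases hw : w = w₀
    · subst hw
      rw [Function.update_self, Function.update_of_ne hne.symm, Set.disjoint_union_left]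
      exact ⟨h.disj _ _ hne, (hD w').symm⟩
    · rw [Function.update_of_ne hw]
      by_cases hw' : w' = w₀
      · subst hw'
        rw [Function.update_self, Set.disjoint_union_right]
        exact ⟨h.disj _ _ hne, hD w⟩
      · rw [Function.update_of_ne hw']
        exact h.disj _ _ hne
  · intro w w' hadj
    by_cases hw : w = w₀
    · subst hw
      rw [Function.update_self, Function.update_of_ne hadj.ne']
      exact key w' hadj
    · rw [Function.update_of_ne hw]
      by_cases hw' : w' = w₀
      · subst hw'
        rw [Function.update_self]
        obtain ⟨a, ha, b, hb, hab⟩ := key w hadj.symm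
        exact ⟨b, hb, a, ha, hab.symm⟩
      · rw [Function.update_of_ne hw']
        obtain ⟨a, ha, b, hb, hab⟩ := h.adj _ _ hadj
        exact ⟨a, ha, b, hb, h2 _ _ hadj hw hw' a ha b hb hab⟩

/-- Contracting an edge `x y` to `x`. -/
theorem isMinorOf_of_contract (hK : ∀ w, ∃ w', K.Adj w w') {x y : V} (hxy : H.Adj x y)
    (hy : ∀ z, ¬ H'.Adj y z)
    (hH : ∀ a b, H'.Adj a b → H.Adj a b ∨ (a = x ∧ H.Adj b y) ∨ (b = x ∧ H.Adj a y))
    (h : IsMinorOf K H') : IsMinorOf K H := by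
  obtain ⟨φ, hφ⟩ := isMinorOf_iff.1 h
  have hyφ : ∀ w, y ∉ φ w := fun w => hφ.notMem_of_isolated (hK w).choose_spec hy
  by_cases hx : ∃ w₀, x ∈ φ w₀
  · obtain ⟨w₀, hx⟩ := hx
    have hne : ∀ w, w ≠ w₀ → x ∉ φ w := fun w hw hxw =>
      Set.disjoint_left.1 (hφ.disj _ _ hw) hxw hx
    refine hφ.absorb w₀ (D := {y}) (fun w => by simpa using hyφ w)
      (connOn_union (hφ.conn w₀) (connOn_singleton y) ?_ ⟨x, hx, y, rfl, hxy⟩) ?_ ?_ ?_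
    · intro a _ b _ hab
      rcases hH a b hab with h1 | ⟨rfl, h1⟩ | ⟨rfl, h1⟩
      · exact Or.inl h1
      · exact Or.inr ⟨⟨y, rfl, hxy⟩, y, rfl, h1⟩
      · exact Or.inr ⟨⟨y, rfl, h1⟩, y, rfl, hxy⟩
    · intro w hw a ha b hb hab
      rcases hH a b hab with h1 | ⟨rfl, h1⟩ | ⟨rfl, h1⟩
      · exact h1
      · exact (hne w hw ha).elim
      · exact (hne w hw hb).elim
    · intro w w' _ hw hw' a ha b hb hab
      rcases hH a b hab with h1 | ⟨rfl, h1⟩ | ⟨rfl, h1⟩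
      · exact h1
      · exact (hne w hw ha).elim
      · exact (hne w' hw' hb).elim
    · intro w hw a ha b hb hab
      rcases hH a b hab with h1 | ⟨rfl, h1⟩ | ⟨rfl, h1⟩
      · exact Or.inl h1
      · exact Or.inr ⟨y, rfl, h1⟩
      · exact (hne w hw hb).elim
  · push Not at hx
    refine isMinorOf_iff.2 ⟨φ, hφ.mono ?_ ?_⟩
    · intro w a ha b hb hab
      rcases hH a b hab with h1 | ⟨rfl, h1⟩ | ⟨rfl, h1⟩
      · exact h1
      · exact (hx w ha).elim
      · exact (hx w hb).elim
    · intro w w' _ a ha b hb hab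
      rcases hH a b hab with h1 | ⟨rfl, h1⟩ | ⟨rfl, h1⟩
      · exact h1
      · exact (hx w ha).elim
      · exact (hx w' hb).elim

theorem isMinorOf_mono (hH : ∀ a b, H'.Adj a b → H.Adj a b) (h : IsMinorOf K H') :
    IsMinorOf K H := by
  obtain ⟨φ, hφ⟩ := isMinorOf_iff.1 h
  exact isMinorOf_iff.2 ⟨φ, hφ.mono (fun _ a _ b _ => hH a b) (fun _ _ _ a _ b _ => hH a b)⟩

theorem isPlanar_mono (hH : ∀ a b, H'.Adj a b → H.Adj a b) (h : IsPlanar H) : IsPlanar H' :=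
  ⟨fun h1 => h.1 (isMinorOf_mono hH h1), fun h1 => h.2 (isMinorOf_mono hH h1)⟩

theorem exists_adj_K5 (w : Fin 5) : ∃ w', (completeGraph (Fin 5)).Adj w w' :=
  ⟨w + 1, by revert w; simp [completeGraph]⟩

theorem exists_adj_K33 (w : Fin 3 ⊕ Fin 3) :
    ∃ w', (completeBipartiteGraph (Fin 3) (Fin 3)).Adj w w' := by
  rcases w with i | i
  · exact ⟨Sum.inr 0, by simp⟩
  · exact ⟨Sum.inl 0, by simp⟩

theorem isPlanar_of_contract {x y : V} (hxy : H.Adj x y) (hy : ∀ z, ¬ H'.Adj y z)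
    (hH : ∀ a b, H'.Adj a b → H.Adj a b ∨ (a = x ∧ H.Adj b y) ∨ (b = x ∧ H.Adj a y))
    (h : IsPlanar H) : IsPlanar H' :=
  ⟨fun h1 => h.1 (isMinorOf_of_contract exists_adj_K5 hxy hy hH h1),
    fun h1 => h.2 (isMinorOf_of_contract exists_adj_K33 hxy hy hH h1)⟩

theorem isMinorOf_K33 {P Q : Fin 3 → Set V} (hP : ∀ i, ConnOn G (P i)) (hQ : ∀ i, ConnOn G (Q i))
    (hPP : ∀ i j, i ≠ j → Disjoint (P i) (P j)) (hQQ : ∀ i j, i ≠ j → Disjoint (Q i) (Q j))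
    (hPQ : ∀ i j, Disjoint (P i) (Q j)) (h : ∀ i j, ∃ a ∈ P i, ∃ b ∈ Q j, G.Adj a b) :
    IsMinorOf (completeBipartiteGraph (Fin 3) (Fin 3)) G := by
  refine isMinorOf_iff.2 ⟨Sum.elim P Q, ?_, ?_, ?_⟩
  · rintro (i | i)
    exacts [hP i, hQ i]
  · rintro (i | i) (j | j) hij
    · exact hPP i j (by simpa using hij)
    · exact hPQ i j
    · exact (hPQ j i).symm
    · exact hQQ i j (by simpa using hij)
  · rintro (i | i) (j | j) hij
    · simp at hij
    · exact h i j
    · obtain ⟨a, ha, b, hb, hab⟩ := h j i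
      exact ⟨b, hb, a, ha, hab.symm⟩
    · simp at hij

/-- Six branch sets of a `K₃,₃` minor. -/
theorem isMinorOf_K33_of_sets {P₁ P₂ P₃ Q₁ Q₂ Q₃ : Set V}
    (hc : ∀ s ∈ [P₁, P₂, P₃, Q₁, Q₂, Q₃], ConnOn G s)
    (hd : [P₁, P₂, P₃, Q₁, Q₂, Q₃].Pairwise Disjoint)
    (h : ∀ s ∈ [P₁, P₂, P₃], ∀ t ∈ [Q₁, Q₂, Q₃], ∃ a ∈ s, ∃ b ∈ t, G.Adj a b) :
    IsMinorOf (completeBipartiteGraph (Fin 3) (Fin 3)) G := by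
  simp only [List.pairwise_cons, List.mem_cons, List.not_mem_nil, or_false, forall_eq_or_imp,
    forall_eq, IsEmpty.forall_iff, implies_true, List.Pairwise.nil, and_true] at hd
  obtain ⟨⟨h1, h2, h3, h4, h5⟩, ⟨h6, h7, h8, h9⟩, ⟨h10, h11, h12⟩, ⟨h13, h14⟩, h15⟩ := hd
  refine isMinorOf_K33 (P := ![P₁, P₂, P₃]) (Q := ![Q₁, Q₂, Q₃]) ?_ ?_ ?_ ?_ ?_ ?_
  · intro i
    fin_cases i <;> exact hc _ (by simp)
  · intro i
    fin_cases i <;> exact hc _ (by simp)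
  · intro i j hij
    fin_cases i <;> fin_cases j <;>
      first | assumption | exact Disjoint.symm (by assumption) | (simp at hij)
  · intro i j hij
    fin_cases i <;> fin_cases j <;>
      first | assumption | exact Disjoint.symm (by assumption) | (simp at hij)
  · intro i j
    fin_cases i <;> fin_cases j <;> assumption
  · intro i j
    fin_cases i <;> fin_cases j <;> exact h _ (by simp) _ (by simp)

/-- Five branch sets of a `K₅` minor. -/
theorem isMinorOf_K5_of_sets {P₁ P₂ P₃ P₄ P₅ : Set V}
    (hc : ∀ s ∈ [P₁, P₂, P₃, P₄, P₅], ConnOn G s)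
    (hd : [P₁, P₂, P₃, P₄, P₅].Pairwise
      (fun s t => Disjoint s t ∧ ∃ a ∈ s, ∃ b ∈ t, G.Adj a b)) :
    IsMinorOf (completeGraph (Fin 5)) G := by
  have hsymm : ∀ s t : Set V, (Disjoint s t ∧ ∃ a ∈ s, ∃ b ∈ t, G.Adj a b) →
      (Disjoint t s ∧ ∃ a ∈ t, ∃ b ∈ s, G.Adj a b) := by
    rintro s t ⟨h1, a, ha, b, hb, hab⟩
    exact ⟨h1.symm, b, hb, a, ha, hab.symm⟩
  have key : ∀ i j : Fin 5, i ≠ j → Disjoint (![P₁, P₂, P₃, P₄, P₅] i) (![P₁, P₂, P₃, P₄, P₅] j) ∧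
      ∃ a ∈ ![P₁, P₂, P₃, P₄, P₅] i, ∃ b ∈ ![P₁, P₂, P₃, P₄, P₅] j, G.Adj a b := by
    have hlt : ∀ i j : Fin 5, i < j →
        Disjoint (![P₁, P₂, P₃, P₄, P₅] i) (![P₁, P₂, P₃, P₄, P₅] j) ∧
        ∃ a ∈ ![P₁, P₂, P₃, P₄, P₅] i, ∃ b ∈ ![P₁, P₂, P₃, P₄, P₅] j, G.Adj a b := by
      simp only [List.pairwise_cons, List.mem_cons, List.not_mem_nil, or_false, forall_eq_or_imp,
        forall_eq, IsEmpty.forall_iff, implies_true, List.Pairwise.nil, and_true] at hd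
      obtain ⟨⟨h1, h2, h3, h4⟩, ⟨h5, h6, h7⟩, ⟨h8, h9⟩, h10⟩ := hd
      intro i j hij
      fin_cases i <;> fin_cases j <;> first | assumption | (simp at hij)
    intro i j hij
    rcases lt_or_gt_of_ne hij with h | h
    · exact hlt i j h
    · exact hsymm _ _ (hlt j i h)
  refine isMinorOf_iff.2 ⟨![P₁, P₂, P₃, P₄, P₅], ?_, fun i j hij => (key i j hij).1,
    fun i j hij => (key i j hij.ne).2⟩
  intro i
  fin_cases i <;> exact hc _ (by simp)

end Minor

namespace Minor

open SimpleGraph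

variable {V W : Type*} {H H' : SimpleGraph V} {K : SimpleGraph W}

/-- `H'` arises from `H` by isolating the connected set `D` and adding edges between the vertices
`a`, `b`, `c`, each of which has a neighbour in `D`. -/
structure IsCliqueSum (H H' : SimpleGraph V) (D : Set V) (a b c : V) : Prop where
  conn : ConnOn H D
  attach : ∀ x, x = a ∨ x = b ∨ x = c → ∃ d ∈ D, H.Adj x d
  isolated : ∀ x ∈ D, ∀ z, ¬ H'.Adj x z
  adj : ∀ x y, H'.Adj x y → H.Adj x y ∨ (x = a ∨ x = b ∨ x = c) ∧ (y = a ∨ y = b ∨ y = c)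

namespace IsCliqueSum

variable {D : Set V} {a b c : V} {φ : W → Set V}

theorem disjoint (h : IsCliqueSum H H' D a b c) (hK : ∀ w, ∃ w', K.Adj w w')
    (hφ : IsModel K H' φ) (w : W) : Disjoint (φ w) D :=
  Set.disjoint_right.2 fun x hx => hφ.notMem_of_isolated (hK w).choose_spec (h.isolated x hx)

theorem isMinorOf_of_center (h : IsCliqueSum H H' D a b c) (hK : ∀ w, ∃ w', K.Adj w w')
    (hφ : IsModel K H' φ) (w₀ : W) (h0 : ∃ x ∈ φ w₀, x = a ∨ x = b ∨ x = c)
    (h1 : ∀ w, w ≠ w₀ → ∀ x ∈ φ w, ∀ y ∈ φ w, (x = a ∨ x = b ∨ x = c) →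
      (y = a ∨ y = b ∨ y = c) → x = y)
    (h2 : ∀ w w', K.Adj w w' → w ≠ w₀ → w' ≠ w₀ → ∀ x ∈ φ w, ∀ y ∈ φ w',
      (x = a ∨ x = b ∨ x = c) → (y = a ∨ y = b ∨ y = c) → False) : IsMinorOf K H := by
  obtain ⟨x, hx, hxX⟩ := h0
  obtain ⟨d, hd, hxd⟩ := h.attach x hxX
  refine hφ.absorb w₀ (h.disjoint hK hφ)
    (connOn_union (hφ.conn w₀) h.conn ?_ ⟨x, hx, d, hd, hxd⟩) ?_ ?_ ?_
  · intro u _ v _ huv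
    exact (h.adj u v huv).imp_right fun h3 => ⟨h.attach u h3.1, h.attach v h3.2⟩
  · intro w hw u hu v hv huv
    rcases h.adj u v huv with h3 | h3
    · exact h3
    · exact (huv.ne (h1 w hw u hu v hv h3.1 h3.2)).elim
  · intro w w' hadj hw hw' u hu v hv huv
    rcases h.adj u v huv with h3 | h3
    · exact h3
    · exact (h2 w w' hadj hw hw' u hu v hv h3.1 h3.2).elim
  · intro w _ u _ v _ huv
    exact (h.adj u v huv).imp_right fun h3 => h.attach v h3.2

/-- Either `K` is already a minor of `H`, or `a`, `b`, `c` lie in different branch sets, any two of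
which are adjacent in `K`. -/
theorem isMinorOf_or (h : IsCliqueSum H H' D a b c) (hK : ∀ w, ∃ w', K.Adj w w')
    (hφ : IsModel K H' φ) : IsMinorOf K H ∨ ∃ u v w, a ∈ φ u ∧ b ∈ φ v ∧ c ∈ φ w ∧
      K.Adj u v ∧ K.Adj v w ∧ K.Adj u w := by
  have hu : ∀ x w w', x ∈ φ w → x ∈ φ w' → w = w' := fun x w w' h1 h2 =>
    by_contra fun hne => Set.disjoint_left.1 (hφ.disj _ _ hne) h1 h2
  have hsymm : ∀ u v, K.Adj u v → K.Adj v u := fun u v => K.adj_symm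
  have hirr : ∀ u, ¬ K.Adj u u := fun u => K.irrefl
  have key := fun w₀ => h.isMinorOf_of_center hK hφ w₀
  by_cases ha : ∃ u, a ∈ φ u
  · obtain ⟨u, ha⟩ := ha
    by_cases hb : ∃ v, b ∈ φ v
    · obtain ⟨v, hb⟩ := hb
      by_cases hc : ∃ w, c ∈ φ w
      · obtain ⟨w, hc⟩ := hc
        by_cases huv : K.Adj u v
        · by_cases hvw : K.Adj v w
          · by_cases huw : K.Adj u w
            · exact Or.inr ⟨u, v, w, ha, hb, hc, huv, hvw, huw⟩
            · left
              by_cases h3 : u = w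
              · exact key u ⟨a, ha, by simp⟩ (by grind) (by grind)
              · exact key v ⟨b, hb, by simp⟩ (by grind) (by grind)
          · left
            by_cases h3 : v = w
            · exact key v ⟨b, hb, by simp⟩ (by grind) (by grind)
            · exact key u ⟨a, ha, by simp⟩ (by grind) (by grind)
        · left
          by_cases h3 : u = v
          · exact key u ⟨a, ha, by simp⟩ (by grind) (by grind)
          · exact key w ⟨c, hc, by simp⟩ (by grind) (by grind)
      · exact Or.inl (key u ⟨a, ha, by simp⟩ (by grind) (by grind))
    · exact Or.inl (key u ⟨a, ha, by simp⟩ (by grind) (by grind))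
  · by_cases hb : ∃ v, b ∈ φ v
    · obtain ⟨v, hb⟩ := hb
      exact Or.inl (key v ⟨b, hb, by simp⟩ (by grind) (by grind))
    · by_cases hc : ∃ w, c ∈ φ w
      · obtain ⟨w, hc⟩ := hc
        exact Or.inl (key w ⟨c, hc, by simp⟩ (by grind) (by grind))
      · left
        have hout : ∀ w, ∀ x ∈ φ w, ¬ (x = a ∨ x = b ∨ x = c) := by
          rintro w x hx (rfl | rfl | rfl)
          exacts [ha ⟨w, hx⟩, hb ⟨w, hx⟩, hc ⟨w, hx⟩]
        refine isMinorOf_iff.2 ⟨φ, hφ.mono ?_ ?_⟩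
        · intro w x hx y _ hxy
          exact (h.adj x y hxy).resolve_right fun h3 => hout w x hx h3.1
        · intro w _ _ x hx y _ hxy
          exact (h.adj x y hxy).resolve_right fun h3 => hout w x hx h3.1

theorem isPlanar (h : IsCliqueSum H H' D a b c) (hH : IsPlanar H) : IsPlanar H' := by
  constructor
  · intro hm
    obtain ⟨φ, hφ⟩ := isMinorOf_iff.1 hm
    rcases h.isMinorOf_or exists_adj_K5 hφ with h1 | ⟨u, v, w, ha, hb, hc, huv, hvw, huw⟩
    · exact hH.1 h1
    · have hu : ∀ x w w', x ∈ φ w → x ∈ φ w' → w = w' := fun x w w' h1 h2 =>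
        by_contra fun hne => Set.disjoint_left.1 (hφ.disj _ _ hne) h1 h2
      obtain ⟨p, q, hp, hq, hpq⟩ : ∃ p q : Fin 5, (p ≠ u ∧ p ≠ v ∧ p ≠ w) ∧
          (q ≠ u ∧ q ≠ v ∧ q ≠ w) ∧ p ≠ q := by
        clear * -
        revert u v w
        decide
      have huv := huv.ne
      have hvw := hvw.ne
      have huw := huw.ne
      have hone : ∀ t, ∀ x ∈ φ t, ∀ y ∈ φ t, H'.Adj x y → H.Adj x y := by
        intro t x hx y hy hxy
        rcases h.adj x y hxy with h3 | ⟨h3, h4⟩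
        · exact h3
        · have := hxy.ne
          grind
      have hconn : ∀ t, ConnOn H (φ t) := fun t => (hφ.conn t).mono (hone t)
      have hnot : ∀ t, t ≠ u → t ≠ v → t ≠ w → ∀ x ∈ φ t, ¬ (x = a ∨ x = b ∨ x = c) := by
        rintro t h1 h2 h3 x hx (rfl | rfl | rfl)
        exacts [h1 (hu _ _ _ hx ha), h2 (hu _ _ _ hx hb), h3 (hu _ _ _ hx hc)]
      have hadj : ∀ s t, s ≠ t → t ≠ u → t ≠ v → t ≠ w → ∃ x ∈ φ s, ∃ y ∈ φ t, H.Adj x y := by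
        intro s t hst h1 h2 h3
        obtain ⟨x, hx, y, hy, hxy⟩ := hφ.adj s t hst
        exact ⟨x, hx, y, hy, (h.adj x y hxy).resolve_right fun h4 => hnot t h1 h2 h3 y hy h4.2⟩
      have hD : ∀ t, Disjoint (φ t) D := h.disjoint exists_adj_K5 hφ
      refine hH.2 (isMinorOf_K33_of_sets (P₁ := φ u) (P₂ := φ v) (P₃ := φ w) (Q₁ := D) (Q₂ := φ p)
        (Q₃ := φ q) ?_ ?_ ?_)
      · simp only [List.mem_cons, List.not_mem_nil, or_false, forall_eq_or_imp, forall_eq]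
        exact ⟨hconn _, hconn _, hconn _, h.conn, hconn _, hconn _⟩
      · simp only [List.pairwise_cons, List.mem_cons, List.not_mem_nil, or_false, forall_eq_or_imp,
          forall_eq, IsEmpty.forall_iff, implies_true, List.Pairwise.nil, and_true]
        exact ⟨⟨hφ.disj _ _ huv, hφ.disj _ _ huw, hD _, hφ.disj _ _ hp.1.symm,
          hφ.disj _ _ hq.1.symm⟩, ⟨hφ.disj _ _ hvw, hD _, hφ.disj _ _ hp.2.1.symm,
          hφ.disj _ _ hq.2.1.symm⟩, ⟨hD _, hφ.disj _ _ hp.2.2.symm, hφ.disj _ _ hq.2.2.symm⟩,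
          ⟨(hD _).symm, (hD _).symm⟩, hφ.disj _ _ hpq⟩
      · simp only [List.mem_cons, List.not_mem_nil, or_false, forall_eq_or_imp, forall_eq]
        exact ⟨⟨⟨a, ha, h.attach a (by simp)⟩, hadj _ _ hp.1.symm hp.1 hp.2.1 hp.2.2,
          hadj _ _ hq.1.symm hq.1 hq.2.1 hq.2.2⟩,
          ⟨⟨b, hb, h.attach b (by simp)⟩, hadj _ _ hp.2.1.symm hp.1 hp.2.1 hp.2.2,
          hadj _ _ hq.2.1.symm hq.1 hq.2.1 hq.2.2⟩,
          ⟨c, hc, h.attach c (by simp)⟩, hadj _ _ hp.2.2.symm hp.1 hp.2.1 hp.2.2,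
          hadj _ _ hq.2.2.symm hq.1 hq.2.1 hq.2.2⟩
  · intro hm
    obtain ⟨φ, hφ⟩ := isMinorOf_iff.1 hm
    rcases h.isMinorOf_or exists_adj_K33 hφ with h1 | ⟨u, v, w, -, -, -, huv, hvw, huw⟩
    · exact hH.2 h1
    · rcases u with u | u <;> rcases v with v | v <;> rcases w with w | w <;>
        simp at huv hvw huw

end IsCliqueSum

theorem isMinorOf_K33_of_attach {a b c : V} (hab : a ≠ b) (hac : a ≠ c) (hbc : b ≠ c)
    {D E F : Set V} (hD : ConnOn H D) (hE : ConnOn H E) (hF : ConnOn H F) (hDE : Disjoint D E)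
    (hDF : Disjoint D F) (hEF : Disjoint E F)
    (h : ∀ x, x = a ∨ x = b ∨ x = c → (x ∉ D ∧ x ∉ E ∧ x ∉ F) ∧ (∃ d ∈ D, H.Adj x d) ∧
      (∃ d ∈ E, H.Adj x d) ∧ ∃ d ∈ F, H.Adj x d) :
    IsMinorOf (completeBipartiteGraph (Fin 3) (Fin 3)) H := by
  have ha := h a (by simp)
  have hb := h b (by simp)
  have hc := h c (by simp)
  refine isMinorOf_K33_of_sets (P₁ := {a}) (P₂ := {b}) (P₃ := {c}) (Q₁ := D) (Q₂ := E)
    (Q₃ := F) ?_ ?_ ?_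
  · simp only [List.mem_cons, List.not_mem_nil, or_false, forall_eq_or_imp, forall_eq]
    exact ⟨connOn_singleton _, connOn_singleton _, connOn_singleton _, hD, hE, hF⟩
  · simp only [List.pairwise_cons, List.mem_cons, List.not_mem_nil, or_false, forall_eq_or_imp,
      forall_eq, IsEmpty.forall_iff, implies_true, List.Pairwise.nil, and_true,
      Set.disjoint_singleton_left, Set.mem_singleton_iff]
    tauto
  · simp only [List.mem_cons, List.not_mem_nil, or_false, forall_eq_or_imp, forall_eq,
      Set.mem_singleton_iff, exists_eq_left]
    exact ⟨ha.2, hb.2, hc.2⟩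

end Minor

namespace Minor

open SimpleGraph

variable {V : Type*} {H : SimpleGraph V}

/-- The subgraph of `H` induced on `A` with all edges inside `X` added. -/
def cliqueOn (H : SimpleGraph V) (A X : Finset V) : SimpleGraph V where
  Adj x y := x ≠ y ∧ x ∈ A ∧ y ∈ A ∧ (H.Adj x y ∨ x ∈ X ∧ y ∈ X)
  symm := ⟨fun _ _ h => ⟨h.1.symm, h.2.2.1, h.2.1, h.2.2.2.imp (fun h1 => h1.symm) And.symm⟩⟩
  loopless := ⟨fun _ h => h.1 rfl⟩

theorem isPlanar_cliqueOn {A X : Finset V} (hX : X.card ≤ 3) {D : Set V} (hD : ConnOn H D)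
    (hXD : ∀ x ∈ X, ∃ d ∈ D, H.Adj x d) (hA : ∀ x ∈ D, x ∉ A) (hH : IsPlanar H) :
    IsPlanar (cliqueOn H A X) := by
  classical
  rcases X.eq_empty_or_nonempty with rfl | hne
  · refine isPlanar_mono (fun a b hab => ?_) hH
    simpa using hab.2.2.2
  · obtain ⟨a, b, c, rfl⟩ : ∃ a b c, X = {a, b, c} := by
      have hpos := hne.card_pos
      obtain h | h | h : X.card = 1 ∨ X.card = 2 ∨ X.card = 3 := by omega
      · obtain ⟨a, rfl⟩ := Finset.card_eq_one.1 h
        exact ⟨a, a, a, by simp⟩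
      · obtain ⟨a, b, -, rfl⟩ := Finset.card_eq_two.1 h
        exact ⟨a, a, b, by simp⟩
      · obtain ⟨a, b, c, -, -, -, rfl⟩ := Finset.card_eq_three.1 h
        exact ⟨a, b, c, rfl⟩
    simp only [Finset.mem_insert, Finset.mem_singleton] at hXD
    have h : IsCliqueSum H (cliqueOn H A {a, b, c}) D a b c := by
      refine ⟨hD, hXD, fun x hx z h1 => hA x hx h1.2.1, fun x y h1 => ?_⟩
      simpa using h1.2.2.2
    exact h.isPlanar hH

end Minor

namespace Triangulation

open Minor

variable {V : Type*} [DecidableEq V] {A B : Finset V} {S T : Finset (V × V × V)}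

namespace IsSphere

theorem exists_face_of_card_le_two (h : IsSphere A S) (hA : 2 ≤ A.card) {X : Finset V} (hXA : X ⊆ A)
    (hX : X.card ≤ 2) (hE : ∀ x ∈ X, ∀ y ∈ X, x ≠ y → IsEdge S x y) :
    ∃ a b c, (a, b, c) ∈ S ∧ X ⊆ {a, b, c} := by
  obtain h0 | h1 | h2 : X.card = 0 ∨ X.card = 1 ∨ X.card = 2 := by omega
  · rw [Finset.card_eq_zero] at h0
    obtain ⟨a, ha⟩ := Finset.card_pos.1 (by omega : 0 < A.card)
    obtain ⟨b, c, hS⟩ := h.exists_edge hA ha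
    exact ⟨a, b, c, hS, by simp [h0]⟩
  · obtain ⟨a, rfl⟩ := Finset.card_eq_one.1 h1
    obtain ⟨b, c, hS⟩ := h.exists_edge hA (hXA (Finset.mem_singleton_self a))
    exact ⟨a, b, c, hS, by simp⟩
  · obtain ⟨a, b, hab, rfl⟩ := Finset.card_eq_two.1 h2
    obtain ⟨c, hS⟩ := hE a (by simp) b (by simp) hab
    refine ⟨a, b, c, hS, ?_⟩
    intro x
    simp only [Finset.mem_insert, Finset.mem_singleton]
    tauto

/-- Two spheres sharing part of a face have a common extension. -/
theorem exists_merge (h : IsSphere A S) (k : IsSphere B T) {a b c a' b' c' : V}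
    (hS : (a, b, c) ∈ S) (hT : (a', b', c') ∈ T) (h1 : A ∩ B ⊆ {a, b, c})
    (h2 : A ∩ B ⊆ {a', b', c'}) :
    ∃ U, IsSphere (A ∪ B) U ∧ (∀ x y, IsEdge S x y → IsEdge U x y) ∧
      ∀ x y, IsEdge T x y → IsEdge U x y := by
  have hc3 : ({a', b', c'} : Finset V).card = 3 :=
    Finset.card_eq_three.2 ⟨_, _, _, k.ne hT, (k.ne₃ hT).symm, k.ne₂ hT, rfl⟩
  have hsub : ({a', b', c'} : Finset V) ⊆ B := by
    intro x
    simp only [Finset.mem_insert, Finset.mem_singleton]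
    rintro (rfl | rfl | rfl)
    exacts [k.mem hT, k.mem₂ hT, k.mem₃ hT]
  obtain ⟨S', hS', hE, p, q, r, hf, hX⟩ := exists_insert_of_card
    (({a', b', c'} : Finset V) \ (A ∩ B)) h hS h1 (by
      intro y hy hyA
      rw [Finset.mem_sdiff] at hy
      exact hy.2 (Finset.mem_inter.2 ⟨hyA, hsub hy.1⟩)) (by
      rw [Finset.card_sdiff_of_subset h2]
      have := Finset.card_le_card h2
      omega)
  rw [Finset.union_sdiff_of_subset h2] at hX
  have heq : ({a', b', c'} : Finset V) = {p, q, r} :=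
    Finset.eq_of_subset_of_card_le hX (by rw [hc3]; exact Finset.card_le_three)
  have hAB : A ∪ (({a', b', c'} : Finset V) \ (A ∩ B)) ∪ B = A ∪ B := by
    ext x
    have := @hsub x
    simp only [Finset.mem_union, Finset.mem_sdiff]
    tauto
  have hI : (A ∪ (({a', b', c'} : Finset V) \ (A ∩ B))) ∩ B = {a', b', c'} := by
    ext x
    have := @hsub x
    have := @h2 x
    simp only [Finset.mem_union, Finset.mem_sdiff, Finset.mem_inter] at *
    tauto
  have hI' : (A ∪ (({a', b', c'} : Finset V) \ (A ∩ B))) ∩ B = {b', a', c'} := by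
    rw [hI]
    ext x
    simp only [Finset.mem_insert, Finset.mem_singleton]
    tauto
  have hor : (a', b', c') ∈ S' ∨ (b', a', c') ∈ S' := by
    have e := fun x => congrArg (x ∈ ·) heq
    simp only [Finset.mem_insert, Finset.mem_singleton, eq_iff_iff] at e
    have n1 := k.ne hT
    have n2 := k.ne₂ hT
    have n3 := k.ne₃ hT
    have f1 := hS'.cyc hf
    have f2 := hS'.cyc f1
    have ea := (e a').1 (by simp)
    have eb := (e b').1 (by simp)
    have ec := (e c').1 (by simp)
    clear e hI hI' hAB heq hX hE h1 h2 hsub hc3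
    rcases ea with rfl | rfl | rfl <;> rcases eb with rfl | rfl | rfl <;>
      rcases ec with rfl | rfl | rfl <;> first | contradiction | (exact Or.inl ‹_›) |
        (exact Or.inr ‹_›)
  rcases hor with hor | hor
  · have hm : (b', a', c') ∈ mirror S' := mem_mirror.2 hor
    have k' := (isSphere_mirror hS').glue k hI' hm hT
    rw [hAB] at k'
    exact ⟨_, k', fun x y hxy => (isSphere_mirror hS').glue_edge_left k hm hT
      (hS'.mirror_edge (hE x y hxy)), fun x y hxy =>
      (isSphere_mirror hS').glue_edge_right k hm hT hxy⟩
  · have k' := hS'.glue k hI' hor hT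
    rw [hAB] at k'
    exact ⟨_, k', fun x y hxy => hS'.glue_edge_left k hor hT (hE x y hxy),
      fun x y hxy => hS'.glue_edge_right k hor hT hxy⟩

end IsSphere

/-- Some triangulation of the sphere with vertex set `A` contains all edges of `H`. -/
def Covers (A : Finset V) (H : SimpleGraph V) : Prop :=
  ∃ S, IsSphere A S ∧ ∀ a b, H.Adj a b → IsEdge S a b

theorem covers_of_degree_le_two {H : SimpleGraph V} (hA : 5 ≤ A.card)
    (hH : ∀ x y, H.Adj x y → x ∈ A) (hP : IsPlanar H) {v : V} (hv : v ∈ A) {X : Finset V}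
    (hX : X.card ≤ 2) (hXv : ∀ x, x ∈ X ↔ H.Adj v x)
    (ih : ∀ B : Finset V, 4 ≤ B.card → B.card < A.card → ∀ H' : SimpleGraph V,
      (∀ x y, H'.Adj x y → x ∈ B) → IsPlanar H' → Covers B H') : Covers A H := by
  have hcard := Finset.card_erase_of_mem hv
  have hXA : X ⊆ A.erase v := fun x hx => by
    rw [hXv] at hx
    exact Finset.mem_erase.2 ⟨hx.ne', hH x v hx.symm⟩
  obtain ⟨S, hS, hE⟩ := ih (A.erase v) (by omega) (by omega) (cliqueOn H (A.erase v) X)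
    (fun x y h => h.2.1) (isPlanar_cliqueOn (by omega) (connOn_singleton v)
      (fun x hx => ⟨v, rfl, ((hXv x).1 hx).symm⟩) (by rintro x rfl; simp) hP)
  obtain ⟨a, b, c, hf, hX'⟩ := hS.exists_face_of_card_le_two (by omega) hXA hX
    fun x hx y hy hxy => hE x y ⟨hxy, hXA hx, hXA hy, Or.inr ⟨hx, hy⟩⟩
  obtain ⟨T, hT, hST, -, -, h1, h2, h3⟩ := hS.exists_insert hf (Finset.notMem_erase v A)
  rw [Finset.insert_erase hv] at hT
  have hvT : ∀ x, H.Adj v x → IsEdge T v x := by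
    intro x hx
    have := hX' ((hXv x).2 hx)
    simp only [Finset.mem_insert, Finset.mem_singleton] at this
    rcases this with rfl | rfl | rfl
    exacts [⟨_, hT.cyc' h1⟩, ⟨_, hT.cyc' h2⟩, ⟨_, hT.cyc' h3⟩]
  refine ⟨T, hT, fun x y hxy => ?_⟩
  by_cases hx : x = v
  · subst hx
    exact hvT y hxy
  · by_cases hy : y = v
    · subst hy
      exact hT.edge_symm (hvT x hxy.symm)
    · exact hST x y (hE x y ⟨hxy.ne, Finset.mem_erase.2 ⟨hx, hH x y hxy⟩,
        Finset.mem_erase.2 ⟨hy, hH y x hxy.symm⟩, Or.inl hxy⟩)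

end Triangulation

namespace Triangulation

open Minor

variable {V : Type*} [DecidableEq V] {A B X D : Finset V} {H : SimpleGraph V}

/-- `X` separates `D` from the nonempty rest of `A` in `H`. -/
structure IsSep (A : Finset V) (H : SimpleGraph V) (X D : Finset V) : Prop where
  sub : X ⊆ A
  sub' : D ⊆ A \ X
  ne : D.Nonempty
  ne' : ((A \ X) \ D).Nonempty
  not_adj : ∀ x ∈ D, ∀ y ∈ (A \ X) \ D, ¬ H.Adj x y

namespace IsSep

theorem compl (h : IsSep A H X D) : IsSep A H X ((A \ X) \ D) where
  sub := h.sub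
  sub' := Finset.sdiff_subset
  ne := h.ne'
  ne' := by
    rw [Finset.sdiff_sdiff_eq_self h.sub']
    exact h.ne
  not_adj x hx y hy hxy := by
    rw [Finset.sdiff_sdiff_eq_self h.sub'] at hy
    exact h.not_adj y hy x hx hxy.symm

theorem filter (h : IsSep A H X D) {D' : Finset V} (hD : D' ⊆ D) (hne : D'.Nonempty)
    (hadj : ∀ x ∈ D', ∀ y ∈ D, y ∉ D' → ¬ H.Adj x y) : IsSep A H X D' where
  sub := h.sub
  sub' := hD.trans h.sub'
  ne := hne
  ne' := h.ne'.mono (Finset.sdiff_subset_sdiff le_rfl hD)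
  not_adj x hx y hy := by
    rw [Finset.mem_sdiff] at hy
    by_cases hyD : y ∈ D
    · exact hadj x hx y hyD hy.2
    · exact h.not_adj x (hD hx) y (Finset.mem_sdiff.2 ⟨hy.1, hyD⟩)

theorem exists_adj (h : IsSep A H X D) (hmin : ∀ Y E, IsSep A H Y E → X.card ≤ Y.card) :
    ∀ x ∈ X, ∃ d ∈ (D : Set V), H.Adj x d := by
  intro x hx
  by_contra! hcon
  have hsub := h.sub'
  have hx' : x ∉ D := fun hxD => (Finset.mem_sdiff.1 (hsub hxD)).2 hx
  have : IsSep A H (X.erase x) D := by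
    refine ⟨(Finset.erase_subset _ _).trans h.sub, fun y hy => ?_, h.ne, ⟨x, ?_⟩,
      fun y hy z hz => ?_⟩
    · have := hsub hy
      simp only [Finset.mem_sdiff, Finset.mem_erase] at *
      tauto
    · simp only [Finset.mem_sdiff, Finset.mem_erase]
      exact ⟨⟨h.sub hx, by tauto⟩, hx'⟩
    · by_cases hzx : z = x
      · subst hzx
        exact fun h1 => hcon y hy h1.symm
      · refine h.not_adj y hy z ?_
        simp only [Finset.mem_sdiff, Finset.mem_erase] at *
        tauto
  have h1 := hmin _ _ this
  rw [Finset.card_erase_of_mem hx] at h1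
  have := Finset.card_pos.2 ⟨x, hx⟩
  omega

theorem exists_connOn (h : IsSep A H X D) : ∃ D' ⊆ D, IsSep A H X D' ∧ ConnOn H (D' : Set V) := by
  classical
  induction hn : D.card using Nat.strong_induction_on generalizing D with
  | _ n ih =>
    by_cases hc : ConnOn H (D : Set V)
    · exact ⟨D, le_rfl, h, hc⟩
    · have : ∃ P : V → Prop, (∀ a ∈ D, ∀ b ∈ D, H.Adj a b → P a → P b) ∧ ∃ a ∈ D, ∃ b ∈ D,
          P a ∧ ¬ P b := by
        by_contra! hcon
        exact hc ⟨h.ne, fun P hP a ha b hb => hcon P hP a ha b hb⟩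
      obtain ⟨P, hP, a, ha, b, hb, hPa, hPb⟩ := this
      obtain ⟨D', hD', h1, h2⟩ := ih (D.filter P).card (by
          rw [← hn]
          exact Finset.card_lt_card ⟨Finset.filter_subset _ _, fun hsub =>
            hPb (Finset.mem_filter.1 (hsub hb)).2⟩)
        (h.filter (Finset.filter_subset P D) ⟨a, Finset.mem_filter.2 ⟨ha, hPa⟩⟩ (by
          intro x hx y hy hy' hxy
          rw [Finset.mem_filter] at hx hy'
          exact hy' ⟨hy, hP x hx.1 y hy hxy hx.2⟩)) rfl
      exact ⟨D', hD'.trans (Finset.filter_subset _ _), h1, h2⟩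

theorem four_le_card (h : IsSep A H X D) (hH : ∀ x y, H.Adj x y → x ∈ A)
    (hdeg : ∀ v ∈ A, ∀ N : Finset V, (∀ x, x ∈ N ↔ H.Adj v x) → 3 ≤ N.card) :
    4 ≤ (X ∪ D).card := by
  classical
  obtain ⟨v, hv⟩ := h.ne
  have hvA := (Finset.mem_sdiff.1 (h.sub' hv)).1
  have h1 := hdeg v hvA (A.filter (H.Adj v)) fun x => by
    rw [Finset.mem_filter]
    exact ⟨And.right, fun hx => ⟨hH x v hx.symm, hx⟩⟩
  have h2 : insert v (A.filter (H.Adj v)) ⊆ X ∪ D := by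
    intro x hx
    rw [Finset.mem_insert, Finset.mem_filter] at hx
    rcases hx with rfl | ⟨hxA, hx⟩
    · exact Finset.mem_union_right _ hv
    · by_contra hcon
      refine h.not_adj v hv x ?_ hx
      simp only [Finset.mem_sdiff, Finset.mem_union] at *
      tauto
  have h3 := Finset.card_le_card h2
  rw [Finset.card_insert_of_notMem (by simp)] at h3
  omega

end IsSep

theorem exists_face_of_cliqueOn {S : Finset (V × V × V)} (hS : IsSphere B S) (hB : 2 ≤ B.card)
    (hXB : X ⊆ B) (hX : X.card ≤ 3)
    (hE : ∀ x y, (cliqueOn H B X).Adj x y → IsEdge S x y)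
    (hc : X.card = 3 → ConnOn H ((B \ X : Finset V) : Set V)) :
    ∃ a b c, (a, b, c) ∈ S ∧ X ⊆ {a, b, c} := by
  have hX' : ∀ x ∈ X, ∀ y ∈ X, x ≠ y → IsEdge S x y := fun x hx y hy hxy =>
    hE x y ⟨hxy, hXB hx, hXB hy, Or.inr ⟨hx, hy⟩⟩
  rcases hX.lt_or_eq with h | h
  · exact hS.exists_face_of_card_le_two hB hXB (by omega) hX'
  · have hc := hc h
    obtain ⟨a, b, c, hab, hac, hbc, rfl⟩ := Finset.card_eq_three.1 h
    have hf := hS.face_of_connected (hX' a (by simp) b (by simp) hab)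
      (hX' b (by simp) c (by simp) hbc) (hX' c (by simp) a (by simp) hac.symm) (by
        intro P hP x hx y hy hxX hyX
        refine hc.2 P (fun u hu v hv huv => ?_) x (Finset.mem_sdiff.2 ⟨hx, hxX⟩) y
          (Finset.mem_sdiff.2 ⟨hy, hyX⟩)
        rw [Finset.mem_coe, Finset.mem_sdiff] at hu hv
        exact hP u v (hE u v ⟨huv.ne, hu.1, hv.1, Or.inl huv⟩) hu.2 hv.2)
    rcases hf with hf | hf
    · exact ⟨_, _, _, hf, le_rfl⟩
    · refine ⟨_, _, _, hf, fun x => ?_⟩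
      simp only [Finset.mem_insert, Finset.mem_singleton]
      tauto

theorem covers_of_isSep (hH : ∀ x y, H.Adj x y → x ∈ A) (hP : IsPlanar H)
    (hdeg : ∀ v ∈ A, ∀ N : Finset V, (∀ x, x ∈ N ↔ H.Adj v x) → 3 ≤ N.card)
    (ih : ∀ B : Finset V, 4 ≤ B.card → B.card < A.card → ∀ H' : SimpleGraph V,
      (∀ x y, H'.Adj x y → x ∈ B) → IsPlanar H' → Covers B H')
    (hsep : ∃ X D, IsSep A H X D ∧ X.card ≤ 3) : Covers A H := by
  classical
  obtain ⟨X, ⟨D₀, h₀⟩, hmin⟩ := exists_minimalFor_of_wellFoundedLT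
    (fun X => ∃ D, IsSep A H X D) Finset.card ⟨_, hsep.choose_spec.imp fun _ => And.left⟩
  have hmin : ∀ Y E, IsSep A H Y E → X.card ≤ Y.card := fun Y E hE =>
    (le_total X.card Y.card).elim id (hmin ⟨E, hE⟩)
  have hX : X.card ≤ 3 := by
    obtain ⟨Y, E, hE, hY⟩ := hsep
    exact (hmin Y E hE).trans hY
  obtain ⟨D, -, h, hD⟩ := h₀.exists_connOn
  obtain ⟨E, hED, hE, hEc⟩ := h.compl.exists_connOn
  have hDX := fun x (hx : x ∈ D) => Finset.mem_sdiff.1 (h.sub' hx)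
  have hA1 : X ∪ D ⊆ A := by
    intro x
    have := hDX x
    have := @h.sub x
    rw [Finset.mem_union]
    tauto
  have hA2 : X ∪ ((A \ X) \ D) ⊆ A := by
    intro x
    have := @h.sub x
    simp only [Finset.mem_union, Finset.mem_sdiff]
    tauto
  have hc1 : (X ∪ D).card < A.card := by
    refine Finset.card_lt_card ⟨hA1, fun hsub => ?_⟩
    obtain ⟨e, he⟩ := h.ne'
    simp only [Finset.mem_sdiff] at he
    have := hsub he.1.1
    rw [Finset.mem_union] at this
    tauto
  have hc2 : (X ∪ ((A \ X) \ D)).card < A.card := by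
    refine Finset.card_lt_card ⟨hA2, fun hsub => ?_⟩
    obtain ⟨e, he⟩ := h.ne
    have h1 := hDX e he
    have := hsub h1.1
    simp only [Finset.mem_union, Finset.mem_sdiff] at this
    tauto
  have h4 := h.four_le_card hH hdeg
  have h4' := h.compl.four_le_card hH hdeg
  obtain ⟨S, hS, hSE⟩ := ih (X ∪ D) h4 hc1 (cliqueOn H (X ∪ D) X) (fun x y h => h.2.1)
    (isPlanar_cliqueOn hX hEc (hE.exists_adj hmin) (by
      intro x hx
      have := hED hx
      simp only [Finset.mem_union, Finset.mem_sdiff] at *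
      tauto) hP)
  obtain ⟨T, hT, hTE⟩ := ih (X ∪ ((A \ X) \ D)) h4' hc2 (cliqueOn H (X ∪ ((A \ X) \ D)) X)
    (fun x y h => h.2.1) (isPlanar_cliqueOn hX hD (h.exists_adj hmin) (by
      intro x hx
      have := hDX x hx
      simp only [Finset.mem_union, Finset.mem_sdiff, Finset.mem_coe] at *
      tauto) hP)
  obtain ⟨a, b, c, hf, hXf⟩ := exists_face_of_cliqueOn hS (by omega) Finset.subset_union_left hX hSE
    fun _ => by
      convert hD
      ext x
      have := hDX x
      simp only [Finset.mem_union, Finset.mem_sdiff]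
      tauto
  have hEconn : X.card = 3 → (A \ X) \ D = E := by
    intro hX3
    by_contra hne
    have hsd : (((A \ X) \ D) \ E).Nonempty := by
      rw [Finset.sdiff_nonempty]
      exact fun hsub => hne (hsub.antisymm hED)
    obtain ⟨F, hFD, hF, hFc⟩ := (h.compl.filter Finset.sdiff_subset hsd (by
      intro x hx y hy hy' hxy
      have hyE : y ∈ E := by
        rw [Finset.mem_sdiff] at hy'
        tauto
      refine hE.not_adj y hyE x ?_ hxy.symm
      simp only [Finset.mem_sdiff] at *
      tauto)).exists_connOn
    obtain ⟨a, b, c, hab, hac, hbc, rfl⟩ := Finset.card_eq_three.1 hX3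
    have hED' := fun x (hx : x ∈ E) => Finset.mem_sdiff.1 (hED hx)
    have hFD' := fun x (hx : x ∈ F) => Finset.mem_sdiff.1 (hFD hx)
    refine hP.2 (isMinorOf_K33_of_attach hab hac hbc hD hEc hFc ?_ ?_ ?_ ?_)
    · rw [Finset.disjoint_coe, Finset.disjoint_left]
      exact fun x hx hx' => (hED' x hx').2 hx
    · rw [Finset.disjoint_coe, Finset.disjoint_left]
      exact fun x hx hx' => (Finset.mem_sdiff.1 (hFD' x hx').1).2 hx
    · rw [Finset.disjoint_coe, Finset.disjoint_left]
      exact fun x hx hx' => (hFD' x hx').2 hx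
    · intro x hx
      have hx' : x ∈ ({a, b, c} : Finset V) := by simpa using hx
      refine ⟨⟨fun h1 => (hDX x h1).2 hx', fun h1 => ?_, fun h1 => ?_⟩, h.exists_adj hmin x hx',
        hE.exists_adj hmin x hx', hF.exists_adj hmin x hx'⟩
      · exact (Finset.mem_sdiff.1 (hE.sub' h1)).2 hx'
      · exact (Finset.mem_sdiff.1 (hF.sub' h1)).2 hx'
  obtain ⟨a', b', c', hf', hXf'⟩ := exists_face_of_cliqueOn hT (by omega)
    Finset.subset_union_left hX hTE fun hX3 => by
      rw [hEconn hX3]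
      convert hEc
      ext x
      have := @hE.sub' x
      simp only [Finset.mem_union, Finset.mem_sdiff] at *
      tauto
  have hI : (X ∪ D) ∩ (X ∪ ((A \ X) \ D)) = X := by
    ext x
    simp only [Finset.mem_union, Finset.mem_sdiff, Finset.mem_inter]
    tauto
  have hU : (X ∪ D) ∪ (X ∪ ((A \ X) \ D)) = A := by
    ext x
    have := @hA1 x
    have := @hA2 x
    simp only [Finset.mem_union, Finset.mem_sdiff] at *
    tauto
  obtain ⟨U, hU', hSU, hTU⟩ := hS.exists_merge hT hf hf' (by rwa [hI]) (by rwa [hI])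
  rw [hU] at hU'
  refine ⟨U, hU', fun x y hxy => ?_⟩
  have hx := hH x y hxy
  have hy := hH y x hxy.symm
  by_cases h1 : x ∈ X ∪ D ∧ y ∈ X ∪ D
  · exact hSU x y (hSE x y ⟨hxy.ne, h1.1, h1.2, Or.inl hxy⟩)
  · refine hTU x y (hTE x y ⟨hxy.ne, ?_, ?_, Or.inl hxy⟩)
    · have := h.not_adj x
      have := fun h1 => this h1 y
      simp only [Finset.mem_union, Finset.mem_sdiff] at *
      tauto
    · have := h.not_adj y
      have := fun h1 => this h1 x
      have := hxy.symm
      simp only [Finset.mem_union, Finset.mem_sdiff] at *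
      tauto

end Triangulation

theorem List.exists_first_of_exists {α : Type*} (p : α → Prop) :
    ∀ {l : List α}, (∃ z ∈ l, p z) → ∃ u a v, l = u ++ a :: v ∧ p a ∧ ∀ z ∈ u, ¬ p z
  | [], h => by simp at h
  | b :: l, h => by
    by_cases hb : p b
    · exact ⟨[], b, l, rfl, hb, by simp⟩
    · obtain ⟨u, a, v, rfl, ha, hu⟩ := exists_first_of_exists p (l := l) (by simpa [hb] using h)
      exact ⟨b :: u, a, v, rfl, ha, by simpa [hb] using hu⟩

theorem List.exists_last_of_exists {α : Type*} (p : α → Prop) {l : List α} (h : ∃ z ∈ l, p z) :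
    ∃ u a v, l = u ++ a :: v ∧ p a ∧ ∀ z ∈ v, ¬ p z := by
  obtain ⟨u, a, v, hl, ha, hu⟩ := exists_first_of_exists p (l := l.reverse) (by simpa using h)
  refine ⟨v.reverse, a, u.reverse, ?_, ha, by simpa using hu⟩
  rw [← l.reverse_reverse, hl]
  simp

theorem List.IsChain.exists_next {α : Type*} {R : α → α → Prop} {l : List α} {b u : α}
    (h : (l ++ [b]).IsChain R) (hu : u ∈ l) : ∃ v ∈ l ++ [b], R u v := by
  obtain ⟨s, t, rfl⟩ := append_of_mem hu
  cases t with
  | nil => exact ⟨b, by simp, (by simpa using h : (s ++ [u]).IsChain R ∧ R u b).2⟩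
  | cons c t => exact ⟨c, by simp, (isChain_append_cons_cons.1 (by simpa using h)).2.1⟩

namespace Minor

theorem connOn_of_isChain {V : Type*} {H : SimpleGraph V} :
    ∀ {l : List V}, l ≠ [] → l.IsChain H.Adj → ConnOn H {z | z ∈ l}
  | [], h, _ => (h rfl).elim
  | [a], _, _ => by simpa using connOn_singleton a
  | a :: b :: l, _, hc => by
    rw [List.isChain_cons_cons] at hc
    have h1 := (connOn_of_isChain (List.cons_ne_nil b l) hc.2).insert (v := a) ⟨b, by simp, hc.1⟩
    convert h1 using 1
    ext z
    simp

end Minor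

namespace Triangulation

variable {V : Type*} {A : Finset V} {S : Finset (V × V × V)}

namespace IsSphere

theorem exists_link_list_aux (h : IsSphere A S) {x b : V} (k : ℕ) : ∀ m : List V,
    A.card ≤ k + m.length → (m ++ [b]).IsChain (fun u v => (x, u, v) ∈ S) → (m ++ [b]).Nodup →
    (∃ c, (x, b, c) ∈ S) → ∃ m : List V, (b :: m ++ [b]).IsChain (fun u v => (x, u, v) ∈ S) ∧
      (b :: m).Nodup := by
  classical
  induction k with
  | zero =>
    rintro m hk hc hn ⟨c, hb⟩
    have hsub : (m ++ [b]).toFinset ⊆ A := by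
      intro z hz
      simp only [List.toFinset_append, List.toFinset_cons, List.toFinset_nil, Finset.mem_union,
        List.mem_toFinset, insert_empty_eq, Finset.mem_singleton] at hz
      rcases hz with hz | rfl
      · obtain ⟨v, -, hv⟩ := hc.exists_next hz
        exact h.mem₂ hv
      · exact h.mem₂ hb
    have := Finset.card_le_card hsub
    rw [List.toFinset_card_of_nodup hn] at this
    simp at this
    omega
  | succ k ih =>
    rintro m hk hc hn ⟨c, hb⟩
    obtain ⟨e, t, het⟩ : ∃ e t, m ++ [b] = e :: t := by
      cases m with
      | nil => exact ⟨_, _, rfl⟩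
      | cons e t => exact ⟨e, t ++ [b], rfl⟩
    have he : ∃ v, (x, e, v) ∈ S := by
      by_cases hem : e ∈ m
      · obtain ⟨v, -, hv⟩ := hc.exists_next hem
        exact ⟨v, hv⟩
      · have : e ∈ m ++ [b] := by rw [het]; simp
        have : e = b := by simpa [hem] using this
        exact ⟨c, this ▸ hb⟩
    obtain ⟨d, hd⟩ := h.exists_prev he.choose_spec
    have hdc : (d :: (m ++ [b])).IsChain (fun u v => (x, u, v) ∈ S) := by
      rw [het] at hc ⊢
      exact List.isChain_cons_cons.2 ⟨hd, hc⟩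
    by_cases hdb : d = b
    · subst hdb
      refine ⟨m, hdc, ?_⟩
      rw [List.nodup_append_comm] at hn
      exact hn
    · by_cases hdm : d ∈ m
      · exfalso
        obtain ⟨s, t', rfl⟩ := List.append_of_mem hdm
        obtain ⟨f, t'', hf⟩ : ∃ f t'', t' ++ [b] = f :: t'' := by
          cases t' with
          | nil => exact ⟨_, _, rfl⟩
          | cons e t => exact ⟨e, t ++ [b], rfl⟩
        have hl : s ++ d :: t' ++ [b] = s ++ d :: f :: t'' := by simp [hf]
        rw [hl] at hc hn het
        have hdf := (List.isChain_append_cons_cons.1 hc).2.1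
        have hfe : f = e := h.uniq (h.cyc (h.cyc' hdf)) (h.cyc (h.cyc' hd))
        have hne := h.ne₂ hd
        cases s with
        | nil =>
          simp at het
          exact hne het.1
        | cons e' s =>
          simp at het hn
          grind
      · refine ih (d :: m) (by simp; omega) (by simpa using hdc) ?_ ⟨c, hb⟩
        have : d ∉ m ++ [b] := by simp [hdm, hdb]
        simpa using List.nodup_cons.2 ⟨this, hn⟩

/-- The link of `x` as a closed list starting at `b`. -/
theorem exists_link_list (h : IsSphere A S) {x b : V} (hb : IsEdge S x b) :
    ∃ m : List V, (b :: m ++ [b]).IsChain (fun u v => (x, u, v) ∈ S) ∧ (b :: m).Nodup ∧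
      ∀ z, IsEdge S x z → z ∈ b :: m := by
  obtain ⟨m, h1, h2⟩ := h.exists_link_list_aux A.card [] (by simp) (by simp) (by simp) hb
  refine ⟨m, h1, h2, ?_⟩
  rintro z ⟨w, hw⟩
  obtain ⟨c, hc⟩ := hb
  refine h.link x (· ∈ b :: m) ?_ b c z w hc hw (by simp)
  intro u v huv hu
  obtain ⟨v', hv', huv'⟩ := h1.exists_next hu
  rw [h.uniq (h.cyc (h.cyc' huv)) (h.cyc (h.cyc' huv'))]
  simp only [List.cons_append, List.mem_cons, List.mem_append, List.not_mem_nil, or_false] at hv' ⊢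
  tauto

variable [DecidableEq V]

theorem edge_of_flip_edge (h : IsSphere A S) {p q z r u v : V} (h1 : (p, q, z) ∈ S)
    (h2 : (q, p, r) ∈ S) (he : IsEdge (flip S p q z r) u v) :
    IsEdge S u v ∨ (u = z ∧ v = r) ∨ (u = r ∧ v = z) := by
  obtain ⟨w, hw⟩ := he
  rcases mem_flip.1 hw with h3 | h3 | h3
  · exact Or.inl ⟨w, h3.1⟩
  · rw [mem_rot] at h3
    rcases h3 with ⟨rfl, rfl, rfl⟩ | ⟨rfl, rfl, rfl⟩ | ⟨rfl, rfl, rfl⟩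
    · exact Or.inl ⟨_, h.cyc' h1⟩
    · exact Or.inl ⟨_, h.cyc h2⟩
    · tauto
  · rw [mem_rot] at h3
    rcases h3 with ⟨rfl, rfl, rfl⟩ | ⟨rfl, rfl, rfl⟩ | ⟨rfl, rfl, rfl⟩
    · exact Or.inl ⟨_, h.cyc' h2⟩
    · exact Or.inl ⟨_, h.cyc h1⟩
    · tauto

/-- Successive flips moving the edges from `x` to an arc of its link over to `y`. -/
theorem exists_flip_chain {x y : V} (l : List V) : ∀ {c : V} {S : Finset (V × V × V)},
    IsSphere A S → (x, y, c) ∈ S → (c :: l).IsChain (fun u v => (x, u, v) ∈ S) →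
    (c :: l).Nodup → (∀ z ∈ l, z ≠ y ∧ ¬ IsEdge S z y) →
    ∃ T, IsSphere A T ∧ (∀ z ∈ c :: l, IsEdge T y z) ∧ (∀ z, IsEdge S y z → IsEdge T y z) ∧
      ∀ u v, IsEdge S u v → ¬ (u = x ∧ v ∈ (c :: l).dropLast) →
        ¬ (v = x ∧ u ∈ (c :: l).dropLast) → IsEdge T u v := by
  induction l with
  | nil =>
    intro c S h hc _ _ _
    refine ⟨S, h, ?_, fun _ => id, fun u v he _ _ => he⟩
    simp only [List.mem_singleton, forall_eq]
    exact h.edge₂ hc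
  | cons c₁ l ih =>
    intro c S h hc hchain hnd hy
    rw [List.isChain_cons_cons] at hchain
    have h1 := hchain.1
    have h2 := h.cyc' hc
    have hxc := h.ne h1
    have hxy := h.ne hc
    have hyc := h.ne₂ hc
    have hx1 := h.ne₃ h1
    have hy1 := (hy c₁ (by simp)).1
    have k := h.isSphere_flip h1 h2 hy1 fun w hw => (hy c₁ (by simp)).2 ⟨w, hw⟩
    have hcl : ∀ z ∈ l, z ≠ c₁ ∧ z ≠ c := by
      simp only [List.nodup_cons, List.mem_cons] at hnd
      intro z hz
      exact ⟨fun e => hnd.2.1 (e ▸ hz), fun e => hnd.1 (Or.inr (e ▸ hz))⟩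
    have hpres : ∀ u v, IsEdge S u v → ¬ (u = x ∧ v = c) → ¬ (u = c ∧ v = x) →
        IsEdge (flip S x c c₁ y) u v := fun u v he n1 n2 => flip_edge he n1 n2
    obtain ⟨T, hT, hT1, hT2, hT3⟩ := ih (c := c₁) k
      (mem_flip.2 (Or.inr (Or.inl (mem_rot.2 (by tauto))))) (by
        refine hchain.2.imp_of_mem_imp ?_
        intro u v hu hv huv
        rw [mem_flip, mem_rot, mem_rot]
        refine Or.inl ⟨huv, ?_, ?_⟩
        · rintro (⟨-, rfl, -⟩ | ⟨rfl, -, -⟩ | ⟨rfl, -, -⟩)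
          · simp only [List.nodup_cons] at hnd
            exact hnd.1 hu
          · exact hxc rfl
          · exact hx1 rfl
        · rintro (⟨rfl, -, -⟩ | ⟨-, -, rfl⟩ | ⟨rfl, -, -⟩)
          · exact hxc rfl
          · simp only [List.nodup_cons] at hnd
            exact hnd.1 hv
          · exact hxy rfl) (List.nodup_cons.1 hnd).2 (by
        intro z hz
        refine ⟨(hy z (by simp [hz])).1, fun he => ?_⟩
        rcases h.edge_of_flip_edge h1 h2 he with h3 | ⟨h3, -⟩ | ⟨h3, -⟩
        · exact (hy z (by simp [hz])).2 h3
        · exact (hcl z hz).1 h3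
        · exact (hy z (by simp [hz])).1 h3)
    have hyz : ∀ z, IsEdge S y z → IsEdge T y z := fun z hz => hT2 z
      (hpres y z hz (fun e => hxy e.1.symm) (fun e => hyc e.1))
    refine ⟨T, hT, ?_, hyz, ?_⟩
    · intro z hz
      rw [List.mem_cons] at hz
      rcases hz with rfl | hz
      · exact hyz _ (h.edge₂ hc)
      · exact hT1 z hz
    · intro u v he n1 n2
      simp only [List.dropLast_cons_cons, List.mem_cons] at n1 n2
      refine hT3 u v (hpres u v he ?_ ?_) ?_ ?_ <;> tauto

end IsSphere

end Triangulation

theorem List.IsChain.exists_rel {α : Type*} {R : α → α → Prop} {a b : α} :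
    ∀ {u v : List α}, (a :: u ++ b :: v).IsChain R → ∃ z ∈ a :: u, R z b
  | [], v, h => ⟨a, by simp, (isChain_cons_cons.1 h).1⟩
  | c :: u, v, h => by
    obtain ⟨z, hz, hzb⟩ := exists_rel (isChain_cons_cons.1 h).2
    exact ⟨z, mem_cons_of_mem _ hz, hzb⟩

namespace Minor

variable {V : Type*} {H : SimpleGraph V}

/-- Contraction of the edge `x y` to `x`; the vertex `y` becomes isolated. -/
def contract (H : SimpleGraph V) (x y : V) : SimpleGraph V where
  Adj a b := a ≠ b ∧ a ≠ y ∧ b ≠ y ∧ (H.Adj a b ∨ (a = x ∧ H.Adj b y) ∨ (b = x ∧ H.Adj a y))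
  symm := ⟨fun _ _ h => ⟨h.1.symm, h.2.2.1, h.2.1, h.2.2.2.imp (fun h1 => h1.symm) Or.symm⟩⟩
  loopless := ⟨fun _ h => h.1 rfl⟩

theorem isPlanar_contract {x y : V} (hxy : H.Adj x y) (h : IsPlanar H) :
    IsPlanar (contract H x y) :=
  isPlanar_of_contract hxy (fun _ h1 => h1.2.1 rfl) (fun _ _ h1 => h1.2.2.2) h

end Minor

namespace Triangulation

open Minor

variable {V : Type*} [DecidableEq V] {A : Finset V} {H : SimpleGraph V}

theorem exists_adj_of_not_isSep (hA : 5 ≤ A.card) (hsep : ¬ ∃ X D, IsSep A H X D ∧ X.card ≤ 3)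
    {v : V} (hv : v ∈ A) {X : Finset V} (hX : X ⊆ A) (hvX : v ∉ X) (hcard : X.card ≤ 3) :
    ∃ z, z ∉ X ∧ H.Adj v z := by
  by_contra! hcon
  refine hsep ⟨X, {v}, ⟨hX, by simp [hv, hvX], by simp, ?_, ?_⟩, hcard⟩
  · rw [← Finset.card_pos, Finset.card_sdiff_of_subset (by simp [hv, hvX]),
      Finset.card_sdiff_of_subset hX, Finset.card_singleton]
    omega
  · intro x hx y hy
    rw [Finset.mem_singleton] at hx
    subst hx
    exact hcon y (Finset.mem_sdiff.1 (Finset.mem_sdiff.1 hy).1).2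

open Classical in
/-- In a sphere around the contraction of `x y` where the degree of `x` is maximal, the link of `x`
consists of edges of `H`. -/
theorem adj_of_mem_link (hA : 5 ≤ A.card) (hH : ∀ a b, H.Adj a b → a ∈ A)
    (hsep : ¬ ∃ X D, IsSep A H X D ∧ X.card ≤ 3) {x y : V} (hxy : H.Adj x y)
    {T : Finset (V × V × V)} (hT : IsSphere (A.erase y) T)
    (hE : ∀ a b, (contract H x y).Adj a b → IsEdge T a b)
    (hmax : ∀ T', IsSphere (A.erase y) T' → (∀ a b, (contract H x y).Adj a b → IsEdge T' a b) →
      (A.filter (IsEdge T' x)).card ≤ (A.filter (IsEdge T x)).card) {c c' : V}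
    (hc : (x, c, c') ∈ T) : H.Adj c c' := by
  by_contra hcon
  have hmemA : ∀ {a b}, IsEdge T a b → a ∈ A ∧ a ≠ y := fun hab =>
    (Finset.mem_erase.1 (hT.edge_mem hab)).symm
  have hx := hH x y hxy
  have hy := hH y x hxy.symm
  have hxc := hT.ne hc
  have hcx' := hT.ne₃ hc
  have hcc := hT.ne₂ hc
  have hcA := hmemA (hT.edge₂ hc)
  have hcA' := hmemA (hT.edge_symm (hT.edge₂ hc))
  have h1 := hT.cyc hc
  obtain ⟨r, hr⟩ := hT.rev h1
  have hrA := hmemA (hT.edge_symm (hT.edge₃ hr))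
  have hcr := hT.ne₂ hr
  have hrc := hT.ne₃ hr
  by_cases hrx : r = x
  · subst hrx
    obtain ⟨z, hz, hrz⟩ := exists_adj_of_not_isSep (X := {y, c, c'}) hA hsep hx (by
      intro z
      simp only [Finset.mem_insert, Finset.mem_singleton]
      rintro (rfl | rfl | rfl)
      exacts [hy, hcA.1, hcA'.1]) (by simp [hxy.ne, hxc, hcx'.symm]) Finset.card_le_three
    simp only [Finset.mem_insert, Finset.mem_singleton, not_or] at hz
    obtain ⟨w, hw⟩ := hE r z ⟨hrz.ne, hxy.ne, hz.1, Or.inl hrz⟩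
    have := hT.link r (fun u => u = c ∨ u = c') (by
      rintro u v huv (rfl | rfl)
      · exact Or.inr (hT.uniq (hT.cyc' (hT.cyc huv)) hc)
      · exact Or.inl (hT.uniq huv (hT.cyc' hr))) c c' z w hc hw (Or.inl rfl)
    tauto
  by_cases hre : IsEdge T x r
  · obtain ⟨P, hP1, hP2, hP3⟩ := hT.exists_separation h1 hr hre
    refine hsep ⟨{x, y, r}, (A \ {x, y, r}).filter P, ⟨?_, Finset.filter_subset _ _, ⟨c', ?_⟩,
      ⟨c, ?_⟩, ?_⟩, Finset.card_le_three⟩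
    · intro z
      simp only [Finset.mem_insert, Finset.mem_singleton]
      rintro (rfl | rfl | rfl)
      exacts [hx, hy, hrA.1]
    · simp only [Finset.mem_filter, Finset.mem_sdiff, Finset.mem_insert, Finset.mem_singleton]
      exact ⟨⟨hcA'.1, by rintro (h | h | h); exacts [hcx' h, hcA'.2 h, hrc h.symm]⟩, hP1⟩
    · simp only [Finset.mem_filter, Finset.mem_sdiff, Finset.mem_insert, Finset.mem_singleton]
      exact ⟨⟨hcA.1, by rintro (h | h | h); exacts [hxc h.symm, hcA.2 h, hcr h]⟩, fun h => hP2 h.2⟩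
    · intro u hu v hv huv
      simp only [Finset.mem_filter, Finset.mem_sdiff, Finset.mem_insert, Finset.mem_singleton,
        not_or] at hu hv
      obtain ⟨⟨huA, hux, huy, hur⟩, hPu⟩ := hu
      obtain ⟨⟨hvA, hvx, hvy, hvr⟩, hPv⟩ := hv
      refine hPv ⟨⟨hvA, hvx, hvy, hvr⟩, hP3 u v (hE u v ⟨huv.ne, huy, hvy, Or.inl huv⟩) hux hur hvx
        hvr ?_ ?_ hPu⟩
      · rintro ⟨rfl, rfl⟩
        exact hcon huv
      · rintro ⟨rfl, rfl⟩
        exact hcon huv.symm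
  · have k := hT.isSphere_flip h1 hr (Ne.symm hrx) fun w hw => hre ⟨w, hw⟩
    have hle := hmax _ k fun a b hab => IsSphere.flip_edge (hE a b hab) (by
        rintro ⟨rfl, rfl⟩
        rcases hab.2.2.2 with h | ⟨h, -⟩ | ⟨h, -⟩
        exacts [hcon h, hxc h.symm, hcx' h]) (by
        rintro ⟨rfl, rfl⟩
        rcases hab.2.2.2 with h | ⟨h, -⟩ | ⟨h, -⟩
        exacts [hcon h.symm, hcx' h, hxc h.symm])
    refine absurd hle (not_le.2 (Finset.card_lt_card ⟨fun z hz => ?_, fun hsub => ?_⟩))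
    · rw [Finset.mem_filter] at hz ⊢
      exact ⟨hz.1, IsSphere.flip_edge hz.2 (fun e => hxc e.1) (fun e => hcx' e.1.symm)⟩
    · have : r ∈ A.filter (IsEdge (flip T c c' x r) x) := Finset.mem_filter.2
        ⟨hrA.1, c', mem_flip.2 (Or.inr (Or.inr (mem_rot.2 (by tauto))))⟩
      exact hre (Finset.mem_filter.1 (hsub this)).2

section Link

variable {x y : V} {T : Finset (V × V × V)}

/-- If all neighbours of `y` are neighbours of `x`, there is a `K₅` minor. -/
theorem not_isPlanar_of_common (hA : 5 ≤ A.card) (hH : ∀ a b, H.Adj a b → a ∈ A)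
    (hsep : ¬ ∃ X D, IsSep A H X D ∧ X.card ≤ 3) (hxy : H.Adj x y) (hT : IsSphere (A.erase y) T)
    (hE : ∀ a b, (contract H x y).Adj a b → IsEdge T a b)
    (hlink : ∀ {c c'}, (x, c, c') ∈ T → H.Adj c c')
    (hsub : ∀ z, H.Adj y z → z ≠ x → H.Adj x z) : ¬ IsPlanar H := by
  have hy := hH y x hxy.symm
  have hmem : ∀ z, H.Adj y z → z ∈ A := fun z hz => hH z y hz.symm
  obtain ⟨y₁, h1, hy1⟩ := exists_adj_of_not_isSep (X := {x}) hA hsep hy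
    (by simp [hH x y hxy]) (by simp [hxy.ne']) (by simp)
  rw [Finset.mem_singleton] at h1
  have hedge : ∀ z, H.Adj y z → z ≠ x → IsEdge T x z := fun z hz hzx =>
    hE x z ⟨hzx.symm, hxy.ne, hz.ne', Or.inl (hsub z hz hzx)⟩
  obtain ⟨m, hm, hnd, hcov⟩ := hT.exists_link_list (hedge y₁ hy1 h1)
  have hin : ∀ z ∈ y₁ :: m, z ≠ x ∧ z ≠ y := by
    intro z hz
    obtain ⟨v, -, hv⟩ := hm.exists_next hz
    exact ⟨(hT.ne hv).symm, (Finset.mem_erase.1 (hT.mem₂ hv)).1⟩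
  have hmH : (y₁ :: m ++ [y₁]).IsChain H.Adj := hm.imp fun a b => hlink
  obtain ⟨z, hz, hyz⟩ := exists_adj_of_not_isSep (X := {x, y₁}) hA hsep hy (by
      intro z
      simp only [Finset.mem_insert, Finset.mem_singleton]
      rintro (rfl | rfl)
      exacts [hH _ _ hxy, hmem _ hy1]) (by simp [hxy.ne', hy1.ne])
    (Finset.card_le_two.trans (by simp))
  simp only [Finset.mem_insert, Finset.mem_singleton, not_or] at hz
  obtain ⟨u₁, y₂, v, rfl, hy2, hu1⟩ := List.exists_first_of_exists (H.Adj y) (l := m)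
    ⟨z, by simpa [hz.2] using hcov z (hedge z hyz hz.1), hyz⟩
  have h2 := (hin y₂ (by simp)).1
  obtain ⟨z, hz, hyz⟩ := exists_adj_of_not_isSep (X := {x, y₁, y₂}) hA hsep hy (by
      intro z
      simp only [Finset.mem_insert, Finset.mem_singleton]
      rintro (rfl | rfl | rfl)
      exacts [hH _ _ hxy, hmem _ hy1, hmem _ hy2]) (by simp [hxy.ne', hy1.ne, hy2.ne])
      Finset.card_le_three
  simp only [Finset.mem_insert, Finset.mem_singleton, not_or] at hz
  have hzm := hcov z (hedge z hyz hz.1)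
  simp only [List.mem_cons, List.mem_append, hz.2.1, hz.2.2, false_or] at hzm
  obtain ⟨u₂, y₃, u₃, rfl, hy3, -⟩ := List.exists_first_of_exists (H.Adj y) (l := v)
    ⟨z, hzm.resolve_left fun h => hu1 z h hyz, hyz⟩
  have h3 := (hin y₃ (by simp)).1
  have hx1 := hsub _ hy1 h1
  have hx2 := hsub _ hy2 h2
  have hx3 := hsub _ hy3 h3
  have c12 : (y₁ :: u₁ ++ y₂ :: u₂).IsChain H.Adj := hmH.of_isInfix ⟨[], y₃ :: u₃ ++ [y₁], by simp⟩
  have c23 : (y₂ :: u₂ ++ y₃ :: u₃).IsChain H.Adj := hmH.of_isInfix ⟨y₁ :: u₁, [y₁], by simp⟩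
  have c31 : (y₃ :: u₃ ++ y₁ :: []).IsChain H.Adj :=
    hmH.of_isInfix ⟨y₁ :: u₁ ++ y₂ :: u₂, [], by simp⟩
  obtain ⟨a, ha, ha'⟩ := c12.exists_rel
  obtain ⟨b, hb, hb'⟩ := c23.exists_rel
  obtain ⟨d, hd, hd'⟩ := c31.exists_rel
  refine fun hP => hP.1 (isMinorOf_K5_of_sets (P₁ := {x}) (P₂ := {y}) (P₃ := {z | z ∈ y₁ :: u₁})
    (P₄ := {z | z ∈ y₂ :: u₂}) (P₅ := {z | z ∈ y₃ :: u₃}) ?_ ?_)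
  · simp only [List.forall_mem_cons]
    exact ⟨connOn_singleton _, connOn_singleton _,
      connOn_of_isChain (by simp) (c12.of_isInfix ⟨[], y₂ :: u₂, by simp⟩),
      connOn_of_isChain (by simp) (c23.of_isInfix ⟨[], y₃ :: u₃, by simp⟩),
      connOn_of_isChain (by simp) (c31.of_isInfix ⟨[], [y₁], by simp⟩), by simp⟩
  · simp only [List.pairwise_cons, List.mem_cons, List.not_mem_nil, or_false, forall_eq_or_imp,
      forall_eq, IsEmpty.forall_iff, implies_true, List.Pairwise.nil, and_true,
      Set.mem_singleton_iff, Set.disjoint_left, Set.mem_ofPred_eq,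
      exists_eq_left]
    simp only [List.mem_cons, List.mem_append, List.nodup_cons, List.nodup_append, ne_eq] at *
    refine ⟨⟨⟨hxy.ne, hxy⟩, ⟨?_, y₁, by simp, hx1⟩, ⟨?_, y₂, by simp, hx2⟩, ?_, y₃, by simp, hx3⟩,
      ⟨⟨?_, y₁, by simp, hy1⟩, ⟨?_, y₂, by simp, hy2⟩, ?_, y₃, by simp, hy3⟩,
      ⟨⟨?_, a, ha, y₂, by simp, ha'⟩, ?_, y₁, by simp, d, hd, hd'.symm⟩,
      ?_, b, hb, y₃, by simp, hb'⟩
    all_goals clear hE hcov hH hsep hmem hedge hlink hsub hu1 c12 c23 c31 hm hmH; grind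

end Link

end Triangulation

namespace Triangulation

open Minor

section Link

variable {V : Type*} [DecidableEq V] {A : Finset V} {H : SimpleGraph V}
variable {x y : V} {T : Finset (V × V × V)}

/-- If `y` has a neighbour that is not a neighbour of `x`, then the sphere around the contraction
can be modified to contain `H`. -/
theorem covers_of_not_adj (hA : 5 ≤ A.card) (hH : ∀ a b, H.Adj a b → a ∈ A)
    (hsep : ¬ ∃ X D, IsSep A H X D ∧ X.card ≤ 3) (hxy : H.Adj x y) (hT : IsSphere (A.erase y) T)
    (hE : ∀ a b, (contract H x y).Adj a b → IsEdge T a b)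
    (hlink : ∀ {c c'}, (x, c, c') ∈ T → H.Adj c c') {y₀ : V} (hy0 : H.Adj y y₀) (h0 : y₀ ≠ x)
    (hx0 : ¬ H.Adj x y₀) (hP : IsPlanar H) : Covers A H := by
  have hx := hH x y hxy
  have hy := hH y x hxy.symm
  have hedge : ∀ z, z ≠ x → z ≠ y → H.Adj x z ∨ H.Adj y z → IsEdge T x z := fun z hzx hzy hz =>
    hE x z ⟨hzx.symm, hxy.ne, hzy, hz.imp_right fun h => Or.inl ⟨rfl, h.symm⟩⟩
  obtain ⟨m, hm, hnd, hcov⟩ := hT.exists_link_list (hedge y₀ h0 hy0.ne' (Or.inr hy0))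
  have hin : ∀ z ∈ y₀ :: m, z ≠ x ∧ z ≠ y := by
    intro z hz
    obtain ⟨v, -, hv⟩ := hm.exists_next hz
    exact ⟨(hT.ne hv).symm, (Finset.mem_erase.1 (hT.mem₂ hv)).1⟩
  have hmH : (y₀ :: m ++ [y₀]).IsChain H.Adj := hm.imp fun a b => hlink
  obtain ⟨z, hz, hxz⟩ := exists_adj_of_not_isSep (X := {y}) hA hsep hx
    (by simp [hy]) (by simp [hxy.ne]) (by simp)
  rw [Finset.mem_singleton] at hz
  obtain ⟨u, x₁, v, rfl, hx1, hu⟩ := List.exists_first_of_exists (H.Adj x) (l := m)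
    ⟨z, (List.mem_cons.1 (hcov z (hedge z hxz.ne' hz (Or.inl hxz)))).resolve_left
      (by rintro rfl; exact hx0 hxz), hxz⟩
  obtain ⟨z, hz, hxz⟩ := exists_adj_of_not_isSep (X := {y, x₁}) hA hsep hx (by
      intro z
      simp only [Finset.mem_insert, Finset.mem_singleton]
      rintro (rfl | rfl)
      exacts [hy, hH _ _ hx1.symm]) (by simp [hxy.ne, hx1.ne]) (Finset.card_le_two.trans (by simp))
  simp only [Finset.mem_insert, Finset.mem_singleton, not_or] at hz
  have hzm := hcov z (hedge z hxz.ne' hz.1 (Or.inl hxz))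
  obtain ⟨r, x₂, w, rfl, hx2, hw⟩ := List.exists_last_of_exists (H.Adj x) (l := v) ⟨z, by
    simp only [List.mem_cons, List.mem_append, hz.2, false_or] at hzm
    rcases hzm with rfl | h | h
    exacts [absurd hxz hx0, absurd hxz (hu z h), h], hxz⟩
  clear hzm hz hxz z
  by_cases hmid : ∃ y', y' ∈ r ∧ H.Adj y y'
  · obtain ⟨y', hyr, hyy'⟩ := hmid
    obtain ⟨m₁, m₂, rfl⟩ := List.append_of_mem hyr
    have c1 : (y₀ :: u ++ x₁ :: m₁).IsChain H.Adj :=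
      hmH.of_isInfix ⟨[], y' :: m₂ ++ x₂ :: w ++ [y₀], by simp⟩
    have c2 : (x₁ :: m₁ ++ y' :: m₂).IsChain H.Adj :=
      hmH.of_isInfix ⟨y₀ :: u, x₂ :: w ++ [y₀], by simp⟩
    have c3 : (y' :: m₂ ++ x₂ :: w).IsChain H.Adj :=
      hmH.of_isInfix ⟨y₀ :: u ++ x₁ :: m₁, [y₀], by simp⟩
    have c4 : (x₂ :: w ++ y₀ :: []).IsChain H.Adj :=
      hmH.of_isInfix ⟨y₀ :: u ++ x₁ :: m₁ ++ y' :: m₂, [], by simp⟩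
    obtain ⟨a₁, ha₁, ha₁'⟩ := c1.exists_rel
    obtain ⟨a₂, ha₂, ha₂'⟩ := c2.exists_rel
    obtain ⟨a₃, ha₃, ha₃'⟩ := c3.exists_rel
    obtain ⟨a₄, ha₄, ha₄'⟩ := c4.exists_rel
    refine absurd (isMinorOf_K33_of_sets (P₁ := {x}) (P₂ := {z | z ∈ y₀ :: u})
      (P₃ := {z | z ∈ y' :: m₂}) (Q₁ := {y}) (Q₂ := {z | z ∈ x₁ :: m₁})
      (Q₃ := {z | z ∈ x₂ :: w}) ?_ ?_ ?_) hP.2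
    · simp only [List.forall_mem_cons]
      exact ⟨connOn_singleton _, connOn_of_isChain (by simp)
          (c1.of_isInfix ⟨[], x₁ :: m₁, by simp⟩),
        connOn_of_isChain (by simp) (c3.of_isInfix ⟨[], x₂ :: w, by simp⟩), connOn_singleton _,
        connOn_of_isChain (by simp) (c2.of_isInfix ⟨[], y' :: m₂, by simp⟩),
        connOn_of_isChain (by simp) (c4.of_isInfix ⟨[], [y₀], by simp⟩), by simp⟩
    · simp only [List.pairwise_cons, List.mem_cons, List.not_mem_nil, or_false, forall_eq_or_imp,
        forall_eq, IsEmpty.forall_iff, implies_true, List.Pairwise.nil, and_true,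
        Set.mem_singleton_iff,
        Set.disjoint_left, Set.mem_ofPred_eq]
      have hne := hxy.ne
      simp only [List.mem_cons, List.mem_append, List.nodup_cons, List.nodup_append, ne_eq] at *
      clear hE hcov hH hsep hedge hlink hu c1 c2 c3 c4 hm hmH hP hT
      grind
    · simp only [List.forall_mem_cons, List.not_mem_nil, IsEmpty.forall_iff, implies_true, and_true]
      exact ⟨⟨⟨x, rfl, y, rfl, hxy⟩, ⟨x, rfl, x₁, by simp, hx1⟩, x, rfl, x₂, by simp, hx2⟩,
        ⟨⟨y₀, by simp, y, rfl, hy0.symm⟩, ⟨a₁, ha₁, x₁, by simp, ha₁'⟩,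
          y₀, by simp, a₄, ha₄, ha₄'.symm⟩,
        ⟨⟨y', by simp, y, rfl, hyy'.symm⟩, ⟨y', by simp, a₂, ha₂, ha₂'.symm⟩,
          a₃, ha₃, x₂, by simp, ha₃'⟩⟩
  · have hch : (x₂ :: w ++ y₀ :: (u ++ [x₁])).IsChain fun a b => (x, a, b) ∈ T :=
      List.isChain_split.2 ⟨hm.of_isInfix ⟨y₀ :: u ++ x₁ :: r, [], by simp⟩,
        hm.of_isInfix ⟨[], r ++ x₂ :: w ++ [y₀], by simp⟩⟩
    obtain ⟨n, l, hnl⟩ : ∃ n l, w ++ y₀ :: (u ++ [x₁]) = n :: l := by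
      rcases w with _ | ⟨a, w⟩
      exacts [⟨_, _, rfl⟩, ⟨_, _, rfl⟩]
    have hdrop : (n :: l).dropLast = w ++ y₀ :: u := by
      rw [← hnl, show w ++ y₀ :: (u ++ [x₁]) = (w ++ y₀ :: u) ++ [x₁] by simp,
        List.dropLast_concat]
    have hmemnl : ∀ z, z ∈ n :: l ↔ z ∈ w ∨ z = y₀ ∨ z ∈ u ∨ z = x₁ := by
      intro z
      simp [← hnl]
    rw [List.cons_append, hnl, List.isChain_cons_cons] at hch
    have hnd' : x₂ ∉ n :: l ∧ (n :: l).Nodup := by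
      rw [hmemnl, ← hnl]
      clear hE hcov hH hsep hedge hlink hu hm hmH hP hT hin
      simp only [List.mem_cons, List.mem_append, List.nodup_cons, List.nodup_append, ne_eq] at *
      grind
    obtain ⟨T₁, hT1, hT1E, hT1S, hT1y, f1, f2, f3⟩ :=
      hT.exists_insert hch.1 (Finset.notMem_erase y A)
    rw [Finset.insert_erase hy] at hT1
    have hinl : ∀ z ∈ n :: l, z ≠ x ∧ z ≠ y := fun z hz => hin z (by
      rw [hmemnl] at hz
      simp only [List.mem_cons, List.mem_append]
      tauto)
    obtain ⟨T₂, hT2, g1, g2, g3⟩ := hT1.exists_flip_chain l (hT1.cyc f3)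
      (hch.2.imp_of_mem_imp fun a b ha _ hab => hT1S _ hab (by
        rw [mem_rot]
        rintro (⟨-, h, -⟩ | ⟨h, -, -⟩ | ⟨h, -, -⟩)
        · exact hnd'.1 (h ▸ ha)
        · exact hT.ne hch.1 h
        · exact (hT.ne₃ hch.1).symm h)) hnd'.2 (fun z hz =>
        ⟨(hinl z (List.mem_cons_of_mem _ hz)).2, fun h => by
          have h2 := List.mem_cons_of_mem n hz
          rcases hT1y z h with h | h | h
          · exact (hinl z h2).1 h
          · exact hnd'.1 (h ▸ h2)
          · exact (List.nodup_cons.1 hnd'.2).1 (h ▸ hz)⟩)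
    have hdropx : ∀ z ∈ (n :: l).dropLast, ¬ H.Adj x z := by
      intro z hz
      rw [hdrop, List.mem_append, List.mem_cons] at hz
      rcases hz with h | rfl | h
      exacts [hw z h, hx0, hu z h]
    have hyE : ∀ z, H.Adj y z → IsEdge T₂ y z := by
      intro z hz
      by_cases hzx : z = x
      · subst hzx
        exact g2 z (hT1.edge_symm (hT1.edge₃ f1))
      by_cases hzn : z ∈ n :: l
      · exact g1 z hzn
      have := hcov z (hedge z hzx hz.ne' (Or.inr hz))
      rw [hmemnl] at hzn
      simp only [List.mem_cons, List.mem_append] at this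
      have hzx2 : z = x₂ := by
        by_contra h
        exact hmid ⟨z, by tauto, hz⟩
      subst hzx2
      exact g2 z (hT1.edge_symm (hT1.edge₂ f1))
    refine ⟨T₂, hT2, fun a b hab => ?_⟩
    by_cases hay : a = y
    · exact hay ▸ hyE b (hay ▸ hab)
    by_cases hby : b = y
    · exact hby ▸ hT2.edge_symm (hyE a (hby ▸ hab.symm))
    refine g3 a b (hT1E a b (hE a b ⟨hab.ne, hay, hby, Or.inl hab⟩)) ?_ ?_
    · rintro ⟨rfl, h⟩
      exact hdropx b h hab
    · rintro ⟨rfl, h⟩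
      exact hdropx a h hab.symm

end Link

theorem covers_of_isPlanar {V : Type*} [DecidableEq V] (k : ℕ) : ∀ A : Finset V, A.card = k →
    4 ≤ A.card → ∀ H : SimpleGraph V, (∀ x y, H.Adj x y → x ∈ A) → IsPlanar H → Covers A H := by
  classical
  induction k using Nat.strong_induction_on with
  | _ k ih =>
  rintro A rfl h4 H hH hP
  have ih : ∀ B : Finset V, 4 ≤ B.card → B.card < A.card → ∀ H' : SimpleGraph V,
      (∀ x y, H'.Adj x y → x ∈ B) → IsPlanar H' → Covers B H' :=
    fun B hB hBA => ih B.card hBA B rfl hB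
  rcases h4.eq_or_lt with h4 | hA
  · obtain ⟨a, b, c, d, hab, hac, had, hbc, hbd, hcd, rfl⟩ := Finset.card_eq_four.1 h4.symm
    have hS := isSphere_tetrahedron hab hac had hbc hbd hcd
    refine ⟨_, hS, fun x y hxy => ?_⟩
    have hx := hH x y hxy
    have hy := hH y x hxy.symm
    have hne := hxy.ne
    have habc : (a, b, c) ∈ rot a b c ∪ rot b a d ∪ rot c b d ∪ rot a c d := by simp [mem_rot]
    have hbad : (b, a, d) ∈ rot a b c ∪ rot b a d ∪ rot c b d ∪ rot a c d := by simp [mem_rot]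
    have hcbd : (c, b, d) ∈ rot a b c ∪ rot b a d ∪ rot c b d ∪ rot a c d := by simp [mem_rot]
    have e1 : IsEdge _ a b := ⟨c, habc⟩
    have e2 := hS.edge₂ habc
    have e3 := hS.edge₃ habc
    have e4 := hS.edge₂ hbad
    have e5 := hS.edge₃ hbad
    have e6 := hS.edge₃ hcbd
    have e7 := hS.edge_symm e1
    have e8 := hS.edge_symm e2
    have e9 := hS.edge_symm e3
    have e10 := hS.edge_symm e4
    have e11 := hS.edge_symm e5
    have e12 := hS.edge_symm e6
    simp only [Finset.mem_insert, Finset.mem_singleton] at hx hy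
    rcases hx with rfl | rfl | rfl | rfl <;> rcases hy with rfl | rfl | rfl | rfl <;>
      first | exact absurd rfl hne | assumption
  have hA : 5 ≤ A.card := hA
  by_cases hdeg : ∀ v ∈ A, ∀ N : Finset V, (∀ x, x ∈ N ↔ H.Adj v x) → 3 ≤ N.card
  swap
  · push Not at hdeg
    obtain ⟨v, hv, N, hN, hN3⟩ := hdeg
    exact covers_of_degree_le_two hA hH hP hv (Nat.le_of_lt_succ hN3) hN ih
  by_cases hsep : ∃ X D, IsSep A H X D ∧ X.card ≤ 3
  · exact covers_of_isSep hH hP hdeg ih hsep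
  obtain ⟨x, hx⟩ : A.Nonempty := Finset.card_pos.1 (by omega)
  obtain ⟨y, -, hxy⟩ := exists_adj_of_not_isSep (X := ∅) hA hsep hx (by simp) (by simp) (by simp)
  have hy := hH y x hxy.symm
  have hcard := Finset.card_erase_of_mem hy
  obtain ⟨T, ⟨hT, hE⟩, hmin⟩ := exists_minimalFor_of_wellFoundedLT
    (fun T => IsSphere (A.erase y) T ∧ ∀ a b, (contract H x y).Adj a b → IsEdge T a b)
    (fun T => A.card - (A.filter (IsEdge T x)).card)
    (ih (A.erase y) (by omega) (by omega) (contract H x y) (by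
      rintro a b ⟨-, hay, -, h⟩
      refine Finset.mem_erase.2 ⟨hay, ?_⟩
      rcases h with h | ⟨rfl, -⟩ | ⟨-, h⟩
      exacts [hH a b h, hx, hH a y h]) (isPlanar_contract hxy hP))
  have hlink : ∀ {c c'}, (x, c, c') ∈ T → H.Adj c c' := fun hc =>
    adj_of_mem_link hA hH hsep hxy hT hE (fun T' hT' hE' => by
      by_contra hlt
      have h1 := Finset.card_filter_le A (IsEdge T' x)
      have h2 := hmin (j := T') ⟨hT', hE'⟩ (by dsimp only; omega)
      dsimp only at h2
      omega) hc
  by_cases hsub : ∀ z, H.Adj y z → z ≠ x → H.Adj x z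
  · exact absurd hP (not_isPlanar_of_common hA hH hsep hxy hT hE hlink hsub)
  · push Not at hsub
    obtain ⟨y₀, hy0, h0, hx0⟩ := hsub
    exact covers_of_not_adj hA hH hsep hxy hT hE hlink hy0 h0 hx0 hP

end Triangulation

theorem List.sum_map_le_of_isChain {α : Type*} {f : α → ℕ} {β : ℕ} :
    ∀ {l : List α}, (∀ a ∈ l, f a ≤ β) → l.IsChain (fun a b => f a + f b ≤ β) →
      (l.map f).sum ≤ β * ((l.length + 1) / 2)
  | [], _, _ => by simp
  | [a], h, _ => by simpa using h a
  | a :: b :: l, h, hc => by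
    rw [isChain_cons_cons] at hc
    have := sum_map_le_of_isChain (f := f) (l := l) (fun c hc => h c (by simp [hc])) hc.2.tail
    rw [map_cons, map_cons, sum_cons, sum_cons, length_cons, length_cons,
      show (l.length + 1 + 1 + 1) / 2 = (l.length + 1) / 2 + 1 by omega, mul_add]
    omega

namespace Triangulation

variable {V : Type*} [DecidableEq V] {A : Finset V} {S : Finset (V × V × V)}

/-- The set of neighbours of `v`, that is, the vertices of its link. -/
def nbrs (S : Finset (V × V × V)) (v : V) : Finset V :=
  (S.filter fun t => t.1 = v).image fun t => t.2.1

theorem mem_nbrs {v u : V} : u ∈ nbrs S v ↔ IsEdge S v u := by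
  simp [nbrs, IsEdge]

theorem IsSphere.sum_card_nbrs (h : IsSphere A S) :
    ∑ v ∈ A, ((nbrs S v).card : ℤ) = 6 * A.card - 12 := by
  have h1 : S.card = ∑ v ∈ A, (S.filter fun t => t.1 = v).card :=
    Finset.card_eq_sum_card_fiberwise fun t ht => h.mem ht
  have h2 : ∀ v ∈ A, (nbrs S v).card = (S.filter fun t => t.1 = v).card := by
    refine fun v _ => Finset.card_image_of_injOn ?_
    rintro ⟨a, b, c⟩ ht ⟨a', b', c'⟩ ht' (rfl : b = b')
    simp only [Finset.coe_filter, Set.mem_ofPred_eq] at ht ht'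
    obtain ⟨ht, rfl⟩ := ht
    obtain ⟨ht', rfl⟩ := ht'
    rw [h.uniq ht ht']
  rw [← Finset.sum_congr rfl h2] at h1
  have h3 := h.card
  rw [h1] at h3
  push_cast [← @Nat.cast_inj ℤ] at h3
  linarith

/-- The bound on the charge `w` sent along an edge by a vertex of degree `t`, where `z` of the
neighbours of the edge are large. All charges are multiples of `1/6`. -/
def Cap (t z w : ℕ) : Prop :=
  (t = 7 → w ≤ z) ∧ (t = 8 → 4 * w ≤ 6 + 3 * z) ∧ (t = 9 ∨ t = 10 → w ≤ 2 + z) ∧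
    (11 ≤ t → w ≤ 2 ∨ (w ≤ 3 ∧ 1 ≤ z) ∨ (w ≤ 6 ∧ 2 ≤ z))

theorem IsSphere.sum_le_of_cap (h : IsSphere A S) {v : V} {w nb : V → ℕ}
    (h7 : 7 ≤ (nbrs S v).card) (hnb : ∀ u, nb u ≤ 1)
    (hw0 : ∀ u, nb u = 1 → w u = 0)
    (hw : ∀ u p q, (v, u, p) ∈ S → (v, q, u) ∈ S → Cap (nbrs S v).card (nb p + nb q) (w u)) :
    ∑ u ∈ nbrs S v, w u ≤ 6 * ((nbrs S v).card - 6) := by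
  have hnx : ∀ u, ∃ p, u ∈ nbrs S v → (v, u, p) ∈ S := fun u => by
    by_cases hu : u ∈ nbrs S v
    · exact (mem_nbrs.1 hu).imp fun _ h _ => h
    · exact ⟨u, fun h => absurd h hu⟩
  have hpv : ∀ u, ∃ q, u ∈ nbrs S v → (v, q, u) ∈ S := fun u => by
    by_cases hu : u ∈ nbrs S v
    · obtain ⟨p, hp⟩ := mem_nbrs.1 hu
      exact (h.exists_prev hp).imp fun _ h _ => h
    · exact ⟨u, fun h => absurd h hu⟩
  choose nx hnx using hnx
  choose pv hpv using hpv
  set t := (nbrs S v).card with ht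
  have hsum : ∀ f : V → V, (∀ u ∈ nbrs S v, f u ∈ nbrs S v) → Set.InjOn f (nbrs S v) →
      ∑ u ∈ nbrs S v, nb (f u) ≤ ∑ u ∈ nbrs S v, nb u := by
    intro f hf hinj
    rw [← Finset.sum_image (f := nb) hinj]
    exact Finset.sum_le_sum_of_subset (Finset.image_subset_iff.2 hf)
  have hnxs := hsum nx (fun u hu => mem_nbrs.2 (h.edge₃ (hnx u hu)))
    fun a ha b hb hab => h.prev_uniq (hnx a ha) (hab ▸ hnx b hb)
  have hpvs := hsum pv (fun u hu => mem_nbrs.2 ⟨_, hpv u hu⟩)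
    fun a ha b hb hab => h.uniq (hpv a ha) (hab ▸ hpv b hb)
  have key : ∀ a b : ℕ,
      (∀ u ∈ nbrs S v, a * w u + 2 * b * nb u ≤ 2 * b + b * nb (nx u) + b * nb (pv u)) →
      a * ∑ u ∈ nbrs S v, w u ≤ 2 * b * t := by
    intro a b hab
    have h1 := Finset.sum_le_sum hab
    simp only [Finset.sum_add_distrib, ← Finset.mul_sum, Finset.sum_const, smul_eq_mul] at h1
    have h2 := Nat.mul_le_mul_left b hnxs
    have h3 := Nat.mul_le_mul_left b hpvs
    rw [← ht] at h1
    linarith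
  have hcap : ∀ u ∈ nbrs S v, Cap t (nb (nx u) + nb (pv u)) (w u) := fun u hu =>
    hw u _ _ (hnx u hu) (hpv u hu)
  have hpair : ∀ β, (t = 7 ∧ β = 2 ∨ t = 11 ∧ β = 6) → ∑ u ∈ nbrs S v, w u ≤ β * (t / 2) := by
    intro β ht'
    have hle : ∀ u ∈ nbrs S v, w u ≤ β := by
      intro u hu
      have h0 := hcap u hu
      have h1 := hnb (nx u)
      have h2 := hnb (pv u)
      rcases ht' with ⟨h7, rfl⟩ | ⟨h7, rfl⟩
      · have := h0.1 h7
        omega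
      · have := h0.2.2.2 h7.ge
        omega
    by_cases hb : ∃ b ∈ nbrs S v, nb b = 1
    · obtain ⟨b, hb, hb1⟩ := hb
      obtain ⟨m, hm, hnd, hcov⟩ := h.exists_link_list (mem_nbrs.1 hb)
      have hmem : ∀ u, u ∈ nbrs S v ↔ u ∈ b :: m := by
        refine fun u => ⟨fun hu => hcov u (mem_nbrs.1 hu), fun hu => mem_nbrs.2 ?_⟩
        obtain ⟨q, -, hq⟩ := hm.exists_next hu
        exact ⟨q, hq⟩
      have heq : nbrs S v = (b :: m).toFinset := by
        ext u
        rw [hmem, List.mem_toFinset]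
      have hlen : t = m.length + 1 := by
        rw [ht, heq, List.toFinset_card_of_nodup hnd, List.length_cons]
      have hsumm : ∑ u ∈ nbrs S v, w u = (m.map w).sum := by
        rw [heq, List.sum_toFinset _ hnd, List.map_cons, List.sum_cons, hw0 b hb1, zero_add]
      rw [hsumm, hlen]
      refine List.sum_map_le_of_isChain (fun a ha => hle a ((hmem a).2 (List.mem_cons_of_mem _ ha)))
        ((hm.of_isInfix ⟨[b], [b], by simp⟩).imp_of_mem_imp fun a c ha hc hac => ?_)
      have ha' := (hmem a).2 (List.mem_cons_of_mem _ ha)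
      have hc' := (hmem c).2 (List.mem_cons_of_mem _ hc)
      have hla := hle a ha'
      have hlc := hle c hc'
      have hwa := hw0 a
      have hwc := hw0 c
      have hna := hnb a
      have hnc := hnb c
      have hca := hw a c (pv a) hac (hpv a ha')
      have hcc := hw c (nx c) a (hnx c hc') hac
      have hn1 := hnb (pv a)
      have hn2 := hnb (nx c)
      by_cases ha1 : nb a = 1
      · rw [hwa ha1, zero_add]
        exact hlc
      by_cases hc1 : nb c = 1
      · rw [hwc hc1, add_zero]
        exact hla
      rcases ht' with ⟨h7, rfl⟩ | ⟨h7, rfl⟩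
      · have k1 := hca.1 h7
        have k2 := hcc.1 h7
        clear * - k1 k2 hn1 hn2 hna hnc ha1 hc1
        omega
      · have k1 := hca.2.2.2 h7.ge
        have k2 := hcc.2.2.2 h7.ge
        clear * - k1 k2 hn1 hn2 hna hnc ha1 hc1
        omega
    · push Not at hb
      have h2 : ∀ u ∈ nbrs S v, w u ≤ if t = 7 then 0 else 2 := by
        intro u hu
        have := hcap u hu
        have h1 := hnb (nx u)
        have h2 := hnb (pv u)
        have h3 := hb _ (mem_nbrs.2 (h.edge₃ (hnx u hu)))
        have h4 := hb _ (mem_nbrs.2 ⟨_, hpv u hu⟩)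
        unfold Cap at this
        split_ifs <;> omega
      have h3 : ∑ u ∈ nbrs S v, w u ≤ t * if t = 7 then 0 else 2 :=
        Finset.sum_le_card_nsmul _ _ _ h2
      rcases ht' with ⟨h7, rfl⟩ | ⟨h7, rfl⟩ <;> rw [h7] at h3 ⊢ <;> exact h3.trans (by simp)
  have h8 : t = 8 → 4 * ∑ u ∈ nbrs S v, w u ≤ 2 * 3 * t := fun h8 => key 4 3 fun u hu => by
    have h0 := hw0 u
    have h1 := hnb u
    have h2 := (hcap u hu).2.1 h8
    omega
  have h9 : t = 9 ∨ t = 10 → 1 * ∑ u ∈ nbrs S v, w u ≤ 2 * 1 * t := fun h9 => key 1 1 fun u hu => by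
    have h0 := hw0 u
    have h1 := hnb u
    have h2 := (hcap u hu).2.2.1 h9
    omega
  have h12 : 12 ≤ t → 2 * ∑ u ∈ nbrs S v, w u ≤ 2 * 3 * t := fun h12 => key 2 3 fun u hu => by
    have h0 := hw0 u
    have h1 := hnb u
    have h2 := (hcap u hu).2.2.2 (by omega)
    omega
  have e1 := hpair 2
  have e2 := hpair 6
  clear * - h7 e1 e2 h8 h9 h12
  clear_value t
  generalize ∑ u ∈ nbrs S v, w u = s at *
  omega

end Triangulation

theorem Finset.exists_sorted_list {α : Type*} [DecidableEq α] (f : α → ℕ) (N : Finset α) :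
    ∃ l : List α, l.Pairwise (fun a b => f a ≤ f b) ∧ l.Nodup ∧ l.length = N.card ∧
      ∀ a, a ∈ l ↔ a ∈ N := by
  refine ⟨N.toList.insertionSort (fun a b => f a ≤ f b), ?_, ?_, ?_, ?_⟩
  · have : Std.Total (fun a b : α => f a ≤ f b) := ⟨fun a b => le_total _ _⟩
    have : IsTrans α (fun a b : α => f a ≤ f b) := ⟨fun a b c => le_trans⟩
    exact List.pairwise_insertionSort _ _
  · exact (List.perm_insertionSort _ _).nodup_iff.2 N.nodup_toList
  · rw [List.length_insertionSort, Finset.length_toList]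
  · intro a
    rw [List.mem_insertionSort, Finset.mem_toList]

namespace Discharging

open Triangulation

section Degrees

variable {V : Type*} [Fintype V] (G : SimpleGraph V) [DecidableRel G.Adj]

theorem card_neighborFinset (v : V) : (G.neighborFinset v).card = deg G v := by
  rw [deg, Set.ncard_eq_toFinset_card']
  rfl

theorem nDegLe_eq (v : V) (k : ℕ) :
    nDegLe G v k = ((G.neighborFinset v).filter fun w => deg G w ≤ k).card := by
  rw [nDegLe, ← Set.ncard_coe_finset]
  simp

theorem nDegEq_eq (v : V) (k : ℕ) :
    nDegEq G v k = ((G.neighborFinset v).filter fun w => deg G w = k).card := by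
  rw [nDegEq, ← Set.ncard_coe_finset]
  simp

theorem two_le_deg [DecidableEq V] (h : TwoConnected G) (v : V) : 2 ≤ deg G v := by
  rw [← card_neighborFinset]
  by_contra! hlt
  obtain ⟨u, hu⟩ : ∃ u, G.neighborFinset v ⊆ {u} ∧ u ≠ v := by
    rcases Nat.lt_succ_iff.1 hlt |>.eq_or_lt with h1 | h0
    · obtain ⟨u, hu⟩ := Finset.card_eq_one.1 h1
      refine ⟨u, hu.subset, ?_⟩
      rintro rfl
      have : u ∈ G.neighborFinset u := by rw [hu]; exact Finset.mem_singleton_self u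
      simp at this
    · obtain ⟨u, -, hu⟩ := Finset.exists_mem_ne (s := Finset.univ) (a := v)
        (by rw [Finset.card_univ]; have := h.1; omega)
      refine ⟨u, ?_, hu⟩
      rw [Finset.card_eq_zero.1 (Nat.lt_one_iff.1 h0)]
      exact Finset.empty_subset _
  obtain ⟨w, hw⟩ : ∃ w, w ∉ ({u, v} : Finset V) := by
    by_contra! hall
    have h1 := Finset.card_le_card (fun x _ => hall x : Finset.univ ⊆ ({u, v} : Finset V))
    have h2 := Finset.card_le_two (a := u) (b := v)
    have := h.1
    rw [Finset.card_univ] at h1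
    omega
  simp only [Finset.mem_insert, Finset.mem_singleton, not_or] at hw
  have : Nontrivial {w | w ≠ u} := ⟨⟨v, hu.2.symm⟩, ⟨w, hw.1⟩,
    fun e => hw.2 (congrArg (·.1) e).symm⟩
  obtain ⟨x, hx⟩ := (h.2 u).preconnected.exists_adj_of_nontrivial ⟨v, hu.2.symm⟩
  have hx' : G.Adj v x := hx
  exact x.2 (Finset.mem_singleton.1 (hu.1 ((G.mem_neighborFinset v x).2 hx')))

end Degrees

end Discharging

namespace Discharging

open Triangulation

/-- A graph without the four configurations, together with a triangulation `S` of the sphere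
containing the graph induced on the set `A` of its vertices of degree other than two. -/
structure IsReduced {V : Type*} [Fintype V] (G : SimpleGraph V) (A : Finset V)
    (S : Finset (V × V × V)) : Prop where
  sphere : IsSphere A S
  mem_iff : ∀ v, v ∈ A ↔ deg G v ≠ 2
  two_le : ∀ v, 2 ≤ deg G v
  edge : ∀ a b, G.Adj a b → deg G a ≠ 2 → deg G b ≠ 2 → IsEdge S a b
  not_A1 : ¬ ConfigA1 G
  not_A2 : ¬ ConfigA2 G
  not_A3 : ¬ ConfigA3 G
  not_A4 : ¬ ConfigA4 G

/-- Indicator of the vertices of degree at least six. -/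
noncomputable def large {V : Type*} (G : SimpleGraph V) (v : V) : ℕ := if 6 ≤ deg G v then 1 else 0

theorem large_eq_one {V : Type*} {G : SimpleGraph V} {v : V} : large G v = 1 ↔ 6 ≤ deg G v := by
  unfold large
  split_ifs <;> simp_all

theorem large_le_one {V : Type*} (G : SimpleGraph V) (v : V) : large G v ≤ 1 := by
  unfold large
  split_ifs <;> simp

variable {V : Type*} [Fintype V] {G : SimpleGraph V} {A : Finset V} {S : Finset (V × V × V)}

namespace IsReduced

theorem deg_ne_two [DecidableRel G.Adj] (h : IsReduced G A S) {u v : V} (huv : G.Adj u v)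
    (hu : deg G u ≤ 9) : deg G v ≠ 2 := by
  intro hv
  rw [← card_neighborFinset] at hv
  obtain ⟨w, hw, hne⟩ := Finset.exists_mem_ne (by omega : 1 < (G.neighborFinset v).card) u
  rw [card_neighborFinset] at hv
  exact h.not_A1 ⟨u, v, w, huv, (G.mem_neighborFinset v w).1 hw, hne.symm, hv, hu⟩

theorem nine_le_deg (h : IsReduced G A S) {u v : V} (huv : G.Adj u v) (hu : deg G u = 3) :
    9 ≤ deg G v := by
  by_contra! hv
  exact h.not_A3 ⟨u, v, huv, hu, Or.inl (by omega)⟩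

end IsReduced

variable [DecidableEq V] [DecidableRel G.Adj]

/-- The vertices that may receive charge from `v` are few enough that `v` can afford to give one
to each of them. -/
def IsFree (G : SimpleGraph V) [DecidableRel G.Adj] (S : Finset (V × V × V)) (v : V) : Prop :=
  ((G.neighborFinset v).filter fun u => 3 ≤ deg G u ∧ deg G u ≤ 5).card + 6 ≤ (nbrs S v).card

/-- `v` may send `w / 6` units of charge to its neighbour `u`. -/
def CanGive (G : SimpleGraph V) [DecidableRel G.Adj] (S : Finset (V × V × V)) (u v : V) (w : ℕ) :
    Prop :=
  G.Adj u v ∧ 7 ≤ deg G v ∧ w ≤ 6 ∧ (IsFree G S v ∨ (7 ≤ (nbrs S v).card ∧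
    ∀ p q, (u, p, v) ∈ S → (u, v, q) ∈ S → Cap (nbrs S v).card (large G p + large G q) w))

namespace IsReduced

theorem subset_nbrs (h : IsReduced G A S) {v : V} (hv : v ∈ A)
    (h2 : ∀ u, G.Adj v u → deg G u ≠ 2) : G.neighborFinset v ⊆ nbrs S v := fun u hu => by
  rw [G.mem_neighborFinset] at hu
  exact mem_nbrs.2 (h.edge v u hu ((h.mem_iff v).1 hv) (h2 u hu))

theorem isFree_of_adj (h : IsReduced G A S) {u v : V} (hv : v ∈ A) (hvu : G.Adj v u)
    (hu : deg G u = 2) : IsFree G S v := by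
  have h1 : 1 ≤ nDegEq G v 2 := by
    rw [nDegEq_eq, Finset.one_le_card]
    exact ⟨u, by simp [hvu, hu]⟩
  have h2 : ¬ (deg G v : ℤ) - 7 ≤ nDegLe G v 8 := fun h2 => h.not_A2 ⟨v, h1, Or.inl h2⟩
  rw [nDegEq_eq] at h1
  rw [nDegLe_eq] at h2
  have h3 : (G.neighborFinset v).filter (fun u => ¬ deg G u = 2) ⊆ nbrs S v := fun u hu => by
    rw [Finset.mem_filter, G.mem_neighborFinset] at hu
    exact mem_nbrs.2 (h.edge v u hu.1 ((h.mem_iff v).1 hv) hu.2)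
  have h3 := Finset.card_le_card h3
  have h4 := Finset.card_filter_add_card_filter_not (s := G.neighborFinset v)
    (fun u => deg G u = 2)
  have h5 : ((G.neighborFinset v).filter fun u => 3 ≤ deg G u ∧ deg G u ≤ 5).card +
      ((G.neighborFinset v).filter fun u => deg G u = 2).card ≤
      ((G.neighborFinset v).filter fun u => deg G u ≤ 8).card := by
    rw [← Finset.card_union_of_disjoint (Finset.disjoint_filter.2 fun u _ h6 h7 => by omega)]
    refine Finset.card_le_card fun u hu => ?_
    simp only [Finset.mem_union, Finset.mem_filter] at hu ⊢
    rcases hu with hu | hu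
    · exact ⟨hu.1, by omega⟩
    · exact ⟨hu.1, by omega⟩
  rw [card_neighborFinset] at h4
  unfold IsFree
  omega

theorem isFree_or (h : IsReduced G A S) {v : V} (hv : v ∈ A) :
    IsFree G S v ∨ G.neighborFinset v ⊆ nbrs S v := by
  by_cases h2 : ∃ u, G.Adj v u ∧ deg G u = 2
  · obtain ⟨u, hu, hu2⟩ := h2
    exact Or.inl (h.isFree_of_adj hv hu hu2)
  · push Not at h2
    exact Or.inr (h.subset_nbrs hv h2)

theorem isFree_or_deg_le (h : IsReduced G A S) {v : V} (hv : v ∈ A) :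
    IsFree G S v ∨ deg G v ≤ (nbrs S v).card :=
  (h.isFree_or hv).imp_right fun h1 => card_neighborFinset G v ▸ Finset.card_le_card h1

/-- A neighbour of a `3`-vertex all of whose neighbours on the link are adjacent to it too. -/
theorem isFree_or_eleven_le (h : IsReduced G A S) {u v p q : V} (huv : G.Adj u v)
    (hu : deg G u = 3) (hpq : p ≠ q) (hp : G.Adj u p) (hq : G.Adj u q) (hvp : IsEdge S v p)
    (hvq : IsEdge S v q) : IsFree G S v ∨ 11 ≤ (nbrs S v).card := by
  have h9 := h.nine_le_deg huv hu
  refine or_iff_not_imp_left.2 fun hfree => ?_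
  have hsub := (h.isFree_or ((h.mem_iff v).2 (by omega))).resolve_left hfree
  have hle := Finset.card_le_card hsub
  rw [← mem_nbrs] at hvp hvq
  rw [card_neighborFinset] at hle
  have hA3 : ¬ ((deg G v = 9 ∧ ∃ w, G.Adj u w ∧ G.Adj v w) ∨ (deg G v = 10 ∧ 5 ≤ nDegLe G v 5 ∧
       ∃ w₁ w₂, w₁ ≠ w₂ ∧ G.Adj u w₁ ∧ G.Adj v w₁ ∧ G.Adj u w₂ ∧ G.Adj v w₂)) :=
    fun h3 => h.not_A3 ⟨u, v, huv, hu, Or.inr h3⟩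
  have hins : ∀ x, x ∈ nbrs S v → ¬ G.Adj v x → deg G v + 1 ≤ (nbrs S v).card := by
    intro x hx hvx
    rw [← card_neighborFinset, ← Finset.card_insert_of_notMem (a := x) (by simpa using hvx)]
    exact Finset.card_le_card (Finset.insert_subset hx hsub)
  rcases (by omega : deg G v = 9 ∨ deg G v = 10 ∨ 11 ≤ deg G v) with h9 | h10 | h11
  · have hvp' : ¬ G.Adj v p := fun h1 => hA3 (Or.inl ⟨h9, p, hp, h1⟩)
    have hvq' : ¬ G.Adj v q := fun h1 => hA3 (Or.inl ⟨h9, q, hq, h1⟩)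
    have h1 := Finset.card_le_card (Finset.insert_subset hvp (Finset.insert_subset hvq hsub))
    rw [Finset.card_insert_of_notMem (by simp [hpq, hvp']),
      Finset.card_insert_of_notMem (by simp [hvq']), card_neighborFinset] at h1
    omega
  · have h5 : 5 ≤ nDegLe G v 5 := by
      by_contra! h5
      refine hfree ?_
      rw [nDegLe_eq] at h5
      have : ((G.neighborFinset v).filter fun u => 3 ≤ deg G u ∧ deg G u ≤ 5).card ≤ _ :=
        Finset.card_le_card (Finset.monotone_filter_right _ fun _ _ h => h.2)
      unfold IsFree
      omega
    by_cases hvp' : G.Adj v p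
    · have := hins q hvq fun hvq' => hA3 (Or.inr ⟨h10, h5, p, q, hpq, hp, hvp', hq, hvq'⟩)
      omega
    · have := hins p hvp hvp'
      omega
  · omega

end IsReduced

end Discharging

namespace Triangulation

variable {V : Type*} [DecidableEq V] {A : Finset V} {S : Finset (V × V × V)}

theorem mem_nbrs_prev {u v p : V} (hp : (u, p, v) ∈ S) : p ∈ nbrs S u := mem_nbrs.2 ⟨_, hp⟩

namespace IsSphere

theorem mem_nbrs_next (h : IsSphere A S) {u v q : V} (hq : (u, v, q) ∈ S) : q ∈ nbrs S u :=
  mem_nbrs.2 (h.edge₃ hq)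

theorem prev_ne_next (h : IsSphere A S) {u v p q : V} (h3 : 3 ≤ (nbrs S u).card)
    (hp : (u, p, v) ∈ S) (hq : (u, v, q) ∈ S) : p ≠ q := by
  rintro rfl
  have hsub : nbrs S u ⊆ {p, v} := by
    intro z hz
    obtain ⟨c, hc⟩ := mem_nbrs.1 hz
    have := h.link u (fun b => b = p ∨ b = v) (by
      rintro b c hbc (rfl | rfl)
      · exact Or.inr (h.uniq hbc hp)
      · exact Or.inl (h.uniq hbc hq)) p v z c hp hc (Or.inl rfl)
    simpa using this
  have h1 := Finset.card_le_card hsub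
  have h2 := Finset.card_le_two (a := p) (b := v)
  omega

/-- A distribution of charge over the neighbours of `u` which spares `z` and gives less to the two
neighbours of `z` on the link. -/
theorem exists_distribution (h : IsSphere A S) {u z : V} (h3 : 3 ≤ (nbrs S u).card)
    (hz : z ∈ nbrs S u) (a : ℕ) : ∃ w : V → ℕ,
      ∑ v ∈ nbrs S u, w v + 4 * a = 2 * a * (nbrs S u).card ∧ ∀ v, w v ≠ 0 → v ∈ nbrs S u ∧ v ≠ z ∧
        (w v = a ∨ (w v = 2 * a ∧ ∀ p q, (u, p, v) ∈ S → (u, v, q) ∈ S → p ≠ z ∧ q ≠ z)) := by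
  obtain ⟨q, hq⟩ := mem_nbrs.1 hz
  obtain ⟨p, hp⟩ := h.exists_prev hq
  have hpq := h.prev_ne_next h3 hp hq
  have hzp := h.ne₂ hp
  have hzq := h.ne₂ hq
  refine ⟨fun v => if v ∉ nbrs S u ∨ v = z then 0 else if v = p ∨ v = q then a else 2 * a, ?_, ?_⟩
  · have h1 : ∀ v ∈ nbrs S u,
        (if v ∉ nbrs S u ∨ v = z then 0 else if v = p ∨ v = q then a else 2 * a) +
          ((if v = z then 2 * a else 0) + (if v = p then a else 0) + if v = q then a else 0) =
        2 * a := by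
      intro v hv
      by_cases h1 : v = z
      · subst h1
        simp [hv, hzp.symm, hzq]
      by_cases h2 : v = p
      · subst h2
        simp [hv, h1, hpq, two_mul]
      by_cases h4 : v = q
      · subst h4
        simp [hv, h1, hpq.symm, two_mul]
      · simp [hv, h1, h2, h4]
    have h2 := Finset.sum_congr rfl h1
    simp only [Finset.sum_add_distrib, Finset.sum_ite_eq', Finset.sum_const, smul_eq_mul, hz,
      mem_nbrs_prev hp, h.mem_nbrs_next hq, if_true] at h2
    rw [mul_comm (2 * a), ← h2]
    ring
  · intro v hv
    dsimp only at hv ⊢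
    split_ifs at hv ⊢ with h1 h2
    · exact absurd rfl hv
    · push Not at h1
      exact ⟨h1.1, h1.2, Or.inl rfl⟩
    · push Not at h1
      refine ⟨h1.1, h1.2, Or.inr ⟨rfl, fun p' q' hp' hq' => ⟨?_, ?_⟩⟩⟩
      · rintro rfl
        exact h2 (Or.inr (h.uniq hp' hq))
      · rintro rfl
        exact h2 (Or.inl (h.prev_uniq hq' hp))

end IsSphere

end Triangulation

namespace Discharging

open Triangulation

variable {V : Type*} [Fintype V] [DecidableEq V] {G : SimpleGraph V} [DecidableRel G.Adj]
  {A : Finset V} {S : Finset (V × V × V)}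

theorem CanGive.of_cap {u v : V} {w k : ℕ} (huv : G.Adj u v) (hv : 7 ≤ deg G v)
    (hw : w ≤ 6) (hfree : IsFree G S v ∨ k ≤ (nbrs S v).card) (h7 : 7 ≤ k)
    (hcap : ∀ p q, (u, p, v) ∈ S → (u, v, q) ∈ S → ∀ t, k ≤ t →
      Cap t (large G p + large G q) w) : CanGive G S u v w :=
  ⟨huv, hv, hw, hfree.imp_right fun ht => ⟨h7.trans ht, fun p q hp hq => hcap p q hp hq _ ht⟩⟩

namespace IsReduced

theorem canGive (h : IsReduced G A S) {u v : V} {w : ℕ} (huv : G.Adj u v) (hv : 7 ≤ deg G v)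
    (hw : w ≤ 6) (hcap : ∀ p q, (u, p, v) ∈ S → (u, v, q) ∈ S → ∀ t, deg G v ≤ t →
      Cap t (large G p + large G q) w) : CanGive G S u v w :=
  .of_cap huv hv hw (h.isFree_or_deg_le ((h.mem_iff v).2 (by omega))) hv hcap

theorem exists_charge_of_subset (M : Finset V) (c : ℕ) {u : V} (hM : M ⊆ nbrs S u)
    (h : ∀ v ∈ M, CanGive G S u v c) : ∃ w : V → ℕ, c * M.card ≤ ∑ v ∈ nbrs S u, w v ∧
      ∀ v, w v ≠ 0 → CanGive G S u v (w v) := by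
  refine ⟨fun v => if v ∈ M then c else 0, ?_, fun v hv => ?_⟩
  · rw [Finset.sum_ite_mem, Finset.inter_eq_right.2 hM, Finset.sum_const, smul_eq_mul, mul_comm]
  · by_cases hvM : v ∈ M
    · simpa [hvM] using h v hvM
    · simp [hvM] at hv

/-- A vertex of degree three in the triangulation. -/
theorem charge_three (h : IsReduced G A S) {u : V} (h3 : (nbrs S u).card = 3) (hu : deg G u = 3)
    (hadj : ∀ v, v ∈ nbrs S u ↔ G.Adj u v) : ∃ w : V → ℕ, 18 ≤ ∑ v ∈ nbrs S u, w v ∧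
      ∀ v, w v ≠ 0 → CanGive G S u v (w v) := by
  have := exists_charge_of_subset (G := G) (nbrs S u) 6 subset_rfl fun v hv => by
    have hv' := (hadj v).1 hv
    have h9 := h.nine_le_deg hv' hu
    obtain ⟨q, hq⟩ := mem_nbrs.1 hv
    obtain ⟨p, hp⟩ := h.sphere.exists_prev hq
    refine CanGive.of_cap (k := 11) hv' (by omega) le_rfl (h.isFree_or_eleven_le hv' hu
      (h.sphere.prev_ne_next h3.ge hp hq) ((hadj p).1 (mem_nbrs_prev hp))
      ((hadj q).1 (h.sphere.mem_nbrs_next hq))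
      (h.sphere.edge_symm (h.sphere.edge₂ hp)) (h.sphere.edge₂ hq)) (by norm_num) ?_
    intro p q hp hq t ht
    have h1 := large_eq_one.2 ((h.nine_le_deg ((hadj p).1 (mem_nbrs_prev hp)) hu).trans'
      (by norm_num))
    have h2 := large_eq_one.2 ((h.nine_le_deg ((hadj q).1 (h.sphere.mem_nbrs_next hq)) hu).trans'
      (by norm_num))
    unfold Cap
    omega
  rwa [h3] at this

/-- A vertex of degree four in the triangulation one of whose neighbours gives nothing. -/
theorem charge_four_of_hole (h : IsReduced G A S) {u : V} (h4 : (nbrs S u).card = 4) {z : V}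
    (hz : z ∈ nbrs S u) (hadj : ∀ v ∈ nbrs S u, v ≠ z → G.Adj u v)
    (hdeg : ∀ v ∈ nbrs S u, v ≠ z → deg G u = 3 ∨ 11 ≤ deg G v) :
    ∃ w : V → ℕ, 12 ≤ ∑ v ∈ nbrs S u, w v ∧ ∀ v, w v ≠ 0 → CanGive G S u v (w v) := by
  obtain ⟨w, hw, hw'⟩ := h.sphere.exists_distribution (by omega) hz 3
  rw [h4] at hw
  refine ⟨w, by omega, fun v hv => ?_⟩
  obtain ⟨hv, hvz, hwv⟩ := hw' v hv
  have hv' := hadj v hv hvz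
  have h9 : ∀ v ∈ nbrs S u, v ≠ z → 9 ≤ deg G v := fun v hv hvz =>
    (hdeg v hv hvz).elim (h.nine_le_deg (hadj v hv hvz)) (le_trans (by norm_num))
  have hv9 := h9 v hv hvz
  have hl : ∀ v ∈ nbrs S u, v ≠ z → large G v = 1 := fun v hv hvz =>
    large_eq_one.2 ((h9 v hv hvz).trans' (by norm_num))
  rcases hwv with hwv | ⟨hwv, hpqz⟩
  · rw [hwv]
    refine h.canGive hv' (by omega) (by norm_num) fun p q hp hq t ht => ?_
    have hpq := h.sphere.prev_ne_next (by omega) hp hq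
    have h1 := hl p (mem_nbrs_prev hp)
    have h2 := hl q (h.sphere.mem_nbrs_next hq)
    have : large G p = 1 ∨ large G q = 1 := by
      by_cases hpz : p = z
      · exact Or.inr (h2 (hpz ▸ hpq.symm))
      · exact Or.inl (h1 hpz)
    unfold Cap
    omega
  · rw [hwv]
    have hfree : IsFree G S v ∨ 11 ≤ (nbrs S v).card := by
      obtain ⟨q, hq⟩ := mem_nbrs.1 hv
      obtain ⟨p, hp⟩ := h.sphere.exists_prev hq
      obtain ⟨hpz, hqz⟩ := hpqz p q hp hq
      rcases hdeg v hv hvz with hu | h11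
      · exact h.isFree_or_eleven_le hv' hu (h.sphere.prev_ne_next (by omega) hp hq)
          (hadj p (mem_nbrs_prev hp) hpz) (hadj q (h.sphere.mem_nbrs_next hq) hqz)
          (h.sphere.edge_symm (h.sphere.edge₂ hp)) (h.sphere.edge₂ hq)
      · exact (h.isFree_or_deg_le ((h.mem_iff v).2 (by omega))).imp_right h11.trans
    refine CanGive.of_cap (k := 11) hv' (by omega) (by norm_num) hfree (by norm_num)
      fun p q hp hq t ht => ?_
    obtain ⟨hpz, hqz⟩ := hpqz p q hp hq
    have h1 := hl p (mem_nbrs_prev hp) hpz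
    have h2 := hl q (h.sphere.mem_nbrs_next hq) hqz
    unfold Cap
    omega

/-- A vertex of degree five in the triangulation one of whose neighbours gives nothing. -/
theorem charge_five_of_hole (h : IsReduced G A S) {u : V} (h5 : (nbrs S u).card = 5) {z : V}
    (hz : z ∈ nbrs S u) (hadj : ∀ v ∈ nbrs S u, v ≠ z → G.Adj u v ∧ 7 ≤ deg G v) :
    ∃ w : V → ℕ, 6 ≤ ∑ v ∈ nbrs S u, w v ∧ ∀ v, w v ≠ 0 → CanGive G S u v (w v) := by
  obtain ⟨w, hw, hw'⟩ := h.sphere.exists_distribution (by omega) hz 1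
  rw [h5] at hw
  refine ⟨w, by omega, fun v hv => ?_⟩
  obtain ⟨hv, hvz, hwv⟩ := hw' v hv
  obtain ⟨hv', h7⟩ := hadj v hv hvz
  have hl : ∀ v ∈ nbrs S u, v ≠ z → large G v = 1 := fun v hv hvz =>
    large_eq_one.2 ((hadj v hv hvz).2.trans' (by norm_num))
  refine h.canGive hv' h7 (by omega) fun p q hp hq t ht => ?_
  have hpq := h.sphere.prev_ne_next (by omega) hp hq
  have h1 := hl p (mem_nbrs_prev hp)
  have h2 := hl q (h.sphere.mem_nbrs_next hq)
  have h3 : large G p = 1 ∨ large G q = 1 := by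
    by_cases hpz : p = z
    · exact Or.inr (h2 (hpz ▸ hpq.symm))
    · exact Or.inl (h1 hpz)
  have h4 : w v = 1 ∨ w v = 2 ∧ large G p = 1 ∧ large G q = 1 := hwv.imp_right fun h =>
    ⟨h.1, h1 (h.2 p q hp hq).1, h2 (h.2 p q hp hq).2⟩
  unfold Cap
  omega

end IsReduced

end Discharging

namespace Discharging

open Triangulation

variable {V : Type*} [Fintype V] [DecidableEq V] {G : SimpleGraph V} [DecidableRel G.Adj]
  {A : Finset V} {S : Finset (V × V × V)}

namespace IsReduced

theorem four_le_deg (h : IsReduced G A S) {u v : V} (huv : G.Adj u v) (hu : deg G u ≤ 8) :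
    4 ≤ deg G v := by
  have h1 := h.deg_ne_two huv (by omega)
  have h2 := h.two_le v
  have h3 := h.nine_le_deg huv.symm
  omega

theorem exists_of_deg_eq_four (h : IsReduced G A S) {u : V} (hu : deg G u = 4) :
    ∃ a, G.Adj u a ∧ ((∀ v, G.Adj u v → 8 ≤ deg G v) ∨ ∀ v, G.Adj u v → v ≠ a → 11 ≤ deg G v) := by
  obtain ⟨l, hsort, hnd, hlen, hmem⟩ := (G.neighborFinset u).exists_sorted_list (deg G)
  rw [card_neighborFinset, hu] at hlen
  rcases l with _ | ⟨a, _ | ⟨b, _ | ⟨c, _ | ⟨d, _ | ⟨e, l⟩⟩⟩⟩⟩ <;>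
    simp only [List.length_cons, List.length_nil] at hlen <;> try omega
  simp only [G.mem_neighborFinset, List.mem_cons, List.not_mem_nil, or_false] at hmem
  simp only [List.pairwise_cons, List.mem_cons, List.not_mem_nil, or_false, forall_eq_or_imp,
    forall_eq, IsEmpty.forall_iff, implies_true, List.Pairwise.nil, and_true] at hsort
  have ha : G.Adj u a := (hmem a).1 (by simp)
  have h4 := h.four_le_deg ha (by omega)
  have hA4 : ¬ (4 ≤ deg G a ∧ deg G a ≤ 7 ∧ deg G a + deg G b ≤ 17) := fun hcon =>
    h.not_A4 (Or.inl ⟨u, a, b, c, d, hu, ha, (hmem b).1 (by simp), (hmem c).1 (by simp),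
      (hmem d).1 (by simp), hnd, by omega, by omega, by omega, hcon⟩)
  refine ⟨a, ha, ?_⟩
  simp only [← hmem]
  by_cases h8 : 8 ≤ deg G a
  · refine Or.inl ?_
    rintro v (rfl | rfl | rfl | rfl) <;> omega
  · refine Or.inr ?_
    rintro v (rfl | rfl | rfl | rfl) hv <;> first | exact absurd rfl hv | omega

theorem exists_of_deg_eq_five (h : IsReduced G A S) {u : V} (hu : deg G u = 5) :
    ∃ a b m, G.Adj u a ∧ G.Adj u b ∧ a ≠ b ∧ (∀ v, G.Adj u v → v ≠ a → v ≠ b → m ≤ deg G v) ∧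
      (9 ≤ m ∨ (8 ≤ m ∧ 6 ≤ deg G b) ∨ (7 ≤ m ∧ 6 ≤ deg G a ∧ 6 ≤ deg G b) ∨
        (7 ≤ m ∧ 7 ≤ deg G b)) := by
  obtain ⟨l, hsort, hnd, hlen, hmem⟩ := (G.neighborFinset u).exists_sorted_list (deg G)
  rw [card_neighborFinset, hu] at hlen
  rcases l with _ | ⟨a, _ | ⟨b, _ | ⟨c, _ | ⟨d, _ | ⟨e, _ | ⟨f, l⟩⟩⟩⟩⟩⟩ <;>
    simp only [List.length_cons, List.length_nil] at hlen <;> try omega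
  simp only [G.mem_neighborFinset, List.mem_cons, List.not_mem_nil, or_false] at hmem
  simp only [List.pairwise_cons, List.mem_cons, List.not_mem_nil, or_false, forall_eq_or_imp,
    forall_eq, IsEmpty.forall_iff, implies_true, List.Pairwise.nil, and_true] at hsort
  have ha : G.Adj u a := (hmem a).1 (by simp)
  have hb : G.Adj u b := (hmem b).1 (by simp)
  have h4 := h.four_le_deg ha (by omega)
  have hA4 : ¬ (4 ≤ deg G a ∧ deg G a ≤ 6 ∧ deg G a + deg G b + deg G c ≤ 18) := fun hcon =>
    h.not_A4 (Or.inr ⟨u, a, b, c, d, e, hu, ha, hb, (hmem c).1 (by simp), (hmem d).1 (by simp),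
      (hmem e).1 (by simp), hnd, by omega, by omega, by omega, by omega, Or.inl hcon⟩)
  refine ⟨a, b, deg G c, ha, hb, ?_, ?_, by omega⟩
  · rintro rfl
    simp at hnd
  · simp only [← hmem]
    rintro v (rfl | rfl | rfl | rfl | rfl) hva hvb <;>
      first | exact absurd rfl hva | exact absurd rfl hvb | omega

/-- Every vertex of degree at most five in the triangulation can receive enough charge. -/
theorem exists_charge (h : IsReduced G A S) {u : V} (hu : u ∈ A) (ht : (nbrs S u).card ≤ 5) :
    ∃ w : V → ℕ, 36 ≤ ∑ v ∈ nbrs S u, w v + 6 * (nbrs S u).card ∧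
      ∀ v, w v ≠ 0 → CanGive G S u v (w v) := by
  have hsub := (h.isFree_or hu).resolve_left (by unfold IsFree; omega)
  have hle := Finset.card_le_card hsub
  rw [card_neighborFinset] at hle
  have h2 := (h.mem_iff u).1 hu
  have h3 := h.two_le u
  have hadj : deg G u = (nbrs S u).card → ∀ v, v ∈ nbrs S u ↔ G.Adj u v := fun he v => by
    rw [← Finset.eq_of_subset_of_card_le hsub (by rw [card_neighborFinset, he]),
      G.mem_neighborFinset]
  have hsubset : ∀ M ⊆ nbrs S u, ∀ c, 36 ≤ c * M.card + 6 * (nbrs S u).card →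
      (∀ v ∈ M, CanGive G S u v c) → ∃ w : V → ℕ,
        36 ≤ ∑ v ∈ nbrs S u, w v + 6 * (nbrs S u).card ∧
        ∀ v, w v ≠ 0 → CanGive G S u v (w v) := fun M hM c hc hMc =>
    (exists_charge_of_subset M c hM hMc).imp fun _ hw => ⟨by omega, hw.2⟩
  rcases (by omega : deg G u = 3 ∨ deg G u = 4 ∨ deg G u = 5) with hu3 | hu4 | hu5
  · rcases (by omega : (nbrs S u).card = 3 ∨ (nbrs S u).card = 4 ∨ (nbrs S u).card = 5) with
      ht | ht | ht
    · exact (h.charge_three ht hu3 (hadj (by omega))).imp fun _ hw => ⟨by omega, hw.2⟩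
    · obtain ⟨z, hz, hzN⟩ := Finset.exists_mem_notMem_of_card_lt_card
        (show (G.neighborFinset u).card < (nbrs S u).card by rw [card_neighborFinset]; omega)
      have heq : G.neighborFinset u = (nbrs S u).erase z :=
        Finset.eq_of_subset_of_card_le (Finset.subset_erase.2 ⟨hsub, hzN⟩)
          (by rw [Finset.card_erase_of_mem hz, card_neighborFinset]; omega)
      exact (h.charge_four_of_hole ht hz (fun v hv hvz => by
        rw [← G.mem_neighborFinset, heq]
        exact Finset.mem_erase.2 ⟨hvz, hv⟩) fun _ _ _ => Or.inl hu3).imp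
          fun _ hw => ⟨by omega, hw.2⟩
    · refine hsubset _ hsub 2 (by rw [card_neighborFinset]; omega) fun v hv => ?_
      rw [G.mem_neighborFinset] at hv
      have h9 := h.nine_le_deg hv hu3
      refine h.canGive hv (by omega) (by norm_num) fun p q _ _ t ht => ?_
      unfold Cap
      omega
  · obtain ⟨a, ha, hdeg⟩ := h.exists_of_deg_eq_four hu4
    rcases (by omega : (nbrs S u).card = 4 ∨ (nbrs S u).card = 5) with ht | ht
    · have hadj := hadj (by omega)
      rcases hdeg with hdeg | hdeg
      · refine hsubset _ hsub 3 (by rw [card_neighborFinset]; omega) fun v hv => ?_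
        rw [G.mem_neighborFinset] at hv
        have h8 := hdeg v hv
        refine h.canGive hv (by omega) (by norm_num) fun p q hp hq t ht => ?_
        have h1 := large_eq_one.2 ((hdeg p ((hadj p).1 (mem_nbrs_prev hp))).trans' (by norm_num))
        have h2 := large_eq_one.2
          ((hdeg q ((hadj q).1 (h.sphere.mem_nbrs_next hq))).trans' (by norm_num))
        unfold Cap
        omega
      · exact (h.charge_four_of_hole ht ((hadj a).2 ha) (fun v hv _ => (hadj v).1 hv)
          fun v hv hva => Or.inr (hdeg v ((hadj v).1 hv) hva)).imp fun _ hw => ⟨by omega, hw.2⟩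
    · have haN := (G.mem_neighborFinset u a).2 ha
      refine hsubset ((G.neighborFinset u).erase a) ((Finset.erase_subset _ _).trans hsub) 2
        (by rw [Finset.card_erase_of_mem haN, card_neighborFinset]; omega) fun v hv => ?_
      rw [Finset.mem_erase, G.mem_neighborFinset] at hv
      rcases hdeg with hdeg | hdeg
      · have h8 := hdeg v hv.2
        refine h.canGive hv.2 (by omega) (by norm_num) fun p q hp hq t ht' => ?_
        have hpq := h.sphere.prev_ne_next (by omega) hp hq
        have : large G p = 1 ∨ large G q = 1 := by
          by_contra! hcon
          simp only [ne_eq, large_eq_one] at hcon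
          have hp' : p ∉ G.neighborFinset u := fun h1 => hcon.1
            ((hdeg p ((G.mem_neighborFinset u p).1 h1)).trans' (by norm_num))
          have hq' : q ∉ G.neighborFinset u := fun h1 => hcon.2
            ((hdeg q ((G.mem_neighborFinset u q).1 h1)).trans' (by norm_num))
          have h1 := Finset.card_le_card (Finset.insert_subset (mem_nbrs_prev hp)
            (Finset.insert_subset (h.sphere.mem_nbrs_next hq) hsub))
          rw [Finset.card_insert_of_notMem (by simpa [hpq] using hp'),
            Finset.card_insert_of_notMem hq', card_neighborFinset] at h1
          omega
        unfold Cap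
        omega
      · have h11 := hdeg v hv.2 hv.1
        refine h.canGive hv.2 (by omega) (by norm_num) fun p q _ _ t ht' => ?_
        unfold Cap
        omega
  · have ht : (nbrs S u).card = 5 := by omega
    have hadj := hadj (by omega)
    obtain ⟨a, b, m, ha, hb, hab, hm, hcase⟩ := h.exists_of_deg_eq_five hu5
    by_cases hhole : 7 ≤ m ∧ 7 ≤ deg G b
    · refine (h.charge_five_of_hole ht ((hadj a).2 ha) fun v hv hva => ?_).imp
        fun _ hw => ⟨by omega, hw.2⟩
      have hv' := (hadj v).1 hv
      refine ⟨hv', ?_⟩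
      by_cases hvb : v = b
      · exact hvb ▸ hhole.2
      · exact hhole.1.trans (hm v hv' hva hvb)
    have hbN := (G.mem_neighborFinset u b).2 hb
    have haN : a ∈ (G.neighborFinset u).erase b :=
      Finset.mem_erase.2 ⟨hab, (G.mem_neighborFinset u a).2 ha⟩
    refine hsubset (((G.neighborFinset u).erase b).erase a)
      ((Finset.erase_subset _ _).trans ((Finset.erase_subset _ _).trans hsub)) 2
      (by rw [Finset.card_erase_of_mem haN, Finset.card_erase_of_mem hbN, card_neighborFinset]
          omega) fun v hv => ?_
    rw [Finset.mem_erase, Finset.mem_erase, G.mem_neighborFinset] at hv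
    obtain ⟨hva, hvb, hv⟩ := hv
    have hvm := hm v hv hva hvb
    refine h.canGive hv (by omega) (by norm_num) fun p q hp hq t ht' => ?_
    have hpq := h.sphere.prev_ne_next (by omega) hp hq
    have hl : ∀ x ∈ nbrs S u, (x = a → 6 ≤ deg G a) → (x = b → 6 ≤ deg G b) → 6 ≤ m →
        large G x = 1 := by
      intro x hx hxa hxb h6
      rw [large_eq_one]
      by_cases hxa' : x = a
      · exact hxa' ▸ hxa hxa'
      by_cases hxb' : x = b
      · exact hxb' ▸ hxb hxb'
      · exact h6.trans (hm x ((hadj x).1 hx) hxa' hxb')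
    have hp := hl p (mem_nbrs_prev hp)
    have hq := hl q (h.sphere.mem_nbrs_next hq)
    rcases (by omega : 9 ≤ m ∨ (8 ≤ m ∧ 6 ≤ deg G b) ∨ (7 ≤ m ∧ 6 ≤ deg G a ∧ 6 ≤ deg G b)) with
      h9 | ⟨h8, h6⟩ | ⟨h7, h6, h6'⟩
    · unfold Cap
      omega
    · have : large G p = 1 ∨ large G q = 1 := by
        by_cases hpa : p = a
        · exact Or.inr (hq (fun hqa => absurd (hpa.trans hqa.symm) hpq) (fun _ => h6) (by omega))
        · exact Or.inl (hp (fun h => absurd h hpa) (fun _ => h6) (by omega))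
      unfold Cap
      omega
    · have h1 := hp (fun _ => h6) (fun _ => h6') (by omega)
      have h2 := hq (fun _ => h6) (fun _ => h6') (by omega)
      unfold Cap
      omega

/-- The charges sent from `v` do not exceed what `v` can afford. -/
theorem sum_le (h : IsReduced G A S) {v : V} {f : V → ℕ}
    (hf : ∀ u, f u ≠ 0 → 3 ≤ deg G u ∧ deg G u ≤ 5 ∧ CanGive G S u v (f u)) :
    6 * 6 + ∑ u ∈ nbrs S v, f u ≤ 6 * (nbrs S v).card ∨ ∀ u, f u = 0 := by
  refine or_iff_not_imp_right.2 fun hne => ?_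
  push Not at hne
  obtain ⟨u₀, hu₀⟩ := hne
  obtain ⟨-, -, -, hv, -, h0⟩ := hf u₀ hu₀
  by_cases hfree : IsFree G S v
  · have h1 : ∑ u ∈ nbrs S v, f u ≤
        ∑ u ∈ (G.neighborFinset v).filter fun u => 3 ≤ deg G u ∧ deg G u ≤ 5, f u := by
      rw [← Finset.sum_filter_ne_zero]
      refine Finset.sum_le_sum_of_subset fun u hu => ?_
      rw [Finset.mem_filter] at hu
      obtain ⟨h3, h5, hadj, -⟩ := hf u hu.2
      exact Finset.mem_filter.2 ⟨(G.mem_neighborFinset v u).2 hadj.symm, h3, h5⟩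
    have h2 : ∑ u ∈ (G.neighborFinset v).filter (fun u => 3 ≤ deg G u ∧ deg G u ≤ 5), f u ≤
        ((G.neighborFinset v).filter fun u => 3 ≤ deg G u ∧ deg G u ≤ 5).card * 6 :=
      Finset.sum_le_card_nsmul _ _ _ fun u _ => by
        by_cases hu : f u = 0
        · omega
        · exact (hf u hu).2.2.2.2.1
    unfold IsFree at hfree
    omega
  · have h7 := (h0.resolve_left hfree).1
    have := h.sphere.sum_le_of_cap (v := v) (w := f) (nb := large G) h7 (large_le_one G)
      (fun u hu => by
        by_contra hcon
        have := (hf u hcon).2.1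
        rw [large_eq_one] at hu
        omega) (fun u p q hp hq => by
        by_cases hu : f u = 0
        · rw [hu]
          unfold Cap
          omega
        · exact (((hf u hu).2.2.2.2.2).resolve_left hfree).2 p q (h.sphere.cyc hp)
            (h.sphere.cyc (h.sphere.cyc hq)))
    omega

end IsReduced

theorem not_isReduced (h : IsReduced G A S) : False := by
  have hw : ∀ u, ∃ w : V → ℕ, (u ∈ A → (nbrs S u).card ≤ 5 →
      36 ≤ ∑ v ∈ nbrs S u, w v + 6 * (nbrs S u).card) ∧
      ∀ v, w v ≠ 0 → (3 ≤ deg G u ∧ deg G u ≤ 5) ∧ CanGive G S u v (w v) := by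
    intro u
    by_cases hu : u ∈ A ∧ (nbrs S u).card ≤ 5
    · obtain ⟨w, hw, hw'⟩ := h.exists_charge hu.1 hu.2
      refine ⟨w, fun _ _ => hw, fun v hv => ⟨?_, hw' v hv⟩⟩
      have h1 := (h.isFree_or_deg_le hu.1).resolve_left (by unfold IsFree; omega)
      have h2 := (h.mem_iff u).1 hu.1
      have h3 := h.two_le u
      omega
    · exact ⟨0, fun h1 h2 => absurd ⟨h1, h2⟩ hu, fun v hv => absurd rfl hv⟩
  choose w hw hw' using hw
  have hbal : ∀ v ∈ A, 6 * 6 + ∑ u ∈ nbrs S v, w u v ≤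
      6 * (nbrs S v).card + ∑ u ∈ nbrs S v, w v u := by
    intro v hv
    rcases h.sum_le (v := v) (f := fun u => w u v)
      (fun u hu => ⟨(hw' u v hu).1.1, (hw' u v hu).1.2, (hw' u v hu).2⟩) with h1 | h1
    · omega
    · rw [Finset.sum_eq_zero fun u _ => h1 u]
      by_cases ht : (nbrs S v).card ≤ 5
      · have := hw v hv ht
        omega
      · omega
  have hswap : ∑ v ∈ A, ∑ u ∈ nbrs S v, w u v = ∑ v ∈ A, ∑ u ∈ nbrs S v, w v u :=
    Finset.sum_comm' fun x y => by
      rw [mem_nbrs, mem_nbrs]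
      exact ⟨fun hxy => ⟨h.sphere.edge_symm hxy.2, h.sphere.edge_mem (h.sphere.edge_symm hxy.2)⟩,
        fun hxy => ⟨h.sphere.edge_mem (h.sphere.edge_symm hxy.1), h.sphere.edge_symm hxy.1⟩⟩
  have h1 := Finset.sum_le_sum hbal
  rw [Finset.sum_add_distrib, Finset.sum_add_distrib, hswap, Finset.sum_const, ← Finset.mul_sum,
    smul_eq_mul] at h1
  have h2 := h.sphere.sum_card_nbrs
  rw [← Nat.cast_sum] at h2
  omega

end Discharging

theorem structural_lemma {V : Type*} [Fintype V] (G : SimpleGraph V)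
    (h2 : TwoConnected G) (hplanar : IsPlanar G) (hΔ : 5 ≤ maxDeg G) :
    ConfigA1 G ∨ ConfigA2 G ∨ ConfigA3 G ∨ ConfigA4 G := by
  classical
  by_contra! ⟨hA1, hA2, hA3, hA4⟩
  obtain ⟨v, hv⟩ : ∃ v, 5 ≤ deg G v := by
    by_contra! hlt
    have : maxDeg G ≤ 4 := Finset.sup_le fun v _ => Nat.le_of_lt_succ (hlt v)
    omega
  let A : Finset V := {v | deg G v ≠ 2}
  have hmem : ∀ v, v ∈ A ↔ deg G v ≠ 2 := fun v => by simp [A]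
  have hcard : 4 ≤ A.card := by
    by_cases hv2 : 1 ≤ nDegEq G v 2
    · have h1 : ¬ (deg G v : ℤ) - 7 ≤ nDegLe G v 8 := fun hcon => hA2 ⟨v, hv2, Or.inl hcon⟩
      have hsub : (G.neighborFinset v).filter (fun w => ¬ deg G w ≤ 8) ⊆ A := fun w hw => by
        rw [Finset.mem_filter] at hw
        exact (hmem w).2 (by omega)
      have hsum := Finset.card_filter_add_card_filter_not (s := G.neighborFinset v)
        (fun w => deg G w ≤ 8)
      rw [← Discharging.nDegLe_eq, Discharging.card_neighborFinset] at hsum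
      have := Finset.card_le_card hsub
      omega
    · rw [Discharging.nDegEq_eq, not_le, Nat.lt_one_iff, Finset.card_eq_zero,
        Finset.filter_eq_empty_iff] at hv2
      have := Finset.card_le_card fun w hw => (hmem w).2 (hv2 hw)
      rw [Discharging.card_neighborFinset] at this
      omega
  let H : SimpleGraph V :=
    { Adj := fun a b => G.Adj a b ∧ deg G a ≠ 2 ∧ deg G b ≠ 2
      symm := ⟨fun _ _ hab => ⟨hab.1.symm, hab.2.2, hab.2.1⟩⟩
      loopless := ⟨fun _ ha => ha.1.ne rfl⟩ }
  obtain ⟨S, hS, hHS⟩ := Triangulation.covers_of_isPlanar A.card A rfl hcard H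
    (fun x _ hxy => (hmem x).2 hxy.2.1) (Minor.isPlanar_mono (fun _ _ hab => hab.1) hplanar)
  exact Discharging.not_isReduced ⟨hS, hmem, Discharging.two_le_deg G h2,
    fun a b hab ha hb => hHS a b ⟨hab, ha, hb⟩, hA1, hA2, hA3, hA4⟩
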